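/- Brieskorn–Deligne theorem: let f ∈ 𝒪₂ with f(0) = 0 and an isolated critical point at 0, with Milnor number μ(f) = dim_ℂ 𝒪₂/(∂_x f, ∂_y f) < ∞. Define H_f = {(a,b) ∈ 𝒪₂² : ∂_x b − ∂_y a ∈ (∂_x f, ∂_y f)} / {(∂_x g + h ∂_x f, ∂_y g + h ∂_y f) : g,h ∈ 𝒪₂} (the first cohomology of the relative de Rham complex of f, a pair (a,b) representing the 1-form a dx + b dy). Then H_f, as a module over the ring ℂ{t} = 𝒪₁ of convergent power series with t acting by [(a,b)] ↦ [(f·a, f·b)], is a free module of rank μ(f). -/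

import Mathlib

open Filter Topology
open scoped Classical

/-- The ring of germs at `0` of holomorphic (analytic) functions on `E`. -/
def Og (E : Type*) [NormedAddCommGroup E] [NormedSpace ℂ E] :
    Subring (Germ (𝓝 (0 : E)) ℂ) where
  carrier := {F | ∃ g : E → ℂ, AnalyticAt ℂ g 0 ∧ F = ↑g}
  one_mem' := ⟨fun _ => 1, analyticAt_const, rfl⟩
  zero_mem' := ⟨fun _ => 0, analyticAt_const, rfl⟩
  mul_mem' := by
    rintro F G ⟨f, hf, rfl⟩ ⟨g, hg, rfl⟩
    exact ⟨f * g, hf.mul hg, (Germ.coe_mul _ _).symm⟩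
  add_mem' := by
    rintro F G ⟨f, hf, rfl⟩ ⟨g, hg, rfl⟩
    exact ⟨f + g, hf.add hg, (Germ.coe_add _ _).symm⟩
  neg_mem' := by
    rintro F ⟨f, hf, rfl⟩
    exact ⟨-f, hf.neg, (Germ.coe_neg _).symm⟩

variable {E F G : Type*} [NormedAddCommGroup E] [NormedSpace ℂ E]
  [NormedAddCommGroup F] [NormedSpace ℂ F] [NormedAddCommGroup G] [NormedSpace ℂ G]

/-- A canonical analytic representative of a germ in `Og E`. -/
noncomputable def Og.rep (f : Og E) : E → ℂ :=
  Classical.choose (f.2 : ∃ g : E → ℂ, AnalyticAt ℂ g 0 ∧ f.1 = ↑g)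

lemma Og.rep_spec (f : Og E) : AnalyticAt ℂ (Og.rep f) 0 ∧ f.1 = ↑(Og.rep f) :=
  Classical.choose_spec (f.2 : ∃ g : E → ℂ, AnalyticAt ℂ g 0 ∧ f.1 = ↑g)

/-- Evaluation at the origin. -/
noncomputable def Og.ev0 (f : Og E) : ℂ := Og.rep f 0

/-- The germ of an analytic function (junk value `0` if not analytic at `0`). -/
noncomputable def Og.mk (g : E → ℂ) : Og E :=
  if h : AnalyticAt ℂ g 0 then ⟨↑g, g, h, rfl⟩ else 0

/-- The constant germ. -/
noncomputable def Og.const (c : ℂ) : Og E := Og.mk (fun _ => c)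

/-- Directional derivative of a germ along the vector `v`. -/
noncomputable def Og.pd (v : E) (f : Og E) : Og E :=
  ⟨↑(fun z => fderiv ℂ (Og.rep f) z v),
   fun z => fderiv ℂ (Og.rep f) z v,
   ((ContinuousLinearMap.apply ℂ ℂ v).analyticAt _).comp (Og.rep_spec f).1.fderiv, rfl⟩

/-- Pull-back of a germ under an analytic map preserving the origin
(junk value `0` otherwise). -/
noncomputable def Og.pull (u : E → F) (f : Og F) : Og E :=
  if h : AnalyticAt ℂ u 0 ∧ u 0 = 0 then
    ⟨↑(fun z => Og.rep f (u z)), fun z => Og.rep f (u z),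
      ((h.2.symm ▸ (Og.rep_spec f).1 : AnalyticAt ℂ (Og.rep f) (u 0))).comp h.1, rfl⟩
  else 0

/-- Composition `ψ ∘ f` of a one-variable germ `ψ` with a germ `f` such that `f(0) = 0`
(junk value `0` if `f(0) ≠ 0`). -/
noncomputable def Og.comp (ψ : Og ℂ) (f : Og E) : Og E :=
  if h : Og.ev0 f = 0 then
    have hψ0 : AnalyticAt ℂ (Og.rep ψ) (0 : ℂ) := (Og.rep_spec ψ).1
    ⟨↑(fun z => Og.rep ψ (Og.rep f z)), fun z => Og.rep ψ (Og.rep f z),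
      (by
        have : Og.rep f 0 = 0 := h
        rw [← this] at hψ0
        exact hψ0.comp (Og.rep_spec f).1 : AnalyticAt ℂ (fun z => Og.rep ψ (Og.rep f z)) 0),
      rfl⟩
  else 0

/-- `∂_x f`, for a germ on `ℂ²`. -/
noncomputable abbrev Og.dx (f : Og (ℂ × ℂ)) : Og (ℂ × ℂ) := Og.pd (1, 0) f
/-- `∂_y f`, for a germ on `ℂ²`. -/
noncomputable abbrev Og.dy (f : Og (ℂ × ℂ)) : Og (ℂ × ℂ) := Og.pd (0, 1) f

/-- The Jacobian ideal `(∂_x f, ∂_y f) ⊆ 𝒪₂` of `f`, as a set. -/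
def jacobianSet (f : Og (ℂ × ℂ)) : Set (Og (ℂ × ℂ)) :=
  {x | ∃ g h : Og (ℂ × ℂ), x = g * Og.dx f + h * Og.dy f}

/-- The Milnor number of `f` is `μ`: the Milnor algebra `𝒪₂/(∂_x f, ∂_y f)` is a
`ℂ`-vector space of dimension `μ` (in particular `f` has an isolated critical point). -/
def HasMilnorNumber (f : Og (ℂ × ℂ)) (μ : ℕ) : Prop :=
  ∃ b : Fin μ → Og (ℂ × ℂ), ∀ u : Og (ℂ × ℂ),
    ∃! c : Fin μ → ℂ, u - ∑ i, Og.const (c i) * b i ∈ jacobianSet f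

/-- Relative de Rham cocycles: pairs `(a,b)`, representing the `1`-form `a dx + b dy`,
with `∂_x b - ∂_y a ∈ (∂_x f, ∂_y f)` (i.e. `dα ∈ df ∧ Ω¹`). -/
def deRhamCocycles (f : Og (ℂ × ℂ)) : Set (Og (ℂ × ℂ) × Og (ℂ × ℂ)) :=
  {u | Og.dx u.2 - Og.dy u.1 ∈ jacobianSet f}

/-- Relative de Rham coboundaries: the forms `dg + h df`,
i.e. pairs `(∂_x g + h ∂_x f, ∂_y g + h ∂_y f)`. -/
def deRhamCoboundaries (f : Og (ℂ × ℂ)) : Set (Og (ℂ × ℂ) × Og (ℂ × ℂ)) :=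
  {u | ∃ g h : Og (ℂ × ℂ),
    u.1 = Og.dx g + h * Og.dx f ∧ u.2 = Og.dy g + h * Og.dy f}

namespace BrieskornLattice
open MvPowerSeries
open scoped ENNReal NNReal

/-- Formal power series in the two variables `x, y`. -/
abbrev PS := MvPowerSeries (Fin 2) ℂ

/-- Exponents of monomials in two variables. -/
abbrev Ex := Fin 2 →₀ ℕ

/-- The value of the monomial with exponent `n` at `(ρ, σ)`. -/
noncomputable def mon (ρ σ : ℝ≥0) (n : Ex) : ℝ≥0 := ρ ^ n 0 * σ ^ n 1

lemma mon_add (ρ σ : ℝ≥0) (m n : Ex) : mon ρ σ (m + n) = mon ρ σ m * mon ρ σ n := by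
  simp only [mon, Finsupp.add_apply, pow_add]; ring

lemma mon_pos {ρ σ : ℝ≥0} (hρ : 0 < ρ) (hσ : 0 < σ) (n : Ex) : 0 < mon ρ σ n := by
  unfold mon; positivity

lemma mon_mono {ρ σ ρ' σ' : ℝ≥0} (hρ : ρ' ≤ ρ) (hσ : σ' ≤ σ) (n : Ex) :
    mon ρ' σ' n ≤ mon ρ σ n := by
  unfold mon; gcongr

/-- The power series with given coefficients. -/
noncomputable def ofCoeff (c : Ex → ℂ) : PS := c

@[simp] lemma coeff_ofCoeff (c : Ex → ℂ) (n : Ex) : coeff n (ofCoeff c) = c n := rfl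

/-- The weighted `ℓ¹` norm of a power series, with values in `[0, ∞]`. -/
noncomputable def nrm (ρ σ : ℝ≥0) (a : PS) : ℝ≥0∞ :=
  ∑' n : Ex, ((‖coeff n a‖₊ * mon ρ σ n : ℝ≥0) : ℝ≥0∞)

lemma nrm_le_of_coeff {ρ σ ρ' σ' : ℝ≥0} {a b : PS} (t : ℝ≥0∞)
    (h : ∀ n, ((‖coeff n b‖₊ * mon ρ' σ' n : ℝ≥0) : ℝ≥0∞)
      ≤ t * ((‖coeff n a‖₊ * mon ρ σ n : ℝ≥0) : ℝ≥0∞)) :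
    nrm ρ' σ' b ≤ t * nrm ρ σ a := by
  unfold nrm
  rw [← ENNReal.tsum_mul_left]
  exact ENNReal.tsum_le_tsum h

@[simp] lemma nrm_zero (ρ σ : ℝ≥0) : nrm ρ σ 0 = 0 := by simp [nrm]

lemma nrm_add_le (ρ σ : ℝ≥0) (a b : PS) : nrm ρ σ (a + b) ≤ nrm ρ σ a + nrm ρ σ b := by
  unfold nrm
  rw [← ENNReal.tsum_add]
  refine ENNReal.tsum_le_tsum fun n => ?_
  rw [← ENNReal.coe_add, ENNReal.coe_le_coe, ← add_mul]
  gcongr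
  simpa using nnnorm_add_le (coeff n a) (coeff n b)

@[simp] lemma nrm_neg (ρ σ : ℝ≥0) (a : PS) : nrm ρ σ (-a) = nrm ρ σ a := by
  simp [nrm]

lemma nrm_sub_le (ρ σ : ℝ≥0) (a b : PS) : nrm ρ σ (a - b) ≤ nrm ρ σ a + nrm ρ σ b := by
  rw [sub_eq_add_neg]
  exact (nrm_add_le _ _ _ _).trans (by rw [nrm_neg])

lemma nrm_mono {ρ σ ρ' σ' : ℝ≥0} (hρ : ρ' ≤ ρ) (hσ : σ' ≤ σ) (a : PS) :
    nrm ρ' σ' a ≤ nrm ρ σ a := by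
  have := nrm_le_of_coeff (ρ := ρ) (σ := σ) (ρ' := ρ') (σ' := σ') (a := a) (b := a) 1 fun n => by
    rw [one_mul, ENNReal.coe_le_coe]
    gcongr
    exact mon_mono hρ hσ n
  simpa using this

lemma coeff_le_nrm (ρ σ : ℝ≥0) (a : PS) (n : Ex) :
    ((‖coeff n a‖₊ * mon ρ σ n : ℝ≥0) : ℝ≥0∞) ≤ nrm ρ σ a :=
  ENNReal.le_tsum n

lemma eq_zero_of_nrm {ρ σ : ℝ≥0} (hρ : 0 < ρ) (hσ : 0 < σ) {a : PS} (h : nrm ρ σ a = 0) :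
    a = 0 := by
  ext n
  have := coeff_le_nrm ρ σ a n
  rw [h, nonpos_iff_eq_zero, ENNReal.coe_eq_zero, mul_eq_zero] at this
  simpa [(mon_pos hρ hσ n).ne'] using this

lemma nrm_sum_le {ι : Type*} (s : Finset ι) (ρ σ : ℝ≥0) (a : ι → PS) :
    nrm ρ σ (∑ i ∈ s, a i) ≤ ∑ i ∈ s, nrm ρ σ (a i) := by
  induction s using Finset.induction_on with
  | empty => simp
  | insert i s hi ih =>
    rw [Finset.sum_insert hi, Finset.sum_insert hi]
    exact (nrm_add_le _ _ _ _).trans (by gcongr)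

lemma nrm_mul_le (ρ σ : ℝ≥0) (a b : PS) : nrm ρ σ (a * b) ≤ nrm ρ σ a * nrm ρ σ b := by
  have h1 : nrm ρ σ a * nrm ρ σ b = ∑' p : Ex × Ex,
      ((‖coeff p.1 a‖₊ * mon ρ σ p.1 * (‖coeff p.2 b‖₊ * mon ρ σ p.2) : ℝ≥0) : ℝ≥0∞) := by
    rw [ENNReal.tsum_prod (f := fun m n : Ex =>
      ((‖coeff m a‖₊ * mon ρ σ m * (‖coeff n b‖₊ * mon ρ σ n) : ℝ≥0) : ℝ≥0∞))]
    simp only [nrm, ← ENNReal.tsum_mul_right]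
    refine tsum_congr fun m => ?_
    rw [← ENNReal.tsum_mul_left]
    simp
  rw [h1, ← Finset.HasAntidiagonal.sigmaAntidiagonalEquivProd.tsum_eq, ENNReal.tsum_sigma']
  refine ENNReal.tsum_le_tsum fun n => ?_
  rw [tsum_fintype, ← ENNReal.ofNNReal_finsetSum, ENNReal.coe_le_coe]
  rw [Finset.univ_eq_attach]
  simp only [Finset.HasAntidiagonal.sigmaAntidiagonalEquivProd_apply]
  rw [Finset.sum_attach (Finset.HasAntidiagonal.antidiagonal n) (fun p : Ex × Ex =>
    ‖coeff p.1 a‖₊ * mon ρ σ p.1 * (‖coeff p.2 b‖₊ * mon ρ σ p.2)), coeff_mul]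
  calc ‖∑ p ∈ Finset.HasAntidiagonal.antidiagonal n, coeff p.1 a * coeff p.2 b‖₊ * mon ρ σ n
      ≤ (∑ p ∈ Finset.HasAntidiagonal.antidiagonal n, ‖coeff p.1 a * coeff p.2 b‖₊) * mon ρ σ n := by
        gcongr; exact nnnorm_sum_le _ _
    _ = _ := by
        rw [Finset.sum_mul]
        refine Finset.sum_congr rfl fun p hp => ?_
        rw [← Finset.HasAntidiagonal.mem_antidiagonal.1 hp, mon_add, nnnorm_mul]; ring

lemma nrm_C (ρ σ : ℝ≥0) (c : ℂ) : nrm ρ σ (C c) = ‖c‖₊ := by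
  unfold nrm
  rw [tsum_eq_single 0]
  · simp [mon]
  · intro n hn
    simp [coeff_C, hn]

lemma nrm_C_mul_le (ρ σ : ℝ≥0) (c : ℂ) (a : PS) : nrm ρ σ (C c * a) ≤ ‖c‖₊ * nrm ρ σ a :=
  (nrm_mul_le _ _ _ _).trans (by rw [nrm_C])

lemma nrm_smul_le (ρ σ : ℝ≥0) (c : ℂ) (a : PS) : nrm ρ σ (c • a) ≤ ‖c‖₊ * nrm ρ σ a := by
  rw [smul_eq_C_mul]; exact nrm_C_mul_le _ _ _ _

lemma nrm_pow_le (ρ σ : ℝ≥0) (a : PS) (k : ℕ) : nrm ρ σ (a ^ k) ≤ nrm ρ σ a ^ k := by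
  induction k with
  | zero =>
    have := nrm_C ρ σ 1
    simp only [map_one] at this
    simp [this]
  | succ k ih =>
    rw [pow_succ, pow_succ]
    exact (nrm_mul_le _ _ _ _).trans (by gcongr)

lemma nrm_monomial (ρ σ : ℝ≥0) (n : Ex) (c : ℂ) :
    nrm ρ σ (monomial n c) = ((‖c‖₊ * mon ρ σ n : ℝ≥0) : ℝ≥0∞) := by
  unfold nrm
  rw [tsum_eq_single n]
  · simp
  · intro m hm
    simp [coeff_monomial, hm]

/-- Division by the monomial with exponent `m`, discarding the terms not divisible by it. -/
noncomputable def shiftDown (m : Ex) : PS →ₗ[ℂ] PS where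
  toFun a := ofCoeff fun n => coeff (n + m) a
  map_add' a b := by ext n; simp
  map_smul' c a := by ext n; simp

@[simp] lemma coeff_shiftDown (m : Ex) (a : PS) (n : Ex) :
    coeff n (shiftDown m a) = coeff (n + m) a := rfl

lemma nrm_shiftDown_le (ρ σ : ℝ≥0) (m : Ex) (a : PS) :
    nrm ρ σ (shiftDown m a) * mon ρ σ m ≤ nrm ρ σ a := by
  unfold nrm
  rw [← ENNReal.tsum_mul_right]
  have := ENNReal.tsum_comp_le_tsum_of_injective (add_left_injective m)
    (fun n : Ex => ((‖coeff n a‖₊ * mon ρ σ n : ℝ≥0) : ℝ≥0∞))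
  refine le_trans (ENNReal.tsum_le_tsum fun n => ?_) this
  rw [← ENNReal.coe_mul, ENNReal.coe_le_coe, coeff_shiftDown, mon_add, mul_assoc]

/-- A power series converges if it has finite norm for some polyradius. -/
def Conv (a : PS) : Prop := ∃ r : ℝ≥0, 0 < r ∧ nrm r r a < ∞

lemma conv_of_nrm {ρ σ : ℝ≥0} (hρ : 0 < ρ) (hσ : 0 < σ) {a : PS} (h : nrm ρ σ a < ∞) : Conv a :=
  ⟨min ρ σ, lt_min hρ hσ, (nrm_mono (min_le_left _ _) (min_le_right _ _) a).trans_lt h⟩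

lemma Conv.exists_common {a b : PS} (ha : Conv a) (hb : Conv b) :
    ∃ r : ℝ≥0, 0 < r ∧ nrm r r a < ∞ ∧ nrm r r b < ∞ := by
  obtain ⟨r, hr, h⟩ := ha
  obtain ⟨s, hs, h'⟩ := hb
  exact ⟨min r s, lt_min hr hs,
    (nrm_mono (min_le_left _ _) (min_le_left _ _) a).trans_lt h,
    (nrm_mono (min_le_right _ _) (min_le_right _ _) b).trans_lt h'⟩

lemma Conv.exists_le {a : PS} (ha : Conv a) {R : ℝ≥0} (hR : 0 < R) :
    ∃ r : ℝ≥0, 0 < r ∧ r ≤ R ∧ nrm r r a < ∞ := by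
  obtain ⟨r, hr, h⟩ := ha
  exact ⟨min r R, lt_min hr hR, min_le_right _ _,
    (nrm_mono (min_le_left _ _) (min_le_left _ _) a).trans_lt h⟩

@[simp] lemma conv_zero : Conv 0 := ⟨1, one_pos, by simp⟩

@[simp] lemma conv_C (c : ℂ) : Conv (C c) := ⟨1, one_pos, by simp [nrm_C]⟩

@[simp] lemma conv_one : Conv 1 := by simpa using conv_C 1

@[simp] lemma conv_monomial (n : Ex) (c : ℂ) : Conv (monomial n c) :=
  ⟨1, one_pos, by rw [nrm_monomial]; exact ENNReal.coe_lt_top⟩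

@[simp] lemma conv_X (i : Fin 2) : Conv (X i) := conv_monomial _ _

lemma Conv.add {a b : PS} (ha : Conv a) (hb : Conv b) : Conv (a + b) := by
  obtain ⟨r, hr, h, h'⟩ := ha.exists_common hb
  exact ⟨r, hr, (nrm_add_le _ _ _ _).trans_lt (ENNReal.add_lt_top.2 ⟨h, h'⟩)⟩

lemma Conv.mul {a b : PS} (ha : Conv a) (hb : Conv b) : Conv (a * b) := by
  obtain ⟨r, hr, h, h'⟩ := ha.exists_common hb
  exact ⟨r, hr, (nrm_mul_le _ _ _ _).trans_lt (ENNReal.mul_lt_top h h')⟩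

lemma Conv.neg {a : PS} (ha : Conv a) : Conv (-a) := by
  obtain ⟨r, hr, h⟩ := ha
  exact ⟨r, hr, by rwa [nrm_neg]⟩

lemma Conv.sub {a b : PS} (ha : Conv a) (hb : Conv b) : Conv (a - b) := by
  rw [sub_eq_add_neg]; exact ha.add hb.neg

/-- The subring of convergent power series. -/
noncomputable def convSubring : Subring PS where
  carrier := {a | Conv a}
  mul_mem' := Conv.mul
  one_mem' := conv_one
  add_mem' := Conv.add
  zero_mem' := conv_zero
  neg_mem' := Conv.neg

lemma Conv.pow {a : PS} (ha : Conv a) (k : ℕ) : Conv (a ^ k) :=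
  convSubring.pow_mem ha k

lemma Conv.sum {ι : Type*} {s : Finset ι} {a : ι → PS} (h : ∀ i ∈ s, Conv (a i)) :
    Conv (∑ i ∈ s, a i) :=
  convSubring.sum_mem h

lemma Conv.smul {a : PS} (ha : Conv a) (c : ℂ) : Conv (c • a) := by
  rw [smul_eq_C_mul]; exact (conv_C c).mul ha

lemma Conv.shiftDown {a : PS} (ha : Conv a) (m : Ex) : Conv (shiftDown m a) := by
  obtain ⟨r, hr, h⟩ := ha
  refine ⟨r, hr, ?_⟩
  have h1 := (nrm_shiftDown_le r r m a).trans_lt h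
  by_contra h2
  rw [not_lt_top_iff] at h2
  rw [h2, ENNReal.top_mul (by exact_mod_cast (mon_pos hr hr m).ne')] at h1
  exact lt_irrefl _ h1

/-- Partial derivatives lose an arbitrarily small amount of radius. -/
lemma nrm_pderiv_le {s r : ℝ≥0} (hs : s < r) (i : Fin 2) (a : PS) :
    nrm s s (pderiv ℂ i a) * ((r - s : ℝ≥0) : ℝ≥0∞) ≤ nrm r r a := by
  unfold nrm
  rw [← ENNReal.tsum_mul_right]
  have := ENNReal.tsum_comp_le_tsum_of_injective (add_left_injective (Finsupp.single i 1 : Ex))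
    (fun n : Ex => ((‖coeff n a‖₊ * mon r r n : ℝ≥0) : ℝ≥0∞))
  refine le_trans (ENNReal.tsum_le_tsum fun n => ?_) this
  rw [← ENNReal.coe_mul, ENNReal.coe_le_coe, coeff_pderiv]
  have key : ∀ k : ℕ, ((k : ℝ≥0) + 1) * s ^ k * (r - s) ≤ r ^ (k + 1) := by
    intro k
    obtain ⟨t, rfl⟩ := exists_add_of_le hs.le
    rw [add_tsub_cancel_left]
    induction k with
    | zero => simp
    | succ k ih =>
      calc ((k + 1 : ℕ) + 1 : ℝ≥0) * s ^ (k + 1) * t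
          = s * (((k : ℝ≥0) + 1) * s ^ k * t) + t * s ^ (k + 1) := by push_cast; ring
        _ ≤ s * (s + t) ^ (k + 1) + t * (s + t) ^ (k + 1) := by
          gcongr
        _ = (s + t) ^ (k + 1 + 1) := by ring
  have hn : ‖((n i : ℂ) + 1)‖₊ = (n i : ℝ≥0) + 1 := by
    have : ((n i : ℂ) + 1) = ((n i + 1 : ℕ) : ℂ) := by push_cast; ring
    rw [this, Complex.nnnorm_natCast]; push_cast; ring
  rw [nnnorm_mul, hn, mul_assoc, mul_assoc]
  gcongr
  fin_cases i
  · have h0 := key (n 0)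
    simp only [mon, Finsupp.add_apply]
    simp
    calc _ = ((n 0 : ℝ≥0) + 1) * s ^ n 0 * (r - s) * s ^ n 1 := by ring
      _ ≤ r ^ (n 0 + 1) * r ^ n 1 := by gcongr
  · have h0 := key (n 1)
    simp only [mon, Finsupp.add_apply]
    simp
    calc _ = ((n 1 : ℝ≥0) + 1) * s ^ n 1 * (r - s) * s ^ n 0 := by ring
      _ ≤ r ^ (n 1 + 1) * r ^ n 0 := by gcongr
      _ = _ := by ring

lemma Conv.pderiv {a : PS} (ha : Conv a) (i : Fin 2) : Conv (pderiv ℂ i a) := by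
  obtain ⟨r, hr, h⟩ := ha
  have hs : r / 2 < r := by exact_mod_cast half_lt_self hr
  refine ⟨r / 2, by positivity, ?_⟩
  have h1 := (nrm_pderiv_le hs i a).trans_lt h
  by_contra h2
  rw [not_lt_top_iff] at h2
  rw [h2, ENNReal.top_mul (by exact_mod_cast (tsub_pos_of_lt hs).ne')] at h1
  exact lt_irrefl _ h1

/-- Completeness of the weighted `ℓ¹` norms. -/
lemma exists_sum_of_nrm {ρ σ : ℝ≥0} (hρ : 0 < ρ) (hσ : 0 < σ) {a : ℕ → PS}
    (h : ∑' k, nrm ρ σ (a k) ≠ ∞) :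
    ∃ u : PS, nrm ρ σ u ≤ ∑' k, nrm ρ σ (a k) ∧
      Tendsto (fun m => nrm ρ σ (u - ∑ k ∈ Finset.range m, a k)) atTop (𝓝 0) := by
  have hsum : ∀ n, Summable fun k => coeff n (a k) := by
    intro n
    have h1 : ∑' k, ((‖coeff n (a k)‖₊ * mon ρ σ n : ℝ≥0) : ℝ≥0∞) ≠ ∞ :=
      ne_top_of_le_ne_top h (ENNReal.tsum_le_tsum fun k => coeff_le_nrm _ _ _ _)
    rw [ENNReal.tsum_coe_ne_top_iff_summable,
      summable_mul_right_iff (mon_pos hρ hσ n).ne'] at h1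
    exact Summable.of_nnnorm h1
  have hle : ∀ b : ℕ → PS, (∀ n, Summable fun k => coeff n (b k)) →
      nrm ρ σ (ofCoeff fun n => ∑' k, coeff n (b k)) ≤ ∑' k, nrm ρ σ (b k) := by
    intro b hb
    unfold nrm
    rw [ENNReal.tsum_comm]
    refine ENNReal.tsum_le_tsum fun n => ?_
    by_cases hs : Summable fun k => ‖coeff n (b k)‖₊
    · have : (∑' k, ((‖coeff n (b k)‖₊ * mon ρ σ n : ℝ≥0) : ℝ≥0∞))
          = ((∑' k, ‖coeff n (b k)‖₊) * mon ρ σ n : ℝ≥0) := by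
        rw [← NNReal.tsum_mul_right, ENNReal.coe_tsum (hs.mul_right _)]
      rw [this, ENNReal.coe_le_coe, coeff_ofCoeff]
      gcongr
      exact nnnorm_tsum_le hs
    · have : (∑' k, ((‖coeff n (b k)‖₊ * mon ρ σ n : ℝ≥0) : ℝ≥0∞)) = ∞ := by
        by_contra hne
        rw [← ne_eq, ENNReal.tsum_coe_ne_top_iff_summable,
          summable_mul_right_iff (mon_pos hρ hσ n).ne'] at hne
        exact hs hne
      rw [this]; exact le_top
  refine ⟨ofCoeff fun n => ∑' k, coeff n (a k), hle a hsum, ?_⟩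
  refine tendsto_of_tendsto_of_tendsto_of_le_of_le tendsto_const_nhds
    (ENNReal.tendsto_sum_nat_add _ h) (fun _ => zero_le) fun m => ?_
  have : (ofCoeff fun n => ∑' k, coeff n (a k)) - ∑ k ∈ Finset.range m, a k
      = ofCoeff fun n => ∑' k, coeff n (a (k + m)) := by
    ext n
    rw [map_sub, coeff_ofCoeff, coeff_ofCoeff, map_sum, ← (hsum n).sum_add_tsum_nat_add m]
    ring
  simp only [this]
  exact hle (fun k => a (k + m)) fun n => (summable_nat_add_iff m).2 (hsum n)

/-- Uniqueness of limits for the weighted norms. -/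
lemma eq_of_tendsto_nrm {ρ σ : ℝ≥0} (hρ : 0 < ρ) (hσ : 0 < σ) {u v : PS} {a : ℕ → PS}
    (hu : Tendsto (fun m => nrm ρ σ (u - a m)) atTop (𝓝 0))
    (hv : Tendsto (fun m => nrm ρ σ (v - a m)) atTop (𝓝 0)) : u = v := by
  have h : Tendsto (fun _ : ℕ => nrm ρ σ (u - v)) atTop (𝓝 0) := by
    refine tendsto_of_tendsto_of_tendsto_of_le_of_le tendsto_const_nhds
      (by simpa using hu.add hv) (fun _ => zero_le) fun m => ?_
    have : u - v = (u - a m) - (v - a m) := by ring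
    simp only [this]
    exact nrm_sub_le _ _ _ _
  exact sub_eq_zero.1 (eq_zero_of_nrm hρ hσ (tendsto_nhds_unique tendsto_const_nhds h))

lemma tendsto_nrm_of_le {ρ σ ρ' σ' : ℝ≥0} {a b : ℕ → PS} {t : ℝ≥0∞} (ht : t ≠ ∞)
    (hle : ∀ m, nrm ρ' σ' (b m) ≤ t * nrm ρ σ (a m))
    (ha : Tendsto (fun m => nrm ρ σ (a m)) atTop (𝓝 0)) :
    Tendsto (fun m => nrm ρ' σ' (b m)) atTop (𝓝 0) := by
  refine tendsto_of_tendsto_of_tendsto_of_le_of_le tendsto_const_nhds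
    (by simpa using ENNReal.Tendsto.const_mul ha (Or.inr ht)) (fun _ => zero_le) hle

/-- `∂/∂x` on power series. -/
noncomputable abbrev Dx : Derivation ℂ PS PS := pderiv ℂ 0
/-- `∂/∂y` on power series. -/
noncomputable abbrev Dy : Derivation ℂ PS PS := pderiv ℂ 1

lemma Dx_mul (a b : PS) : Dx (a * b) = a * Dx b + Dx a * b := by
  rw [Derivation.leibniz, smul_eq_mul, smul_eq_mul]; ring

lemma Dy_mul (a b : PS) : Dy (a * b) = a * Dy b + Dy a * b := by
  rw [Derivation.leibniz, smul_eq_mul, smul_eq_mul]; ring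

@[simp] lemma Dx_X0 : Dx (X 0) = 1 := pderiv_X_self
@[simp] lemma Dx_X1 : Dx (X 1) = 0 := pderiv_X_of_ne (by decide)
@[simp] lemma Dy_X0 : Dy (X 0) = 0 := pderiv_X_of_ne (by decide)
@[simp] lemma Dy_X1 : Dy (X 1) = 1 := pderiv_X_self
@[simp] lemma Dx_C (c : ℂ) : Dx (C c) = 0 := pderiv_C
@[simp] lemma Dy_C (c : ℂ) : Dy (C c) = 0 := pderiv_C

lemma Dx_Dy_comm (a : PS) : Dx (Dy a) = Dy (Dx a) := by
  ext n
  simp only [coeff_pderiv, Finsupp.add_apply]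
  rw [add_right_comm]
  simp
  ring

lemma coeff_X_mul_pderiv (i : Fin 2) (a : PS) (n : Ex) :
    coeff n (X i * pderiv ℂ i a) = n i * coeff n a := by
  rw [X, coeff_monomial_mul]
  split_ifs with h
  · rw [coeff_pderiv, tsub_add_cancel_of_le h]
    have : 1 ≤ n i := by simpa using h i
    obtain ⟨k, hk⟩ := Nat.exists_eq_add_of_le this
    simp [hk]; ring
  · have : n i = 0 := by
      by_contra h0
      refine h fun j => ?_
      rcases eq_or_ne i j with rfl | hij
      · simpa using Nat.one_le_iff_ne_zero.2 h0
      · simp [hij]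
    simp [this]

/-- Total degree of an exponent. -/
def deg (n : Ex) : ℕ := n 0 + n 1

lemma deg_add (m n : Ex) : deg (m + n) = deg m + deg n := by
  simp only [deg, Finsupp.add_apply]; ring

/-- The Euler vector field `x ∂/∂x + y ∂/∂y`. -/
noncomputable def eul (a : PS) : PS := X 0 * Dx a + X 1 * Dy a

lemma coeff_eul (a : PS) (n : Ex) : coeff n (eul a) = deg n * coeff n a := by
  rw [eul, map_add, coeff_X_mul_pderiv, coeff_X_mul_pderiv, deg]; push_cast; ring

/-- The inverse of `eul + 2`. -/
noncomputable def L2 : PS →ₗ[ℂ] PS where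
  toFun a := ofCoeff fun n => coeff n a / (deg n + 2)
  map_add' a b := by ext n; simp [add_div]
  map_smul' c a := by ext n; simp [mul_div_assoc]

/-- The inverse of `eul` on power series without constant term; it kills constants. -/
noncomputable def L0 : PS →ₗ[ℂ] PS where
  toFun a := ofCoeff fun n => coeff n a / deg n
  map_add' a b := by ext n; simp [add_div]
  map_smul' c a := by ext n; simp [mul_div_assoc]

lemma coeff_L2 (a : PS) (n : Ex) : coeff n (L2 a) = coeff n a / (deg n + 2) := rfl
lemma coeff_L0 (a : PS) (n : Ex) : coeff n (L0 a) = coeff n a / deg n := rfl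

lemma eul_L2 (a : PS) : eul (L2 a) + 2 * L2 a = a := by
  ext n
  have h2 : (2 : PS) = C 2 := (map_ofNat C 2).symm
  have : ((deg n : ℂ) + 2) ≠ 0 := by exact_mod_cast (by omega : deg n + 2 ≠ 0)
  rw [map_add, coeff_eul, h2, coeff_C_mul, coeff_L2]
  field_simp

lemma eul_L0 {a : PS} (ha : coeff 0 a = 0) : eul (L0 a) = a := by
  ext n
  rw [coeff_eul, coeff_L0]
  rcases eq_or_ne (deg n) 0 with h | h
  · have : n = 0 := by
      ext i; fin_cases i <;> simp [deg] at h ⊢ <;> omega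
    simp [this, ha]
  · have : (deg n : ℂ) ≠ 0 := by exact_mod_cast h
    field_simp

lemma eul_add_self_injective {a b : PS} (h : eul a + a = eul b + b) : a = b := by
  ext n
  have := congrArg (coeff n) h
  simp only [map_add, coeff_eul] at this
  have h1 : ((deg n : ℂ) + 1) ≠ 0 := Nat.cast_add_one_ne_zero _
  apply mul_left_cancel₀ h1
  linear_combination this

/-- The Poisson bracket, i.e. the coefficient of `df ∧ dg`. -/
noncomputable def br (f g : PS) : PS := Dx f * Dy g - Dy f * Dx g

lemma br_self (f : PS) : br f f = 0 := by simp [br]; ring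

lemma br_add (f g h : PS) : br f (g + h) = br f g + br f h := by simp [br]; ring
lemma br_sub (f g h : PS) : br f (g - h) = br f g - br f h := by simp [br]; ring
lemma br_neg (f g : PS) : br f (-g) = -br f g := by simp [br]; ring
lemma br_zero (f : PS) : br f 0 = 0 := by simp [br]
lemma br_sum {ι : Type*} (s : Finset ι) (f : PS) (g : ι → PS) :
    br f (∑ i ∈ s, g i) = ∑ i ∈ s, br f (g i) := by
  simp [br, Finset.mul_sum, Finset.sum_sub_distrib]

lemma br_mul (f g h : PS) : br f (g * h) = g * br f h + br f g * h := by
  simp only [br, Dx_mul, Dy_mul]; ring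

/-- A primitive of the closed form `p dx + q dy`. -/
noncomputable def prim (p q : PS) : PS := L0 (X 0 * p + X 1 * q)

lemma eul_prim (p q : PS) : eul (prim p q) = X 0 * p + X 1 * q :=
  eul_L0 (by simp)

lemma poincare {p q : PS} (h : Dx q = Dy p) : Dx (prim p q) = p ∧ Dy (prim p q) = q := by
  have e := eul_prim p q
  have ex := congrArg Dx e
  have ey := congrArg Dy e
  unfold eul at ex ey
  simp only [map_add, Dx_mul, Dy_mul, Dx_X0, Dx_X1, Dy_X0, Dy_X1] at ex ey
  constructor
  · apply eul_add_self_injective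
    unfold eul
    rw [← Dx_Dy_comm, ← h]
    linear_combination ex
  · apply eul_add_self_injective
    unfold eul
    rw [Dx_Dy_comm, h]
    linear_combination ey

/-- The operator `∂_t⁻¹` of the Brieskorn lattice on functions. -/
noncomputable def Sop (f : PS) : PS →ₗ[ℂ] PS := LinearMap.mulLeft ℂ (eul f) ∘ₗ L2

/-- The companion of `Sop` on potentials. -/
noncomputable def Sig (f : PS) : PS →ₗ[ℂ] PS := L0 ∘ₗ LinearMap.mulLeft ℂ (eul f)

lemma Sop_apply (f u : PS) : Sop f u = eul f * L2 u := rfl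
lemma Sig_apply (f u : PS) : Sig f u = L0 (eul f * u) := rfl

/-- `u = d(primitive)`: the standard primitive of `u dx ∧ dy` is `L2 u · (x dy - y dx)`. -/
lemma d_L2 (u : PS) : Dx (X 0 * L2 u) - Dy (-(X 1 * L2 u)) = u := by
  conv_rhs => rw [← eul_L2 u]
  simp only [map_neg, Dx_mul, Dy_mul, Dx_X0, Dy_X1, eul]; ring

lemma wedge_eq (f p q : PS) :
    Dx f * q - Dy f * p = Sop f (Dx q - Dy p) + br f (prim p q) := by
  set h := L2 (Dx q - Dy p) with hh
  have hd := d_L2 (Dx q - Dy p)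
  rw [← hh] at hd
  have hc : Dx (q - X 0 * h) = Dy (p + X 1 * h) := by
    rw [map_sub, map_add]
    rw [map_neg] at hd
    linear_combination -hd
  obtain ⟨h1, h2⟩ := poincare hc
  have h3 : prim (p + X 1 * h) (q - X 0 * h) = prim p q := by
    unfold prim; congr 1; ring
  rw [h3] at h1 h2
  rw [br, h1, h2, Sop_apply, ← hh, eul]; ring

lemma Sop_br (f g : PS) : Sop f (br f g) = br f (Sig f g) := by
  have h := wedge_eq f (-(g * Dx f)) (-(g * Dy f))
  have h1 : Dx (-(g * Dy f)) - Dy (-(g * Dx f)) = br f g := by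
    simp only [map_neg, Dx_mul, Dy_mul, br, Dx_Dy_comm]; ring
  have h2 : prim (-(g * Dx f)) (-(g * Dy f)) = - Sig f g := by
    rw [Sig_apply, ← map_neg]; unfold prim eul; congr 1; ring
  rw [h1, h2, br_neg] at h
  linear_combination -h

lemma Sop_pow_br (f g : PS) (k : ℕ) : (Sop f ^ k) (br f g) = br f ((Sig f ^ k) g) := by
  induction k with
  | zero => simp
  | succ k ih => rw [pow_succ', pow_succ', Module.End.mul_apply, ih, Sop_br, Module.End.mul_apply]

/-- All coefficients of degree less than `k` vanish. -/
def Ord (k : ℕ) (a : PS) : Prop := ∀ n, deg n < k → coeff n a = 0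

lemma ord_zero_left (a : PS) : Ord 0 a := fun _ h => absurd h (Nat.not_lt_zero _)

lemma ord_one {a : PS} (h : coeff 0 a = 0) : Ord 1 a := by
  intro n hn
  have : n = 0 := by
    ext i; fin_cases i <;> simp [deg] at hn ⊢ <;> omega
  rw [this, h]

lemma Ord.mono {j k : ℕ} (h : j ≤ k) {a : PS} (ha : Ord k a) : Ord j a :=
  fun n hn => ha n (hn.trans_le h)

lemma Ord.mul {j k : ℕ} {a b : PS} (ha : Ord j a) (hb : Ord k b) : Ord (j + k) (a * b) := by
  intro n hn
  rw [coeff_mul]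
  refine Finset.sum_eq_zero fun p hp => ?_
  have := deg_add p.1 p.2
  rw [Finset.HasAntidiagonal.mem_antidiagonal.1 hp] at this
  rcases lt_or_ge (deg p.1) j with h | h
  · rw [ha _ h, zero_mul]
  · rw [hb p.2 (by omega), mul_zero]

lemma Ord.pow {a : PS} (ha : Ord 1 a) (k : ℕ) : Ord k (a ^ k) := by
  induction k with
  | zero => exact ord_zero_left _
  | succ k ih => rw [pow_succ]; exact ih.mul ha

lemma ord_eul (f : PS) : Ord 1 (eul f) := ord_one (by rw [coeff_eul]; simp [deg])

lemma Ord.L2 {k : ℕ} {a : PS} (ha : Ord k a) : Ord k (L2 a) := fun n hn => by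
  rw [coeff_L2, ha n hn, zero_div]

lemma Ord.L0 {k : ℕ} {a : PS} (ha : Ord k a) : Ord k (L0 a) := fun n hn => by
  rw [coeff_L0, ha n hn, zero_div]

lemma nrm_div_le {ρ σ : ℝ≥0} {k : ℕ} {a b : PS} (ha : Ord k a) (d : ℕ)
    (h : ∀ n, ∃ j, deg n + d ≤ j ∧ coeff n b = coeff n a / (j : ℂ)) (hk : 0 < k + d) :
    nrm ρ σ b ≤ (((k + d : ℕ) : ℝ≥0)⁻¹ : ℝ≥0) * nrm ρ σ a := by
  refine nrm_le_of_coeff _ fun n => ?_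
  rw [← ENNReal.coe_mul, ENNReal.coe_le_coe, ← mul_assoc]
  gcongr
  obtain ⟨j, hj, he⟩ := h n
  rw [he]
  rcases lt_or_ge (deg n) k with hn | hn
  · simp [ha n hn]
  · rw [nnnorm_div, div_eq_inv_mul, Complex.nnnorm_natCast]
    gcongr
    omega

lemma nrm_L2_le {ρ σ : ℝ≥0} {k : ℕ} {a : PS} (ha : Ord k a) :
    nrm ρ σ (L2 a) ≤ (((k + 1 : ℕ) : ℝ≥0)⁻¹ : ℝ≥0) * nrm ρ σ a :=
  nrm_div_le ha 1 (fun n => ⟨deg n + 2, by omega, by rw [coeff_L2]; push_cast; rfl⟩) (by omega)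

lemma nrm_L0_le {ρ σ : ℝ≥0} {k : ℕ} {a : PS} (ha : Ord (k + 1) a) :
    nrm ρ σ (L0 a) ≤ (((k + 1 : ℕ) : ℝ≥0)⁻¹ : ℝ≥0) * nrm ρ σ a :=
  nrm_div_le ha 0 (fun n => ⟨deg n, by omega, by rw [coeff_L0]⟩) (by omega)

lemma nrm_iterate_le {ρ σ : ℝ≥0} {M : ℝ≥0∞} (L : PS →ₗ[ℂ] PS)
    (h : ∀ k a, Ord k a → Ord (k + 1) (L a) ∧
      nrm ρ σ (L a) ≤ (((k + 1 : ℕ) : ℝ≥0)⁻¹ : ℝ≥0) * (M * nrm ρ σ a)) (k : ℕ) (a : PS) :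
    Ord k ((L ^ k) a) ∧
      nrm ρ σ ((L ^ k) a) ≤ (((k.factorial : ℕ) : ℝ≥0)⁻¹ : ℝ≥0) * (M ^ k * nrm ρ σ a) := by
  induction k with
  | zero => simp [ord_zero_left]
  | succ k ih =>
    rw [pow_succ', Module.End.mul_apply]
    obtain ⟨h1, h2⟩ := h k _ ih.1
    refine ⟨h1, h2.trans ?_⟩
    calc _ ≤ (((k + 1 : ℕ) : ℝ≥0)⁻¹ : ℝ≥0) *
          (M * ((((k.factorial : ℕ) : ℝ≥0)⁻¹ : ℝ≥0) * (M ^ k * nrm ρ σ a))) := by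
          gcongr; exact ih.2
      _ = _ := by
        rw [Nat.factorial_succ, Nat.cast_mul, mul_inv, ENNReal.coe_mul, pow_succ]; ring

lemma Sop_step (f : PS) {ρ σ : ℝ≥0} (k : ℕ) (a : PS) (ha : Ord k a) : Ord (k + 1) (Sop f a) ∧
    nrm ρ σ (Sop f a) ≤ (((k + 1 : ℕ) : ℝ≥0)⁻¹ : ℝ≥0) * (nrm ρ σ (eul f) * nrm ρ σ a) := by
  refine ⟨by rw [add_comm]; exact (ord_eul f).mul ha.L2, ?_⟩
  rw [Sop_apply]
  refine (nrm_mul_le _ _ _ _).trans ?_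
  calc _ ≤ nrm ρ σ (eul f) * ((((k + 1 : ℕ) : ℝ≥0)⁻¹ : ℝ≥0) * nrm ρ σ a) := by
        gcongr; exact nrm_L2_le ha
    _ = _ := by ring

lemma Sig_step (f : PS) {ρ σ : ℝ≥0} (k : ℕ) (a : PS) (ha : Ord k a) : Ord (k + 1) (Sig f a) ∧
    nrm ρ σ (Sig f a) ≤ (((k + 1 : ℕ) : ℝ≥0)⁻¹ : ℝ≥0) * (nrm ρ σ (eul f) * nrm ρ σ a) := by
  have h1 : Ord (k + 1) (eul f * a) := by rw [add_comm]; exact (ord_eul f).mul ha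
  refine ⟨h1.L0, ?_⟩
  rw [Sig_apply]
  refine (nrm_L0_le h1).trans ?_
  gcongr
  exact nrm_mul_le _ _ _ _

lemma nrm_Sop_pow_le (f : PS) (ρ σ : ℝ≥0) (k : ℕ) (a : PS) :
    nrm ρ σ ((Sop f ^ k) a) ≤
      (((k.factorial : ℕ) : ℝ≥0)⁻¹ : ℝ≥0) * (nrm ρ σ (eul f) ^ k * nrm ρ σ a) :=
  (nrm_iterate_le (Sop f) (Sop_step f) k a).2

lemma nrm_Sig_pow_le (f : PS) (ρ σ : ℝ≥0) (k : ℕ) (a : PS) :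
    nrm ρ σ ((Sig f ^ k) a) ≤
      (((k.factorial : ℕ) : ℝ≥0)⁻¹ : ℝ≥0) * (nrm ρ σ (eul f) ^ k * nrm ρ σ a) :=
  (nrm_iterate_le (Sig f) (Sig_step f) k a).2

lemma nrm_Sop_le (f : PS) (ρ σ : ℝ≥0) (a : PS) :
    nrm ρ σ (Sop f a) ≤ nrm ρ σ (eul f) * nrm ρ σ a := by
  simpa using nrm_Sop_pow_le f ρ σ 1 a

lemma Conv.of_nrm_le {a b : PS} (ha : Conv a) (t : ℝ≥0) (h : ∀ r, nrm r r b ≤ t * nrm r r a) :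
    Conv b := by
  obtain ⟨r, hr, h'⟩ := ha
  exact ⟨r, hr, (h r).trans_lt (ENNReal.mul_lt_top ENNReal.coe_lt_top h')⟩

lemma Conv.L2 {a : PS} (ha : Conv a) : Conv (L2 a) :=
  ha.of_nrm_le _ fun _ => nrm_L2_le (ord_zero_left a)

lemma Conv.prim {p q : PS} (hp : Conv p) (hq : Conv q) : Conv (prim p q) :=
  (((conv_X 0).mul hp).add ((conv_X 1).mul hq)).of_nrm_le _ fun _ =>
    nrm_L0_le (k := 0) (ord_one (by simp))

lemma Conv.eul {a : PS} (ha : Conv a) : Conv (eul a) :=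
  ((conv_X 0).mul (ha.pderiv 0)).add ((conv_X 1).mul (ha.pderiv 1))

lemma Conv.br {f g : PS} (hf : Conv f) (hg : Conv g) : Conv (br f g) :=
  ((hf.pderiv 0).mul (hg.pderiv 1)).sub ((hf.pderiv 1).mul (hg.pderiv 0))

lemma nrm_scale_le {s r : ℝ≥0} (hs : s ≤ 1) {a : PS} (ha : Ord 1 a) :
    nrm (s * r) (s * r) a ≤ s * nrm r r a := by
  refine nrm_le_of_coeff _ fun n => ?_
  rw [← ENNReal.coe_mul, ENNReal.coe_le_coe]
  rcases Nat.eq_zero_or_pos (deg n) with h | h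
  · simp [ha n (by omega)]
  · have : mon (s * r) (s * r) n = s ^ deg n * mon r r n := by
      simp only [mon, deg, mul_pow, pow_add]; ring
    rw [this]
    have h2 : s ^ deg n ≤ s := by
      calc s ^ deg n ≤ s ^ 1 := pow_le_pow_of_le_one (zero_le) hs h
        _ = s := pow_one s
    calc _ = s ^ deg n * (‖coeff n a‖₊ * mon r r n) := by ring
      _ ≤ _ := by gcongr

/-- Convergent series without constant term have small norm on small polydiscs. -/
lemma Conv.exists_small {a : PS} (ha : Conv a) (h1 : Ord 1 a) {ε R : ℝ≥0} (hε : 0 < ε)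
    (hR : 0 < R) :
    ∃ r : ℝ≥0, 0 < r ∧ r ≤ R ∧ ∀ s ≤ r, nrm s s a ≤ ε := by
  obtain ⟨r, hr, hrR, h⟩ := ha.exists_le hR
  lift nrm r r a to ℝ≥0 using h.ne with M hM
  set s : ℝ≥0 := min 1 (ε / (M + 1)) with hs
  have hs0 : 0 < s := lt_min one_pos (by positivity)
  refine ⟨s * r, by positivity, ?_, fun s' hs' => ?_⟩
  · calc s * r ≤ 1 * r := by gcongr; exact min_le_left _ _
      _ ≤ R := by simpa using hrR
  · refine (nrm_mono hs' hs' a).trans ((nrm_scale_le (min_le_left _ _) h1).trans ?_)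
    rw [← hM, ← ENNReal.coe_mul, ENNReal.coe_le_coe]
    calc s * M ≤ ε / (M + 1) * (M + 1) := by
          gcongr
          · exact min_le_right _ _
          · exact le_self_add
      _ = ε := by field_simp

/-- `g` divides `a` with a convergent quotient. -/
def CDvd (g a : PS) : Prop := ∃ h, Conv h ∧ a = g * h

/-- `a` belongs to the Jacobian ideal of `f` in the ring of convergent power series. -/
def InJ (f a : PS) : Prop := ∃ g h, Conv g ∧ Conv h ∧ a = g * Dx f + h * Dy f

lemma CDvd.add {g a b : PS} (ha : CDvd g a) (hb : CDvd g b) : CDvd g (a + b) := by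
  obtain ⟨h, hh, rfl⟩ := ha
  obtain ⟨k, hk, rfl⟩ := hb
  exact ⟨h + k, hh.add hk, by ring⟩

lemma CDvd.mul_left {g a c : PS} (ha : CDvd g a) (hc : Conv c) : CDvd g (c * a) := by
  obtain ⟨h, hh, rfl⟩ := ha
  exact ⟨c * h, hc.mul hh, by ring⟩

lemma InJ.conv {f a : PS} (hf : Conv f) (h : InJ f a) : Conv a := by
  obtain ⟨g, h, hg, hh, rfl⟩ := h
  exact (hg.mul (hf.pderiv 0)).add (hh.mul (hf.pderiv 1))

lemma InJ.add {f a b : PS} (ha : InJ f a) (hb : InJ f b) : InJ f (a + b) := by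
  obtain ⟨g, h, hg, hh, rfl⟩ := ha
  obtain ⟨g', h', hg', hh', rfl⟩ := hb
  exact ⟨g + g', h + h', hg.add hg', hh.add hh', by ring⟩

lemma InJ.mul_left {f a c : PS} (ha : InJ f a) (hc : Conv c) : InJ f (c * a) := by
  obtain ⟨g, h, hg, hh, rfl⟩ := ha
  exact ⟨c * g, c * h, hc.mul hg, hc.mul hh, by ring⟩

lemma InJ.neg {f a : PS} (ha : InJ f a) : InJ f (-a) := by
  simpa using ha.mul_left conv_one.neg

lemma InJ.sub {f a b : PS} (ha : InJ f a) (hb : InJ f b) : InJ f (a - b) := by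
  rw [sub_eq_add_neg]; exact ha.add hb.neg

lemma InJ.zero (f : PS) : InJ f 0 := ⟨0, 0, conv_zero, conv_zero, by simp⟩

lemma InJ.sum {ι : Type*} {s : Finset ι} {f : PS} {a : ι → PS} (h : ∀ i ∈ s, InJ f (a i)) :
    InJ f (∑ i ∈ s, a i) :=
  Finset.sum_induction a (InJ f) (fun _ _ => InJ.add) (InJ.zero f) h

lemma InJ.of_wedge {f p q : PS} (hp : Conv p) (hq : Conv q) :
    InJ f (Dx f * q - Dy f * p) := ⟨q, -p, hq, hp.neg, by ring⟩

/-- Convergent series with nonzero constant term are invertible. -/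
lemma Conv.exists_inv {a : PS} (ha : Conv a) (h0 : coeff 0 a ≠ 0) : ∃ b, Conv b ∧ a * b = 1 := by
  set c := coeff 0 a with hc
  set e : PS := 1 - C c⁻¹ * a with he
  have hec : Conv e := conv_one.sub ((conv_C _).mul ha)
  have he1 : Ord 1 e := ord_one (by
    rw [he, map_sub, coeff_C_mul, ← hc, inv_mul_cancel₀ h0]; simp)
  obtain ⟨r, hr, -, hre⟩ := hec.exists_small he1 (ε := 1 / 2) (R := 1) (by norm_num) one_pos
  have hre := hre r le_rfl
  have hpow : ∀ k : ℕ, nrm r r (e ^ k) ≤ ((1 / 2 : ℝ≥0) : ℝ≥0∞) ^ k := fun k =>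
    (nrm_pow_le _ _ _ _).trans (by gcongr)
  have hlt : ((1 / 2 : ℝ≥0) : ℝ≥0∞) < 1 := by
    rw [← ENNReal.coe_one, ENNReal.coe_lt_coe]; exact NNReal.half_lt_self one_ne_zero
  have hsum : ∑' k, nrm r r (e ^ k) ≠ ∞ := by
    refine ne_top_of_le_ne_top ?_ (ENNReal.tsum_le_tsum hpow)
    rw [ENNReal.tsum_geometric]
    exact ENNReal.inv_ne_top.2 (tsub_pos_of_lt hlt).ne'
  obtain ⟨u, hu, ht⟩ := exists_sum_of_nrm hr hr hsum
  have huc : Conv u := ⟨r, hr, hu.trans_lt hsum.lt_top⟩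
  have h1 : (1 - e) * u = 1 := by
    refine eq_of_tendsto_nrm hr hr (a := fun m => (1 - e) * ∑ k ∈ Finset.range m, e ^ k) ?_ ?_
    · refine tendsto_nrm_of_le (t := nrm r r (1 - e)) ?_ (fun m => ?_) ht
      · refine ((nrm_sub_le _ _ _ _).trans_lt (ENNReal.add_lt_top.2
          ⟨?_, hre.trans_lt ENNReal.coe_lt_top⟩)).ne
        have := nrm_C r r 1
        rw [map_one] at this
        rw [this]; exact ENNReal.coe_lt_top
      · rw [← mul_sub]; exact nrm_mul_le _ _ _ _
    · refine tendsto_of_tendsto_of_tendsto_of_le_of_le tendsto_const_nhds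
        (ENNReal.tendsto_pow_atTop_nhds_zero_of_lt_one hlt) (fun _ => zero_le) fun m => ?_
      rw [mul_neg_geom_sum]
      simpa using hpow m
  refine ⟨C c⁻¹ * u, (conv_C _).mul huc, ?_⟩
  rw [← h1, he]; ring

lemma coeff_X_pow_mul_of_lt {i : Fin 2} {N : ℕ} {n : Ex} (h : n i < N) (a : PS) :
    coeff n (X i ^ N * a) = 0 := by
  rw [X_pow_eq, coeff_monomial_mul, if_neg]
  intro h'
  have := h' i
  simp at this
  omega

lemma coeff_X_pow_mul_add (i : Fin 2) (N : ℕ) (n : Ex) (a : PS) :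
    coeff (n + Finsupp.single i N) (X i ^ N * a) = coeff n a := by
  rw [X_pow_eq, add_comm, coeff_add_monomial_mul, one_mul]

lemma X_pow_mul_shiftDown {i : Fin 2} {N : ℕ} {u : PS} (h : ∀ n : Ex, n i < N → coeff n u = 0) :
    X i ^ N * shiftDown (Finsupp.single i N) u = u := by
  ext n
  rcases lt_or_ge (n i) N with hn | hn
  · rw [coeff_X_pow_mul_of_lt hn, h n hn]
  · have : n = n - Finsupp.single i N + Finsupp.single i N :=
      (tsub_add_cancel_of_le (by simpa using hn)).symm
    rw [this, coeff_X_pow_mul_add, coeff_shiftDown]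

lemma X_ne_zero' (i : Fin 2) : (X i : PS) ≠ 0 := by
  intro h
  have := congrArg (coeff (Finsupp.single i 1)) h
  rw [coeff_index_single_self_X, map_zero] at this
  exact one_ne_zero this

/-- If `x ^ N * a` and `y ^ N * a` are divisible by `g`, so is `a`. -/
lemma cdvd_of_X_pow {N : ℕ} {g a : PS} (hg : g ≠ 0)
    (hx : CDvd g (X 0 ^ N * a)) (hy : CDvd g (X 1 ^ N * a)) : CDvd g a := by
  obtain ⟨u, hu, hu'⟩ := hx
  obtain ⟨v, hv, hv'⟩ := hy
  have h : X 1 ^ N * u = X 0 ^ N * v := by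
    apply mul_left_cancel₀ hg
    linear_combination X 0 ^ N * hv' - X 1 ^ N * hu'
  have h0 : X 0 ^ N * shiftDown (Finsupp.single 0 N) u = u := by
    refine X_pow_mul_shiftDown fun n hn => ?_
    rw [← coeff_X_pow_mul_add 1 N, h, coeff_X_pow_mul_of_lt]
    simpa using hn
  refine ⟨_, hu.shiftDown (Finsupp.single 0 N), ?_⟩
  apply mul_left_cancel₀ (pow_ne_zero N (X_ne_zero' 0))
  rw [hu']
  conv_lhs => rw [← h0]
  ring

/-- `f` is a convergent power series whose Milnor algebra has basis `b`. -/
structure Milnor {μ : ℕ} (f : PS) (b : Fin μ → PS) : Prop where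
  conv : Conv f
  coeff_zero : coeff 0 f = 0
  conv_basis : ∀ i, Conv (b i)
  exists_unique : ∀ u, Conv u → ∃! c : Fin μ → ℂ, InJ f (u - ∑ i, C (c i) * b i)

namespace Milnor

variable {μ : ℕ} {f : PS} {b : Fin μ → PS}

lemma exists_X_pow (M : Milnor f b) (i : Fin 2) : ∃ N, InJ f (X i ^ N) := by
  choose c hc _ using fun k : ℕ => M.exists_unique (X i ^ k) ((conv_X i).pow k)
  obtain ⟨l, hl, k0, hk0⟩ := Fintype.not_linearIndependent_iff.1
    (fun h : LinearIndependent ℂ (fun k : Fin (μ + 1) => c k) => by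
      have := h.fintype_card_le_finrank
      simp at this)
  set P : PS := ∑ k : Fin (μ + 1), C (l k) * X i ^ (k : ℕ) with hP
  have hPJ : InJ f P := by
    have h1 : InJ f (∑ k : Fin (μ + 1), C (l k) * (X i ^ (k : ℕ) - ∑ j, C (c k j) * b j)) :=
      InJ.sum fun k _ => (hc k).mul_left (conv_C _)
    have h2 : ∑ k : Fin (μ + 1), C (l k) * ∑ j, C (c k j) * b j = 0 := by
      simp only [Finset.mul_sum]
      rw [Finset.sum_comm]
      refine Finset.sum_eq_zero fun j _ => ?_
      have := congrFun hl j
      simp only [Finset.sum_apply, Pi.smul_apply, smul_eq_mul, Pi.zero_apply] at this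
      simp only [← mul_assoc, ← Finset.sum_mul, ← map_mul, ← map_sum, this]
      simp
    simpa [mul_sub, Finset.sum_sub_distrib, h2] using h1
  obtain ⟨j, hj, hmin⟩ : ∃ j : Fin (μ + 1), l j ≠ 0 ∧ ∀ k < j, l k = 0 := by
    have := WellFounded.has_min (wellFounded_lt (α := Fin (μ + 1))) {k | l k ≠ 0} ⟨k0, hk0⟩
    obtain ⟨j, hj, h⟩ := this
    exact ⟨j, hj, fun k hk => by_contra fun h' => h k h' hk⟩
  set U : PS := ∑ k : Fin (μ + 1), if j ≤ k then C (l k) * X i ^ ((k : ℕ) - j) else 0 with hU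
  have hUc : Conv U := Conv.sum fun k _ => by
    split_ifs
    · exact (conv_C _).mul ((conv_X i).pow _)
    · exact conv_zero
  have hU0 : coeff 0 U ≠ 0 := by
    rw [hU, map_sum, Finset.sum_eq_single j]
    · simpa using hj
    · intro k _ hk
      split_ifs with h
      · have : (k : ℕ) - j ≠ 0 := by
          have : (j : ℕ) < k := lt_of_le_of_ne h (fun h' => hk (Fin.ext h'.symm))
          omega
        rw [coeff_C_mul]
        simp [this]
      · simp
    · simp
  have hPU : P = X i ^ (j : ℕ) * U := by
    rw [hP, hU, Finset.mul_sum]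
    refine Finset.sum_congr rfl fun k _ => ?_
    split_ifs with h
    · have : (k : ℕ) = j + (k - j) := by have : (j : ℕ) ≤ k := h; omega
      conv_lhs => rw [this, pow_add]
      ring
    · rw [hmin k (not_le.1 h)]; simp
  obtain ⟨V, hV, hUV⟩ := hUc.exists_inv hU0
  refine ⟨j, ?_⟩
  have : X i ^ (j : ℕ) = V * P := by rw [hPU]; linear_combination -X i ^ (j : ℕ) * hUV
  rw [this]
  exact hPJ.mul_left hV

lemma exists_X_pow_both (M : Milnor f b) : ∃ N, ∀ i, InJ f (X i ^ N) := by
  obtain ⟨N, hN⟩ := M.exists_X_pow 0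
  obtain ⟨N', hN'⟩ := M.exists_X_pow 1
  refine ⟨N + N', fun i => ?_⟩
  fin_cases i
  · rw [add_comm, pow_add]; exact hN.mul_left ((conv_X _).pow _)
  · rw [pow_add]; exact hN'.mul_left ((conv_X _).pow _)

/-- The Jacobian ideal has depth two. -/
lemma cdvd_of_mul_partials (M : Milnor f b) {g a : PS} (hg : g ≠ 0)
    (hx : CDvd g (Dx f * a)) (hy : CDvd g (Dy f * a)) : CDvd g a := by
  obtain ⟨N, hN⟩ := M.exists_X_pow_both
  have key : ∀ i, CDvd g (X i ^ N * a) := by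
    intro i
    obtain ⟨A, B, hA, hB, h⟩ := hN i
    have : X i ^ N * a = A * (Dx f * a) + B * (Dy f * a) := by rw [h]; ring
    rw [this]
    exact (hx.mul_left hA).add (hy.mul_left hB)
  exact cdvd_of_X_pow hg (key 0) (key 1)

lemma partials_ne_zero (M : Milnor f b) : Dx f ≠ 0 ∨ Dy f ≠ 0 := by
  by_contra! h
  obtain ⟨N, A, B, -, -, h'⟩ := M.exists_X_pow 0
  rw [h.1, h.2] at h'
  exact pow_ne_zero N (X_ne_zero' 0) (by rw [h']; ring)

/-- Exactness of the Koszul complex of the partial derivatives. -/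
lemma koszul (M : Milnor f b) {p q : PS} (hp : Conv p) (hq : Conv q)
    (h : Dx f * q - Dy f * p = 0) : ∃ k, Conv k ∧ p = k * Dx f ∧ q = k * Dy f := by
  by_cases hy : Dy f = 0
  · have hx : Dx f ≠ 0 := M.partials_ne_zero.resolve_right (not_not.2 hy)
    have hq0 : q = 0 := by
      rw [hy, zero_mul, sub_zero] at h
      exact (mul_eq_zero.1 h).resolve_left hx
    obtain ⟨k, hk, e⟩ := M.cdvd_of_mul_partials hx (a := p) ⟨p, hp, rfl⟩
      ⟨0, conv_zero, by rw [hy]; ring⟩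
    exact ⟨k, hk, by rw [e]; ring, by rw [hq0, hy]; ring⟩
  · obtain ⟨k, hk, e⟩ := M.cdvd_of_mul_partials hy (a := q) ⟨p, hp, by linear_combination h⟩
      ⟨q, hq, rfl⟩
    refine ⟨k, hk, ?_, by rw [e]; ring⟩
    apply mul_left_cancel₀ hy
    rw [e] at h
    linear_combination -h

/-- A convergent series vanishing at `0` has a power in the Jacobian ideal. -/
lemma exists_pow_mem (M : Milnor f b) {g : PS} (hg : Conv g) (h0 : coeff 0 g = 0) :
    ∃ N, InJ f (g ^ N) := by
  obtain ⟨N, hN⟩ := M.exists_X_pow_both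
  refine ⟨2 * N, ?_⟩
  have ho : Ord (2 * N) (g ^ (2 * N)) := (ord_one h0).pow _
  set w := g ^ (2 * N) with hw
  have hwc : Conv w := hg.pow _
  set w1 := shiftDown (Finsupp.single 0 N) w
  have hw1 : Conv w1 := hwc.shiftDown _
  have h2 : X 1 ^ N * shiftDown (Finsupp.single 1 N) (w - X 0 ^ N * w1) = w - X 0 ^ N * w1 := by
    refine X_pow_mul_shiftDown fun n hn => ?_
    rw [map_sub]
    rcases lt_or_ge (n 0) N with h | h
    · rw [coeff_X_pow_mul_of_lt h, ho n (by unfold deg; omega), sub_zero]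
    · have : n = n - Finsupp.single 0 N + Finsupp.single 0 N :=
        (tsub_add_cancel_of_le (by simpa using h)).symm
      rw [this, coeff_X_pow_mul_add, coeff_shiftDown, sub_self]
  have h3 : w = w1 * X 0 ^ N + shiftDown (Finsupp.single 1 N) (w - X 0 ^ N * w1) * X 1 ^ N := by
    linear_combination -h2
  rw [h3]
  exact ((hN 0).mul_left hw1).add
    ((hN 1).mul_left ((hwc.sub (((conv_X 0).pow N).mul hw1)).shiftDown _))

end Milnor

/-- A linear operator on power series which is bounded, uniformly for radii in `[R/2, R]`, for
every small `R`. -/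
def BddOp (L : PS →ₗ[ℂ] PS) : Prop :=
  ∃ R0 : ℝ≥0, 0 < R0 ∧ ∀ R, 0 < R → R ≤ R0 → ∃ K : ℝ≥0, ∀ r, R / 2 ≤ r → r ≤ R →
    ∀ u, nrm r r (L u) ≤ K * nrm r r u

lemma BddOp.add {L L' : PS →ₗ[ℂ] PS} (h : BddOp L) (h' : BddOp L') : BddOp (L + L') := by
  obtain ⟨R0, hR0, h⟩ := h
  obtain ⟨R0', hR0', h'⟩ := h'
  refine ⟨min R0 R0', lt_min hR0 hR0', fun R hR hle => ?_⟩
  obtain ⟨K, hK⟩ := h R hR (hle.trans (min_le_left _ _))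
  obtain ⟨K', hK'⟩ := h' R hR (hle.trans (min_le_right _ _))
  refine ⟨K + K', fun r h1 h2 u => ?_⟩
  rw [LinearMap.add_apply, ENNReal.coe_add, add_mul]
  exact (nrm_add_le _ _ _ _).trans (add_le_add (hK r h1 h2 u) (hK' r h1 h2 u))

lemma BddOp.comp {L L' : PS →ₗ[ℂ] PS} (h : BddOp L) (h' : BddOp L') : BddOp (L ∘ₗ L') := by
  obtain ⟨R0, hR0, h⟩ := h
  obtain ⟨R0', hR0', h'⟩ := h'
  refine ⟨min R0 R0', lt_min hR0 hR0', fun R hR hle => ?_⟩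
  obtain ⟨K, hK⟩ := h R hR (hle.trans (min_le_left _ _))
  obtain ⟨K', hK'⟩ := h' R hR (hle.trans (min_le_right _ _))
  refine ⟨K * K', fun r h1 h2 u => ?_⟩
  rw [LinearMap.comp_apply, ENNReal.coe_mul, mul_assoc]
  exact (hK r h1 h2 _).trans (by gcongr; exact hK' r h1 h2 u)

lemma BddOp.zero : BddOp 0 := ⟨1, one_pos, fun _ _ _ => ⟨0, fun _ _ _ _ => by simp⟩⟩

lemma BddOp.sum {ι : Type*} {s : Finset ι} {L : ι → PS →ₗ[ℂ] PS} (h : ∀ i ∈ s, BddOp (L i)) :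
    BddOp (∑ i ∈ s, L i) :=
  Finset.sum_induction L BddOp (fun _ _ => BddOp.add) BddOp.zero h

lemma BddOp.mulLeft {g : PS} (hg : Conv g) : BddOp (LinearMap.mulLeft ℂ g) := by
  obtain ⟨R0, hR0, h⟩ := hg
  refine ⟨R0, hR0, fun R _ hle => ⟨(nrm R0 R0 g).toNNReal, fun r _ h2 u => ?_⟩⟩
  rw [ENNReal.coe_toNNReal h.ne, LinearMap.mulLeft_apply]
  refine (nrm_mul_le _ _ _ _).trans ?_
  gcongr
  exact nrm_mono (h2.trans hle) (h2.trans hle) g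

lemma BddOp.id : BddOp LinearMap.id := ⟨1, one_pos, fun _ _ _ => ⟨1, fun _ _ _ _ => by simp⟩⟩

lemma le_mon_of_half_le {R r : ℝ≥0} (h : R / 2 ≤ r) (n : Ex) :
    mon (R / 2) (R / 2) n ≤ mon r r n := mon_mono h h n

lemma BddOp.shiftDown (m : Ex) : BddOp (shiftDown m) := by
  refine ⟨1, one_pos, fun R hR _ => ⟨(mon (R / 2) (R / 2) m)⁻¹, fun r h1 _ u => ?_⟩⟩
  have hp : 0 < mon (R / 2) (R / 2) m := mon_pos (by positivity) (by positivity) m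
  have h2 := nrm_shiftDown_le r r m u
  rw [ENNReal.coe_inv hp.ne', mul_comm, ← div_eq_mul_inv]
  rw [ENNReal.le_div_iff_mul_le (Or.inl (by exact_mod_cast hp.ne')) (Or.inl ENNReal.coe_ne_top)]
  refine le_trans ?_ h2
  gcongr
  exact le_mon_of_half_le h1 m

/-- The rank one operator `u ↦ (coefficient of u at n) • g`. -/
noncomputable def coeffOp (n : Ex) (g : PS) : PS →ₗ[ℂ] PS := (coeff n).smulRight g

lemma coeffOp_apply (n : Ex) (g u : PS) : coeffOp n g u = coeff n u • g := rfl

lemma BddOp.coeffOp (n : Ex) {g : PS} (hg : Conv g) : BddOp (coeffOp n g) := by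
  obtain ⟨R0, hR0, h⟩ := hg
  refine ⟨R0, hR0, fun R hR hle =>
    ⟨(mon (R / 2) (R / 2) n)⁻¹ * (nrm R0 R0 g).toNNReal, fun r h1 h2 u => ?_⟩⟩
  have hp : 0 < mon (R / 2) (R / 2) n := mon_pos (by positivity) (by positivity) n
  have h3 := coeff_le_nrm r r u n
  rw [ENNReal.coe_mul, ENNReal.coe_toNNReal h.ne, coeffOp_apply]
  refine (nrm_smul_le _ _ _ _).trans ?_
  have h4 : (‖coeff n u‖₊ : ℝ≥0∞) ≤ ((mon (R / 2) (R / 2) n)⁻¹ : ℝ≥0) * nrm r r u := by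
    calc (‖coeff n u‖₊ : ℝ≥0∞)
        = ((mon (R / 2) (R / 2) n)⁻¹ : ℝ≥0) *
          ((‖coeff n u‖₊ * mon (R / 2) (R / 2) n : ℝ≥0) : ℝ≥0∞) := by
          rw [← ENNReal.coe_mul, ENNReal.coe_inj]; field_simp
      _ ≤ _ := by
        gcongr
        refine le_trans ?_ h3
        rw [ENNReal.coe_le_coe]
        gcongr
        exact le_mon_of_half_le h1 n
  calc _ ≤ ((mon (R / 2) (R / 2) n)⁻¹ : ℝ≥0) * nrm r r u * nrm R0 R0 g := by
        gcongr
        exact nrm_mono (h2.trans hle) (h2.trans hle) g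
    _ = _ := by ring

lemma BddOp.conv {L : PS →ₗ[ℂ] PS} (hL : BddOp L) {u : PS} (hu : Conv u) : Conv (L u) := by
  obtain ⟨R0, hR0, h⟩ := hL
  obtain ⟨r, hr, hle, hfin⟩ := hu.exists_le hR0
  obtain ⟨K, hK⟩ := h r hr hle
  have hr2 : r / 2 ≤ r := half_le_self zero_le
  exact ⟨r, hr, (hK r hr2 le_rfl u).trans_lt (ENNReal.mul_lt_top ENNReal.coe_lt_top hfin)⟩

/-- The exponent `(i, j)`. -/
noncomputable def ex (p : ℕ × ℕ) : Ex := Finsupp.single 0 p.1 + Finsupp.single 1 p.2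

@[simp] lemma ex_zero (p : ℕ × ℕ) : ex p 0 = p.1 := by simp [ex]
@[simp] lemma ex_one (p : ℕ × ℕ) : ex p 1 = p.2 := by simp [ex]

lemma decomp (N : ℕ) (u : PS) :
    u = ∑ p ∈ Finset.range N ×ˢ Finset.range N, coeff (ex p) u • monomial (ex p) (1 : ℂ)
      + X 0 ^ N * shiftDown (Finsupp.single 0 N) u
      + X 1 ^ N * shiftDown (Finsupp.single 1 N)
        (u - X 0 ^ N * shiftDown (Finsupp.single 0 N) u) := by
  have hsum : ∀ n, coeff n (∑ p ∈ Finset.range N ×ˢ Finset.range N,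
      coeff (ex p) u • monomial (ex p) (1 : ℂ)) = if n 0 < N ∧ n 1 < N then coeff n u else 0 := by
    intro n
    have hn : ex (n 0, n 1) = n := by ext i; fin_cases i <;> simp
    simp only [map_sum, coeff_smul, coeff_monomial, mul_ite, mul_one, mul_zero]
    split_ifs with h
    · rw [Finset.sum_eq_single (n 0, n 1)]
      · rw [hn, if_pos rfl]
      · rintro p - hp
        rw [if_neg]
        rintro rfl
        exact hp (by simp)
      · intro h'; simp [h] at h'
    · refine Finset.sum_eq_zero fun p hp => ?_
      rw [if_neg]
      rintro rfl
      exact h (by simpa using hp)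
  ext n
  rw [map_add, map_add, hsum]
  rcases lt_or_ge (n 0) N with h0 | h0
  · rw [coeff_X_pow_mul_of_lt h0]
    rcases lt_or_ge (n 1) N with h1 | h1
    · rw [coeff_X_pow_mul_of_lt h1, if_pos ⟨h0, h1⟩]; ring
    · have : n = n - Finsupp.single 1 N + Finsupp.single 1 N :=
        (tsub_add_cancel_of_le (by simpa using h1)).symm
      rw [if_neg (by omega), this, coeff_X_pow_mul_add, coeff_shiftDown, ← this, map_sub,
        coeff_X_pow_mul_of_lt h0]; ring
  · have e0 : n = n - Finsupp.single 0 N + Finsupp.single 0 N :=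
      (tsub_add_cancel_of_le (by simpa using h0)).symm
    have hz : ∀ m : Ex, N ≤ m 0 → coeff m (u - X 0 ^ N * shiftDown (Finsupp.single 0 N) u) = 0 := by
      intro m hm
      have e : m = m - Finsupp.single 0 N + Finsupp.single 0 N :=
        (tsub_add_cancel_of_le (by simpa using hm)).symm
      rw [e, map_sub, coeff_X_pow_mul_add, coeff_shiftDown, sub_self]
    have hz' : coeff n (X 1 ^ N * shiftDown (Finsupp.single 1 N)
        (u - X 0 ^ N * shiftDown (Finsupp.single 0 N) u)) = 0 := by
      rcases lt_or_ge (n 1) N with h1 | h1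
      · rw [coeff_X_pow_mul_of_lt h1]
      · have : n = n - Finsupp.single 1 N + Finsupp.single 1 N :=
          (tsub_add_cancel_of_le (by simpa using h1)).symm
        rw [this, coeff_X_pow_mul_add, coeff_shiftDown, ← this, hz n h0]
    rw [hz', if_neg (by omega), e0, coeff_X_pow_mul_add, coeff_shiftDown]; ring

/-- Linear division by the partial derivatives of `f`, with bounds. -/
structure Division {μ : ℕ} (f : PS) (b : Fin μ → PS) where
  c : PS →ₗ[ℂ] (Fin μ → ℂ)
  p : PS →ₗ[ℂ] PS
  q : PS →ₗ[ℂ] PS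
  eq : ∀ u, u = ∑ i, C (c u i) * b i + (Dx f * q u - Dy f * p u)
  bdd_p : BddOp p
  bdd_q : BddOp q
  bdd_c : ∀ i, BddOp (LinearMap.smulRight (LinearMap.proj i ∘ₗ c) (1 : PS))

lemma Milnor.exists_division {μ : ℕ} {f : PS} {b : Fin μ → PS} (M : Milnor f b) :
    Nonempty (Division f b) := by
  obtain ⟨N, hN⟩ := M.exists_X_pow_both
  choose A B hA hB hAB using hN
  choose γ hγ _ using fun p : ℕ × ℕ =>
    M.exists_unique (monomial (ex p) 1) (conv_monomial (ex p) 1)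
  choose P Q hP hQ hPQ using hγ
  set s := Finset.range N ×ˢ Finset.range N
  set u1 : PS →ₗ[ℂ] PS := BrieskornLattice.shiftDown (Finsupp.single 0 N)
  set u2 : PS →ₗ[ℂ] PS := BrieskornLattice.shiftDown (Finsupp.single 1 N) ∘ₗ
    (LinearMap.id + LinearMap.mulLeft ℂ (-(X 0 ^ N)) ∘ₗ u1) with hu2
  have bu1 : BddOp u1 := BddOp.shiftDown _
  have bu2 : BddOp u2 := (BddOp.shiftDown _).comp
    (BddOp.id.add ((BddOp.mulLeft ((conv_X 0).pow N).neg).comp bu1))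
  refine ⟨⟨∑ p ∈ s, (coeff (ex p)).smulRight (γ p),
    ∑ p ∈ s, coeffOp (ex p) (-(Q p)) + LinearMap.mulLeft ℂ (-(B 0)) ∘ₗ u1
      + LinearMap.mulLeft ℂ (-(B 1)) ∘ₗ u2,
    ∑ p ∈ s, coeffOp (ex p) (P p) + LinearMap.mulLeft ℂ (A 0) ∘ₗ u1
      + LinearMap.mulLeft ℂ (A 1) ∘ₗ u2, fun u => ?_, ?_, ?_, fun i => ?_⟩⟩
  · conv_lhs => rw [decomp N u]
    have e2 : u2 u = BrieskornLattice.shiftDown (Finsupp.single 1 N) (u - X 0 ^ N * u1 u) := by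
      simp [hu2, sub_eq_add_neg]
    have e1 : ∀ p, monomial (ex p) (1 : ℂ) =
        ∑ i, C (γ p i) * b i + (P p * Dx f + Q p * Dy f) := fun p => by rw [← hPQ p]; ring
    rw [← e2]
    simp only [LinearMap.add_apply, LinearMap.sum_apply, LinearMap.comp_apply,
      LinearMap.mulLeft_apply, coeffOp_apply, LinearMap.smulRight_apply, hAB, Finset.sum_apply,
      Pi.smul_apply, smul_eq_mul, map_sum, map_mul, Finset.sum_mul]
    have e3 : ∑ p ∈ s, coeff (ex p) u • monomial (ex p) (1 : ℂ) =
        ∑ i, ∑ p ∈ s, C (coeff (ex p) u) * C (γ p i) * b i +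
          (∑ p ∈ s, coeff (ex p) u • P p) * Dx f + (∑ p ∈ s, coeff (ex p) u • Q p) * Dy f := by
      rw [Finset.sum_comm, Finset.sum_mul, Finset.sum_mul, ← Finset.sum_add_distrib,
        ← Finset.sum_add_distrib]
      refine Finset.sum_congr rfl fun p _ => ?_
      rw [e1 p]
      simp only [smul_eq_C_mul, mul_add, Finset.mul_sum, mul_assoc]
      ring
    rw [e3]
    simp only [smul_neg, Finset.sum_neg_distrib]
    ring
  · exact ((BddOp.sum fun p _ => BddOp.coeffOp _ (hQ p).neg).add
      ((BddOp.mulLeft (hB 0).neg).comp bu1)).add ((BddOp.mulLeft (hB 1).neg).comp bu2)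
  · exact ((BddOp.sum fun p _ => BddOp.coeffOp _ (hP p)).add
      ((BddOp.mulLeft (hA 0)).comp bu1)).add ((BddOp.mulLeft (hA 1)).comp bu2)
  · have : (LinearMap.smulRight (LinearMap.proj i ∘ₗ
        ∑ p ∈ s, (coeff (ex p)).smulRight (γ p)) (1 : PS) : PS →ₗ[ℂ] PS)
        = ∑ p ∈ s, coeffOp (ex p) (C (γ p i)) := by
      ext1 u
      simp only [LinearMap.smulRight_apply, LinearMap.comp_apply, LinearMap.sum_apply,
        LinearMap.proj_apply, Pi.smul_apply, coeffOp_apply, smul_eq_C_mul,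
        map_sum, map_mul, smul_eq_mul, mul_one]
    rw [this]
    exact BddOp.sum fun p _ => BddOp.coeffOp _ (conv_C _)

lemma BddOp.eventually {L : PS →ₗ[ℂ] PS} (h : BddOp L) : ∀ᶠ R in 𝓝[>] (0 : ℝ≥0),
    ∃ K : ℝ≥0, ∀ r, R / 2 ≤ r → r ≤ R → ∀ u, nrm r r (L u) ≤ K * nrm r r u := by
  obtain ⟨R0, hR0, h⟩ := h
  filter_upwards [Ioc_mem_nhdsGT hR0] with R hR using h R hR.1 hR.2

lemma Conv.eventually {a : PS} (h : Conv a) : ∀ᶠ R in 𝓝[>] (0 : ℝ≥0), nrm R R a < ∞ := by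
  obtain ⟨R0, hR0, h⟩ := h
  filter_upwards [Ioc_mem_nhdsGT hR0] with R hR using (nrm_mono hR.2 hR.2 a).trans_lt h

lemma Conv.eventually_small {a : PS} (h : Conv a) (h1 : Ord 1 a) {ε : ℝ≥0} (hε : 0 < ε) :
    ∀ᶠ R in 𝓝[>] (0 : ℝ≥0), nrm R R a ≤ ε := by
  obtain ⟨r, hr, -, h⟩ := h.exists_small h1 hε one_pos
  filter_upwards [Ioc_mem_nhdsGT hr] with R hR using h R hR.2

lemma exists_radius {P : ℝ≥0 → Prop} (h : ∀ᶠ R in 𝓝[>] (0 : ℝ≥0), P R) {R0 : ℝ≥0}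
    (hR0 : 0 < R0) : ∃ R, 0 < R ∧ R ≤ R0 ∧ P R := by
  obtain ⟨R, h1, h2⟩ := (h.and (Ioc_mem_nhdsGT hR0)).exists
  exact ⟨R, h2.1, h2.2, h1⟩

lemma pow_self_le (k : ℕ) : (k : ℝ≥0) ^ k ≤ 3 ^ k * (k.factorial : ℝ≥0) := by
  have h := Real.pow_div_factorial_le_exp (k : ℝ) (Nat.cast_nonneg k) k
  rw [div_le_iff₀ (by positivity)] at h
  have h3 : Real.exp (k : ℝ) ≤ 3 ^ k := by
    rw [← Real.exp_one_pow]
    exact pow_le_pow_left₀ (Real.exp_pos 1).le (Real.exp_one_lt_d9.le.trans (by norm_num)) k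
  rw [← NNReal.coe_le_coe]
  push_cast
  exact h.trans (by gcongr)

namespace Division
variable {μ : ℕ} {f : PS} {b : Fin μ → PS} (D : Division f b)

/-- The exterior derivative of the quotient form in the division by `df`. -/
noncomputable def N : PS →ₗ[ℂ] PS := Dx.toLinearMap ∘ₗ D.q - Dy.toLinearMap ∘ₗ D.p

lemma N_apply (u : PS) : D.N u = Dx (D.q u) - Dy (D.p u) := rfl

/-- The sequence of all remainders of iterated division by `df`. -/
noncomputable def Phi : PS →ₗ[ℂ] (ℕ → Fin μ → ℂ) := LinearMap.pi fun k => D.c ∘ₗ (D.N ^ k)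

lemma Phi_apply (u : PS) (k : ℕ) : D.Phi u k = D.c ((D.N ^ k) u) := rfl

lemma Phi_zero_eq (u : PS) : D.Phi u 0 = D.c u := rfl

lemma Phi_succ (u : PS) (k : ℕ) : D.Phi u (k + 1) = D.Phi (D.N u) k := by
  rw [Phi_apply, Phi_apply, pow_succ, Module.End.mul_apply]

lemma conv_N {u : PS} (hu : Conv u) : Conv (D.N u) :=
  ((D.bdd_q.conv hu).pderiv 0).sub ((D.bdd_p.conv hu).pderiv 1)

lemma eventually_N_bound : ∀ᶠ R in 𝓝[>] (0 : ℝ≥0), ∃ K : ℝ≥0, ∀ (k : ℕ) (u : PS),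
    nrm (R / 2) (R / 2) ((D.N ^ k) u) ≤ ((K ^ k * k.factorial : ℝ≥0) : ℝ≥0∞) * nrm R R u := by
  filter_upwards [D.bdd_p.eventually, D.bdd_q.eventually, self_mem_nhdsWithin] with R hp hq hR
  obtain ⟨Kp, hp⟩ := hp
  obtain ⟨Kq, hq⟩ := hq
  have hR : 0 < R := hR
  refine ⟨3 * (Kq + Kp) * (R / 2)⁻¹, fun k u => ?_⟩
  rcases Nat.eq_zero_or_pos k with rfl | hk
  · simpa using nrm_mono half_le_self_aux half_le_self_aux u
  set δ : ℝ≥0 := R / 2 / k with hδ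
  have hk' : (0 : ℝ≥0) < k := by exact_mod_cast hk
  have hδ0 : 0 < δ := by positivity
  have hkδ : k * δ = R / 2 := by rw [hδ]; field_simp
  have hrj : ∀ j ≤ k, R / 2 + j * δ ≤ R := fun j hj => by
    calc R / 2 + j * δ ≤ R / 2 + k * δ := by gcongr
      _ = R := by rw [hkδ, add_halves]
  have key : ∀ i j, i + j = k → nrm (R / 2 + i * δ) (R / 2 + i * δ) ((D.N ^ j) u) * (δ ^ j : ℝ≥0) ≤
      ((Kq + Kp) ^ j : ℝ≥0) * nrm R R u := by
    intro i j
    induction j generalizing i with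
    | zero =>
      intro h
      have := hrj i (by omega)
      simpa using nrm_mono this this u
    | succ j ih =>
      intro h
      have h1 := ih (i + 1) (by omega)
      set s := R / 2 + i * δ with hs
      set t := R / 2 + (i + 1 : ℕ) * δ with ht
      have hts : t = s + δ := by rw [ht, hs]; push_cast; ring
      have hst : s < t := by rw [hts]; exact lt_add_of_pos_right _ hδ0
      have hts' : t - s = δ := by rw [hts, add_tsub_cancel_left]
      have ht1 : R / 2 ≤ t := by rw [ht]; exact le_self_add
      have ht2 : t ≤ R := hrj _ (by omega)
      set w := (D.N ^ j) u
      rw [pow_succ', Module.End.mul_apply, N_apply]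
      have hX := nrm_pderiv_le hst 0 (D.q w)
      have hY := nrm_pderiv_le hst 1 (D.p w)
      rw [hts'] at hX hY
      calc nrm s s (Dx (D.q w) - Dy (D.p w)) * (δ ^ (j + 1) : ℝ≥0)
          ≤ (nrm s s (Dx (D.q w)) + nrm s s (Dy (D.p w))) * (δ ^ (j + 1) : ℝ≥0) := by
            gcongr; exact nrm_sub_le _ _ _ _
        _ = (nrm s s (Dx (D.q w)) * δ + nrm s s (Dy (D.p w)) * δ) * (δ ^ j : ℝ≥0) := by
            push_cast; ring
        _ ≤ (Kq * nrm t t w + Kp * nrm t t w) * (δ ^ j : ℝ≥0) := by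
            exact mul_le_mul' (add_le_add (hX.trans (hq t ht1 ht2 w))
              (hY.trans (hp t ht1 ht2 w))) le_rfl
        _ = (Kq + Kp : ℝ≥0) * (nrm t t w * (δ ^ j : ℝ≥0)) := by push_cast; ring
        _ ≤ (Kq + Kp : ℝ≥0) * (((Kq + Kp) ^ j : ℝ≥0) * nrm R R u) := by gcongr
        _ = _ := by push_cast; ring
  have h := key 0 k (by omega)
  have e : nrm (R / 2) (R / 2) ((D.N ^ k) u) ≤
      ((δ ^ k)⁻¹ : ℝ≥0) * (((Kq + Kp) ^ k : ℝ≥0) * nrm R R u) := by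
    rw [ENNReal.coe_inv (by positivity), mul_comm, ← div_eq_mul_inv,
      ENNReal.le_div_iff_mul_le (Or.inl (by exact_mod_cast (pow_pos hδ0 k).ne'))
        (Or.inl ENNReal.coe_ne_top)]
    simpa using h
  refine e.trans ?_
  rw [← mul_assoc, ← ENNReal.coe_mul]
  refine mul_le_mul' (ENNReal.coe_le_coe.2 ?_) le_rfl
  calc (δ ^ k)⁻¹ * (Kq + Kp) ^ k = (k : ℝ≥0) ^ k * ((Kq + Kp) * (R / 2)⁻¹) ^ k := by
        rw [hδ, div_pow, inv_div, mul_pow, inv_pow]; ring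
    _ ≤ 3 ^ k * (k.factorial : ℝ≥0) * ((Kq + Kp) * (R / 2)⁻¹) ^ k := by
        gcongr; exact pow_self_le k
    _ = _ := by rw [mul_assoc (3 : ℝ≥0), mul_pow (3 : ℝ≥0)]; ring
where half_le_self_aux {R : ℝ≥0} : R / 2 ≤ R := half_le_self zero_le

lemma eventually_bound {L : PS →ₗ[ℂ] PS} (hL : BddOp L) :
    ∀ᶠ R in 𝓝[>] (0 : ℝ≥0), ∃ K B : ℝ≥0, ∀ (k : ℕ) (u : PS),
    nrm (R / 2) (R / 2) (L ((D.N ^ k) u)) ≤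
      ((B * (K ^ k * k.factorial) : ℝ≥0) : ℝ≥0∞) * nrm R R u := by
  filter_upwards [D.eventually_N_bound, hL.eventually] with R h1 h2
  obtain ⟨K, hK⟩ := h1
  obtain ⟨B, hB⟩ := h2
  refine ⟨K, B, fun k u => (hB _ le_rfl (half_le_self zero_le) _).trans ?_⟩
  rw [ENNReal.coe_mul, mul_assoc]
  gcongr
  exact hK k u

lemma eventually_Phi_bound :
    ∀ᶠ R in 𝓝[>] (0 : ℝ≥0), ∃ K B : ℝ≥0, ∀ (u : PS) (k : ℕ) (i : Fin μ),
    (‖D.Phi u k i‖₊ : ℝ≥0∞) ≤ ((B * (K ^ k * k.factorial) : ℝ≥0) : ℝ≥0∞) * nrm R R u := by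
  filter_upwards [eventually_all.2 fun i => D.eventually_bound (D.bdd_c i)] with R h
  choose K B h using h
  refine ⟨∑ i, K i, ∑ i, B i, fun u k i => ?_⟩
  have h1 := h i k u
  simp only [LinearMap.smulRight_apply, LinearMap.comp_apply, LinearMap.proj_apply,
    smul_eq_C_mul, mul_one, nrm_C] at h1
  refine h1.trans ?_
  have hK : K i ≤ ∑ i, K i := Finset.single_le_sum (fun _ _ => zero_le) (Finset.mem_univ i)
  have hB : B i ≤ ∑ i, B i := Finset.single_le_sum (fun _ _ => zero_le) (Finset.mem_univ i)
  gcongr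

end Division

namespace Division
variable {μ : ℕ} {f : PS} {b : Fin μ → PS} (D : Division f b)

/-- The linear combination of the basis with given coefficients. -/
noncomputable def lin (b : Fin μ → PS) : (Fin μ → ℂ) →ₗ[ℂ] PS :=
  ∑ i, (LinearMap.proj i).smulRight (b i)

lemma lin_apply (c : Fin μ → ℂ) : lin b c = ∑ i, C (c i) * b i := by
  simp [lin, smul_eq_C_mul]

lemma conv_lin (M : Milnor f b) (c : Fin μ → ℂ) : Conv (lin b c) := by
  rw [lin_apply]; exact Conv.sum fun i _ => (conv_C _).mul (M.conv_basis i)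

lemma conv_p {u : PS} (hu : Conv u) : Conv (D.p u) := D.bdd_p.conv hu
lemma conv_q {u : PS} (hu : Conv u) : Conv (D.q u) := D.bdd_q.conv hu

lemma eq_lin (u : PS) : u = lin b (D.c u) + (Dx f * D.q u - Dy f * D.p u) := by
  rw [lin_apply]; exact D.eq u

lemma c_eq (M : Milnor f b) {u : PS} (hu : Conv u) {c : Fin μ → ℂ} (h : InJ f (u - lin b c)) :
    D.c u = c := by
  refine (M.exists_unique u hu).unique ?_ (by rwa [← lin_apply])
  rw [sub_eq_of_eq_add' (D.eq u)]
  exact InJ.of_wedge (D.conv_p hu) (D.conv_q hu)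

lemma c_eq_zero (M : Milnor f b) {u : PS} (h : InJ f u) : D.c u = 0 :=
  D.c_eq M (h.conv M.conv) (by simpa using h)

lemma inJ_of_c_eq_zero {u : PS} (hu : Conv u) (h : D.c u = 0) : InJ f u := by
  rw [D.eq_lin u, h, map_zero, zero_add]
  exact InJ.of_wedge (D.conv_p hu) (D.conv_q hu)

lemma InJ_br {g : PS} (hg : Conv g) : InJ f (br f g) :=
  InJ.of_wedge (hg.pderiv 0) (hg.pderiv 1)

/-- The ambiguity in division by `df` changes the quotient's derivative by a bracket with `f`. -/
lemma exists_N_eq (M : Milnor f b) {u p q : PS} (hu : Conv u) (hp : Conv p) (hq : Conv q)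
    {c : Fin μ → ℂ} (h : u = lin b c + (Dx f * q - Dy f * p)) :
    D.c u = c ∧ ∃ g, Conv g ∧ D.N u = Dx q - Dy p + br f g := by
  have hc : D.c u = c := by
    refine D.c_eq M hu ?_
    rw [h, add_sub_cancel_left]; exact InJ.of_wedge hp hq
  refine ⟨hc, ?_⟩
  have h1 := D.eq_lin u
  rw [hc] at h1
  obtain ⟨k, hk, e1, e2⟩ := M.koszul ((D.conv_p hu).sub hp) ((D.conv_q hu).sub hq)
    (by linear_combination -h1 + h)
  refine ⟨-k, hk.neg, ?_⟩
  rw [N_apply, sub_eq_iff_eq_add.1 e1, sub_eq_iff_eq_add.1 e2]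
  simp only [map_add, Dx_mul, Dy_mul, map_neg, br, Dx_Dy_comm]
  ring

lemma Phi_br (M : Milnor f b) {g : PS} (hg : Conv g) : D.Phi (br f g) = 0 := by
  ext1 k
  induction k generalizing g with
  | zero => exact D.c_eq_zero M (InJ_br hg)
  | succ k ih =>
    obtain ⟨-, h, hh, e⟩ := D.exists_N_eq M (M.conv.br hg) (hg.pderiv 0) (hg.pderiv 1)
      (c := 0) (by rw [map_zero, zero_add]; rfl)
    rw [Phi_succ, e, Dx_Dy_comm, sub_self, zero_add, ih hh]; rfl

lemma Phi_of_eq (M : Milnor f b) {u p q : PS} (hu : Conv u) (hp : Conv p) (hq : Conv q)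
    {c : Fin μ → ℂ} (h : u = lin b c + (Dx f * q - Dy f * p)) :
    D.Phi u 0 = c ∧ ∀ k, D.Phi u (k + 1) = D.Phi (Dx q - Dy p) k := by
  obtain ⟨h1, g, hg, h2⟩ := D.exists_N_eq M hu hp hq h
  refine ⟨h1, fun k => ?_⟩
  rw [Phi_succ, h2, map_add, D.Phi_br M hg, add_zero]

lemma Phi_wedge (M : Milnor f b) {p q : PS} (hp : Conv p) (hq : Conv q) :
    D.Phi (Dx f * q - Dy f * p) 0 = 0 ∧
    ∀ k, D.Phi (Dx f * q - Dy f * p) (k + 1) = D.Phi (Dx q - Dy p) k :=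
  D.Phi_of_eq M ((InJ.of_wedge hp hq).conv M.conv) hp hq (by simp)

lemma Phi_lin (M : Milnor f b) (c : Fin μ → ℂ) :
    D.Phi (lin b c) 0 = c ∧ ∀ k, D.Phi (lin b c) (k + 1) = 0 := by
  have := D.Phi_of_eq M (conv_lin M c) conv_zero conv_zero (c := c) (by simp)
  simpa using this

lemma Phi_Sop (M : Milnor f b) {u : PS} (hu : Conv u) :
    D.Phi (Sop f u) 0 = 0 ∧ ∀ k, D.Phi (Sop f u) (k + 1) = D.Phi u k := by
  have h := D.Phi_wedge M ((conv_X 1).mul hu.L2).neg ((conv_X 0).mul hu.L2)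
  rw [d_L2] at h
  have e : Dx f * (X 0 * L2 u) - Dy f * -(X 1 * L2 u) = Sop f u := by
    rw [Sop_apply, eul]; ring
  rwa [e] at h

/-- Partial expansion of a series all of whose remainders vanish. -/
lemma partial_sum (u : PS) (hu : D.Phi u = 0) (m : ℕ) :
    u = (Sop f ^ m) ((D.N ^ m) u) + br f (∑ k ∈ Finset.range m,
      (Sig f ^ k) (prim (D.p ((D.N ^ k) u)) (D.q ((D.N ^ k) u)))) := by
  induction m with
  | zero => simp [br_zero]
  | succ m ih =>
    have h1 := D.eq_lin ((D.N ^ m) u)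
    rw [← Phi_apply, hu, Pi.zero_apply, map_zero, zero_add, wedge_eq, ← N_apply] at h1
    rw [h1, map_add, Sop_pow_br] at ih
    rw [Finset.sum_range_succ, br_add, pow_succ, pow_succ', Module.End.mul_apply,
      Module.End.mul_apply]
    exact ih.trans (by abel)

lemma exists_br_of_Phi_eq_zero (M : Milnor f b) {u : PS} (hu : Conv u) (h : D.Phi u = 0) :
    ∃ g, Conv g ∧ u = br f g := by
  set Γ : PS →ₗ[ℂ] PS := LinearMap.mulLeft ℂ (X 0) ∘ₗ D.p + LinearMap.mulLeft ℂ (X 1) ∘ₗ D.q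
    with hΓ
  have bΓ : BddOp Γ := ((BddOp.mulLeft (conv_X 0)).comp D.bdd_p).add
    ((BddOp.mulLeft (conv_X 1)).comp D.bdd_q)
  obtain ⟨R, hR, -, ⟨⟨⟨K, hK⟩, K', B, hKB⟩, hfin⟩⟩ := exists_radius
    ((D.eventually_N_bound.and (D.eventually_bound bΓ)).and hu.eventually) one_pos
  set κ : ℝ≥0 := K + K' + 1 with hκ
  have hκ0 : 0 < κ := by positivity
  obtain ⟨r, hr, hrR, hr1, hr2⟩ := exists_radius
    ((M.conv.eul.eventually_small (ord_eul f) (ε := (2 * κ)⁻¹) (by positivity)).and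
      (M.conv.pderiv 0).eventually |>.and (M.conv.pderiv 1).eventually)
    (R0 := R / 2) (by positivity)
  obtain ⟨hr1, hr3⟩ := hr1
  set w : ℕ → PS := fun k => (D.N ^ k) u
  set γ : ℕ → PS := fun k => prim (D.p (w k)) (D.q (w k))
  have key : ∀ (k : ℕ) (A K₁ : ℝ≥0), K₁ ≤ κ →
      (((k.factorial : ℕ) : ℝ≥0)⁻¹ : ℝ≥0) * (nrm r r (eul f) ^ k *
        (((A * (K₁ ^ k * k.factorial) : ℝ≥0) : ℝ≥0∞) * nrm R R u)) ≤
      (((1 / 2) ^ k : ℝ≥0) : ℝ≥0∞) * (A * nrm R R u) := by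
    intro k A K₁ hK₁
    calc _ ≤ ((((k.factorial : ℕ) : ℝ≥0)⁻¹ : ℝ≥0) : ℝ≥0∞) * (((2 * κ)⁻¹ : ℝ≥0) ^ k *
        (((A * (κ ^ k * k.factorial) : ℝ≥0) : ℝ≥0∞) * nrm R R u)) := by gcongr
      _ = (((((k.factorial : ℕ) : ℝ≥0)⁻¹ * (((2 * κ)⁻¹) ^ k *
        ((κ ^ k * k.factorial)))) : ℝ≥0) : ℝ≥0∞) * (A * nrm R R u) := by push_cast; ring
      _ = _ := by
        congr 2
        have : (k.factorial : ℝ≥0) ≠ 0 := by exact_mod_cast k.factorial_ne_zero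
        rw [mul_inv, mul_pow, one_div]
        field_simp
        rw [← mul_pow, one_div_mul_cancel hκ0.ne', one_pow]
  have hS : ∀ k, nrm r r ((Sop f ^ k) (w k)) ≤ (((1 / 2) ^ k : ℝ≥0) : ℝ≥0∞) * nrm R R u := by
    intro k
    refine (nrm_Sop_pow_le f r r k _).trans ?_
    refine le_trans ?_ ((key k 1 K ?_).trans (by simp))
    · gcongr
      exact (nrm_mono hrR hrR _).trans (by simpa using hK k u)
    · rw [hκ, add_assoc]; exact le_self_add
  have hG : ∀ k, nrm r r ((Sig f ^ k) (γ k)) ≤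
      (((1 / 2) ^ k : ℝ≥0) : ℝ≥0∞) * (B * nrm R R u) := by
    intro k
    refine (nrm_Sig_pow_le f r r k _).trans ?_
    refine le_trans ?_ (key k B K' ?_)
    · gcongr
      refine (nrm_mono hrR hrR _).trans ?_
      refine le_trans ?_ (hKB k u)
      refine (nrm_L0_le (k := 0) (ord_one (by simp))).trans ?_
      simp [hΓ, w]
    · rw [hκ, add_right_comm]; exact le_add_self
  have hB : (B : ℝ≥0∞) * nrm R R u ≠ ∞ := ENNReal.mul_ne_top ENNReal.coe_ne_top hfin.ne
  have hgeo : ∑' k : ℕ, (((1 / 2) ^ k : ℝ≥0) : ℝ≥0∞) ≠ ∞ :=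
    ENNReal.tsum_coe_ne_top_iff_summable.2 (NNReal.summable_geometric (by norm_num))
  have hsum : ∑' k, nrm r r ((Sig f ^ k) (γ k)) ≠ ∞ := by
    refine ne_top_of_le_ne_top ?_ (ENNReal.tsum_le_tsum hG)
    rw [ENNReal.tsum_mul_right]
    exact ENNReal.mul_ne_top hgeo hB
  obtain ⟨g, hg, hlim⟩ := exists_sum_of_nrm hr hr hsum
  have hgc : Conv g := conv_of_nrm hr hr (hg.trans_lt (lt_top_iff_ne_top.2 hsum))
  refine ⟨g, hgc, ?_⟩
  have hr0 : 0 < r / 2 := by positivity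
  have hlt : r / 2 < r := half_lt_self hr
  refine eq_of_tendsto_nrm hr0 hr0
    (a := fun m => br f (∑ k ∈ Finset.range m, (Sig f ^ k) (γ k))) ?_ ?_
  · have e : ∀ m, u - br f (∑ k ∈ Finset.range m, (Sig f ^ k) (γ k)) = (Sop f ^ m) (w m) :=
      fun m => sub_eq_of_eq_add (D.partial_sum u h m)
    simp only [e]
    have ht : Tendsto (fun m : ℕ => (((1 / 2) ^ m : ℝ≥0) : ℝ≥0∞) * nrm R R u) atTop (𝓝 0) := by
      have := ENNReal.Tendsto.mul_const (b := nrm R R u)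
        (ENNReal.tendsto_atTop_zero_of_tsum_ne_top hgeo) (Or.inr hfin.ne)
      simpa using this
    exact tendsto_of_tendsto_of_tendsto_of_le_of_le tendsto_const_nhds ht (fun _ => zero_le)
      fun m => (nrm_mono hlt.le hlt.le _).trans (hS m)
  · simp only [← br_sub]
    set δ : ℝ≥0 := r - r / 2 with hδ
    have hδ0 : 0 < δ := tsub_pos_of_lt hlt
    refine tendsto_nrm_of_le (t := (nrm r r (Dx f) + nrm r r (Dy f)) * ((δ⁻¹ : ℝ≥0) : ℝ≥0∞))
      (ENNReal.mul_ne_top (ENNReal.add_ne_top.2 ⟨hr3.ne, hr2.ne⟩) ENNReal.coe_ne_top)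
      (fun m => ?_) hlim
    set e := g - ∑ k ∈ Finset.range m, (Sig f ^ k) (γ k)
    have hd : ∀ i, nrm (r / 2) (r / 2) (pderiv ℂ i e) ≤ (δ⁻¹ : ℝ≥0) * nrm r r e := by
      intro i
      rw [ENNReal.coe_inv hδ0.ne', mul_comm, ← div_eq_mul_inv, ENNReal.le_div_iff_mul_le
        (Or.inl (by exact_mod_cast hδ0.ne')) (Or.inl ENNReal.coe_ne_top)]
      exact nrm_pderiv_le hlt i e
    calc nrm (r / 2) (r / 2) (br f e)
        ≤ nrm (r / 2) (r / 2) (Dx f * Dy e) + nrm (r / 2) (r / 2) (Dy f * Dx e) :=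
          nrm_sub_le _ _ _ _
      _ ≤ nrm r r (Dx f) * ((δ⁻¹ : ℝ≥0) * nrm r r e) +
          nrm r r (Dy f) * ((δ⁻¹ : ℝ≥0) * nrm r r e) := by
          refine add_le_add ((nrm_mul_le _ _ _ _).trans ?_) ((nrm_mul_le _ _ _ _).trans ?_)
          · exact mul_le_mul' (nrm_mono hlt.le hlt.le _) (hd 1)
          · exact mul_le_mul' (nrm_mono hlt.le hlt.le _) (hd 0)
      _ = _ := by ring

end Division

/-- Gevrey sequences (of order one) of vectors. -/
def Gev {μ : ℕ} (v : ℕ → Fin μ → ℂ) : Prop :=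
  ∃ B K : ℝ≥0, ∀ k i, ‖v k i‖₊ ≤ B * (K ^ k * k.factorial)

lemma Gev.shift {μ : ℕ} {v : ℕ → Fin μ → ℂ} (h : Gev v) : Gev fun k => v (k + 1) := by
  obtain ⟨B, K, h⟩ := h
  refine ⟨B * K, 2 * K, fun k i => (h (k + 1) i).trans ?_⟩
  have h2 : ((k + 1 : ℕ) : ℝ≥0) ≤ 2 ^ k := by exact_mod_cast k.lt_two_pow_self
  calc B * (K ^ (k + 1) * (k + 1).factorial)
      = B * K * K ^ k * k.factorial * ((k + 1 : ℕ) : ℝ≥0) := by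
        rw [Nat.factorial_succ]; push_cast; ring
    _ ≤ B * K * K ^ k * k.factorial * 2 ^ k := by gcongr
    _ = _ := by rw [mul_pow]; ring

namespace Division
variable {μ : ℕ} {f : PS} {b : Fin μ → PS} (D : Division f b)

lemma gev_Phi {u : PS} (hu : Conv u) : Gev (D.Phi u) := by
  obtain ⟨R, -, -, ⟨K, B, h⟩, hfin⟩ :=
    exists_radius (D.eventually_Phi_bound.and hu.eventually) one_pos
  refine ⟨B * (nrm R R u).toNNReal, K, fun k i => ?_⟩
  have := h u k i
  rw [← ENNReal.coe_toNNReal hfin.ne, ← ENNReal.coe_mul, ENNReal.coe_le_coe] at this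
  exact this.trans (by rw [mul_right_comm])

/-- `u` is the convergent sum of the series `∑ S ^ k (v k)`. -/
def Rep (f : PS) (b : Fin μ → PS) (v : ℕ → Fin μ → ℂ) (u : PS) : Prop :=
  ∃ r : ℝ≥0, 0 < r ∧ nrm r r (eul f) < ∞ ∧ nrm r r u < ∞ ∧
    Tendsto (fun m => nrm r r (u - ∑ k ∈ Finset.range m, (Sop f ^ k) (lin b (v k)))) atTop (𝓝 0)

lemma Rep.conv {v : ℕ → Fin μ → ℂ} {u : PS} (h : Rep f b v u) : Conv u := by
  obtain ⟨r, hr, -, h, -⟩ := h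
  exact ⟨r, hr, h⟩

lemma exists_rep (M : Milnor f b) {v : ℕ → Fin μ → ℂ} (hv : Gev v) : ∃ u, Rep f b v u := by
  obtain ⟨B, K, hv⟩ := hv
  obtain ⟨r, hr, -, hr1, hr2⟩ := exists_radius
    ((M.conv.eul.eventually_small (ord_eul f) (ε := (2 * (K + 1))⁻¹) (by positivity)).and
    (eventually_all.2 fun i => (M.conv_basis i).eventually)) one_pos
  have hfac : ∀ k : ℕ, (k.factorial : ℝ≥0) ≠ 0 := fun k => by exact_mod_cast k.factorial_ne_zero
  have hA : B * ∑ i, nrm r r (b i) ≠ ∞ := ENNReal.mul_ne_top ENNReal.coe_ne_top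
    (ENNReal.sum_ne_top.2 fun i _ => (hr2 i).ne)
  have key : ∀ k, nrm r r ((Sop f ^ k) (lin b (v k))) ≤
      (((1 / 2) ^ k : ℝ≥0) : ℝ≥0∞) * (B * ∑ i, nrm r r (b i)) := by
    intro k
    refine (nrm_Sop_pow_le f r r k _).trans ?_
    calc _ ≤ ((((k.factorial : ℕ) : ℝ≥0)⁻¹ : ℝ≥0) : ℝ≥0∞) * (((2 * (K + 1))⁻¹ : ℝ≥0) ^ k *
        (((B * ((K + 1) ^ k * k.factorial) : ℝ≥0) : ℝ≥0∞) * ∑ i, nrm r r (b i))) := by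
          gcongr
          rw [lin_apply, Finset.mul_sum]
          refine (nrm_sum_le _ _ _ _).trans (Finset.sum_le_sum fun i _ => ?_)
          refine (nrm_C_mul_le _ _ _ _).trans ?_
          gcongr
          exact (hv k i).trans (by gcongr; exact le_self_add)
      _ = (((((k.factorial : ℕ) : ℝ≥0)⁻¹ * (((2 * (K + 1))⁻¹) ^ k *
        (((K + 1) ^ k * k.factorial)))) : ℝ≥0) : ℝ≥0∞) * (B * ∑ i, nrm r r (b i)) := by
          push_cast; ring
      _ = _ := by
        congr 2
        have h0 : (K + 1 : ℝ≥0) ≠ 0 := by positivity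
        have := hfac k
        rw [mul_inv, mul_pow, one_div]
        field_simp
        rw [← mul_pow, one_div_mul_cancel h0, one_pow]
  have hsum : ∑' k, nrm r r ((Sop f ^ k) (lin b (v k))) ≠ ∞ := by
    refine ne_top_of_le_ne_top ?_ (ENNReal.tsum_le_tsum key)
    rw [ENNReal.tsum_mul_right]
    exact ENNReal.mul_ne_top (ENNReal.tsum_coe_ne_top_iff_summable.2
      (NNReal.summable_geometric (by norm_num))) hA
  obtain ⟨u, hu, hlim⟩ := exists_sum_of_nrm hr hr hsum
  exact ⟨u, r, hr, hr1.trans_lt ENNReal.coe_lt_top,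
    hu.trans_lt (lt_top_iff_ne_top.2 hsum), hlim⟩

lemma Rep.eq_add {v : ℕ → Fin μ → ℂ} {u u' : PS} (h : Rep f b v u)
    (h' : Rep f b (fun k => v (k + 1)) u') : u = lin b (v 0) + Sop f u' := by
  obtain ⟨r, hr, he, -, hl⟩ := h
  obtain ⟨r', hr', he', -, hl'⟩ := h'
  have hs : 0 < min r r' := lt_min hr hr'
  set s := min r r'
  have hle : s ≤ r := min_le_left _ _
  have hle' : s ≤ r' := min_le_right _ _
  refine eq_of_tendsto_nrm hs hs
    (a := fun m => ∑ k ∈ Finset.range (m + 1), (Sop f ^ k) (lin b (v k))) ?_ ?_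
  · exact tendsto_nrm_of_le (t := 1) ENNReal.one_ne_top
      (fun m => by rw [one_mul]; exact nrm_mono hle hle _) ((tendsto_add_atTop_iff_nat 1).2 hl)
  · refine tendsto_nrm_of_le (t := nrm r' r' (eul f)) he'.ne (fun m => ?_) hl'
    have e : lin b (v 0) + Sop f u' - ∑ k ∈ Finset.range (m + 1), (Sop f ^ k) (lin b (v k)) =
        Sop f (u' - ∑ k ∈ Finset.range m, (Sop f ^ k) (lin b (v (k + 1)))) := by
      rw [Finset.sum_range_succ', map_sub, map_sum]
      simp only [pow_succ', Module.End.mul_apply, pow_zero, Module.End.one_apply]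
      abel
    rw [e]
    exact (nrm_mono hle' hle' _).trans (nrm_Sop_le f r' r' _)

lemma Phi_of_rep (M : Milnor f b) {v : ℕ → Fin μ → ℂ} {u : PS} (hv : Gev v) (h : Rep f b v u) :
    D.Phi u = v := by
  ext1 j
  induction j generalizing v u with
  | zero =>
    obtain ⟨u', h'⟩ := exists_rep M hv.shift
    rw [h.eq_add h', map_add, Pi.add_apply, (D.Phi_lin M _).1, (D.Phi_Sop M h'.conv).1, add_zero]
  | succ j ih =>
    obtain ⟨u', h'⟩ := exists_rep M hv.shift
    rw [h.eq_add h', map_add, Pi.add_apply, (D.Phi_lin M _).2, (D.Phi_Sop M h'.conv).2,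
      ih hv.shift h', zero_add]

lemma exists_Phi_eq (M : Milnor f b) {v : ℕ → Fin μ → ℂ} (hv : Gev v) :
    ∃ u, Conv u ∧ D.Phi u = v := by
  obtain ⟨u, hu⟩ := exists_rep M hv
  exact ⟨u, hu.conv, D.Phi_of_rep M hv hu⟩

/-- The matrices describing multiplication by `f` on remainders. -/
noncomputable def A (k : ℕ) : (Fin μ → ℂ) →ₗ[ℂ] (Fin μ → ℂ) :=
  LinearMap.proj k ∘ₗ D.Phi ∘ₗ LinearMap.mulLeft ℂ f ∘ₗ lin b

lemma A_apply (k : ℕ) (c : Fin μ → ℂ) : D.A k c = D.Phi (f * lin b c) k := rfl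

lemma Phi_mul (M : Milnor f b) {u : PS} (hu : Conv u) (n : ℕ) :
    D.Phi (f * u) n = ∑ k ∈ Finset.range (n + 1), D.A (n - k) (D.Phi u k) +
      ((n - 1 : ℕ) : ℂ) • D.Phi u (n - 1) := by
  induction n generalizing u with
  | zero =>
    obtain ⟨h1, -⟩ := D.Phi_wedge M (M.conv.mul (D.conv_p hu)) (M.conv.mul (D.conv_q hu))
    have h := D.eq_lin u
    have e : f * u = f * lin b (D.c u) + (Dx f * (f * D.q u) - Dy f * (f * D.p u)) := by
      linear_combination f * h
    rw [e, map_add, Pi.add_apply, h1]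
    simp [A_apply, Phi_zero_eq]
  | succ n ih =>
    obtain ⟨-, h1⟩ := D.Phi_wedge M (M.conv.mul (D.conv_p hu)) (M.conv.mul (D.conv_q hu))
    have h := D.eq_lin u
    have e : f * u = f * lin b (D.c u) + (Dx f * (f * D.q u) - Dy f * (f * D.p u)) := by
      linear_combination f * h
    have e' : Dx (f * D.q u) - Dy (f * D.p u) = f * D.N u + (u - lin b (D.c u)) := by
      rw [Dx_mul, Dy_mul, N_apply]; linear_combination -h
    rw [e, map_add, Pi.add_apply, h1, e', map_add, Pi.add_apply, ih (D.conv_N hu),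
      Finset.sum_range_succ' (fun k => D.A (n + 1 - k) (D.Phi u k)), map_sub, Pi.sub_apply]
    simp only [Nat.add_sub_add_right, ← Phi_succ, Nat.sub_zero, A_apply, Phi_zero_eq,
      add_tsub_cancel_right]
    cases n with
    | zero => simp [(D.Phi_lin M _).1, Phi_zero_eq, add_comm]
    | succ n =>
      rw [(D.Phi_lin M _).2]
      simp only [add_tsub_cancel_right]
      push_cast
      module

/-- Differential of a `1`-form, divided by `dx ∧ dy`. -/
noncomputable def dform : PS × PS →ₗ[ℂ] PS :=
  Dx.toLinearMap ∘ₗ LinearMap.snd ℂ PS PS - Dy.toLinearMap ∘ₗ LinearMap.fst ℂ PS PS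

lemma dform_apply (α : PS × PS) : dform α = Dx α.2 - Dy α.1 := rfl

/-- Convergent cocycles of the relative de Rham complex. -/
def Coc (f : PS) (α : PS × PS) : Prop := Conv α.1 ∧ Conv α.2 ∧ InJ f (dform α)

/-- Convergent coboundaries of the relative de Rham complex. -/
def Cob (f : PS) (α : PS × PS) : Prop :=
  ∃ g h, Conv g ∧ Conv h ∧ α.1 = Dx g + h * Dx f ∧ α.2 = Dy g + h * Dy f

/-- The coordinates of a cocycle. -/
noncomputable def Psi : PS × PS →ₗ[ℂ] (ℕ → Fin μ → ℂ) :=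
  LinearMap.funLeft ℂ (Fin μ → ℂ) Nat.succ ∘ₗ D.Phi ∘ₗ dform

lemma Psi_apply (α : PS × PS) (n : ℕ) : D.Psi α n = D.Phi (dform α) (n + 1) := rfl

lemma conv_dform {α : PS × PS} (h1 : Conv α.1) (h2 : Conv α.2) : Conv (dform α) :=
  (h2.pderiv 0).sub (h1.pderiv 1)

lemma gev_Psi {α : PS × PS} (h : Coc f α) : Gev (D.Psi α) :=
  (D.gev_Phi (conv_dform h.1 h.2.1)).shift

lemma exists_Psi_eq (M : Milnor f b) {v : ℕ → Fin μ → ℂ} (hv : Gev v) :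
    ∃ α, Coc f α ∧ D.Psi α = v := by
  have hv' : Gev (fun k => Nat.casesOn k (0 : Fin μ → ℂ) v) := by
    obtain ⟨B, K, hv⟩ := hv
    refine ⟨B, K + 1, fun k i => ?_⟩
    cases k with
    | zero => simp
    | succ k =>
      refine (hv k i).trans ?_
      have h1 : K ^ k ≤ (K + 1) ^ (k + 1) :=
        (pow_le_pow_left₀ (zero_le (a := K)) le_self_add k).trans
          (pow_le_pow_right₀ le_add_self k.le_succ)
      have h2 : (k.factorial : ℝ≥0) ≤ (k + 1).factorial := by
        exact_mod_cast Nat.factorial_le k.le_succ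
      gcongr
  obtain ⟨u, hu, e⟩ := D.exists_Phi_eq M hv'
  refine ⟨(-(X 1 * L2 u), X 0 * L2 u),
    ⟨((conv_X 1).mul hu.L2).neg, (conv_X 0).mul hu.L2, ?_⟩, ?_⟩
  · rw [dform_apply, d_L2]
    exact D.inJ_of_c_eq_zero hu (congrFun e 0)
  · ext1 n
    rw [Psi_apply, dform_apply, d_L2, e]

lemma cob_of_Psi_eq_zero (M : Milnor f b) {α : PS × PS} (h : Coc f α) (h0 : D.Psi α = 0) :
    Cob f α := by
  have hc := conv_dform h.1 h.2.1
  have : D.Phi (dform α) = 0 := by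
    ext1 k
    cases k with
    | zero => exact D.c_eq_zero M h.2.2
    | succ k => exact congrFun h0 k
  obtain ⟨g, hg, e⟩ := D.exists_br_of_Phi_eq_zero M hc this
  rw [dform_apply] at e
  have hcl : Dx (α.2 + g * Dy f) = Dy (α.1 + g * Dx f) := by
    rw [map_add, map_add, Dx_mul, Dy_mul, Dx_Dy_comm]
    unfold br at e
    linear_combination e
  obtain ⟨e1, e2⟩ := poincare hcl
  refine ⟨_, -g, Conv.prim (h.1.add (hg.mul (M.conv.pderiv 0)))
    (h.2.1.add (hg.mul (M.conv.pderiv 1))), hg.neg, ?_, ?_⟩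
  · rw [e1]; ring
  · rw [e2]; ring

lemma Psi_of_cob (M : Milnor f b) {α : PS × PS} (h : Cob f α) : D.Psi α = 0 := by
  obtain ⟨g, h, hg, hh, e1, e2⟩ := h
  have : dform α = br f (-h) := by
    rw [dform_apply, e1, e2]
    simp only [map_add, Dx_mul, Dy_mul, map_neg, br, Dx_Dy_comm]
    ring
  ext1 n
  rw [Psi_apply, this, D.Phi_br M hh.neg]; rfl

lemma Psi_mul (M : Milnor f b) {α : PS × PS} (h : Coc f α) (n : ℕ) :
    D.Psi (f * α.1, f * α.2) n = ∑ k ∈ Finset.range (n + 1), D.A (n - k) (D.Psi α k) +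
      ((n + 1 : ℕ) : ℂ) • (if n = 0 then 0 else D.Psi α (n - 1)) := by
  have e : dform (f * α.1, f * α.2) = f * dform α + (Dx f * α.2 - Dy f * α.1) := by
    simp only [dform_apply, Dx_mul, Dy_mul]; ring
  have h0 : D.Phi (dform α) 0 = 0 := D.c_eq_zero M h.2.2
  rw [Psi_apply, e, map_add, Pi.add_apply, (D.Phi_wedge M h.1 h.2.1).2, ← dform_apply,
    D.Phi_mul M (conv_dform h.1 h.2.1), Finset.sum_range_succ', h0]
  simp only [Nat.add_sub_add_right, map_zero, add_zero, add_tsub_cancel_right]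
  cases n with
  | zero => simp [Psi_apply, h0]
  | succ n =>
    rw [if_neg (Nat.succ_ne_zero n)]
    simp only [Psi_apply, add_tsub_cancel_right]
    push_cast
    module

lemma Coc.mul (M : Milnor f b) {α : PS × PS} (h : Coc f α) : Coc f (f * α.1, f * α.2) := by
  refine ⟨M.conv.mul h.1, M.conv.mul h.2.1, ?_⟩
  have e : dform (f * α.1, f * α.2) = f * dform α + (Dx f * α.2 - Dy f * α.1) := by
    simp only [dform_apply, Dx_mul, Dy_mul]; ring
  rw [e]
  exact (h.2.2.mul_left M.conv).add (InJ.of_wedge h.1 h.2.1)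

lemma gev_A (M : Milnor f b) : ∃ B K : ℝ≥0, ∀ k i j,
    ‖D.A k (Pi.single j 1) i‖₊ ≤ B * (K ^ k * k.factorial) := by
  choose B K h using fun j => D.gev_Phi (M.conv.mul (conv_lin M (Pi.single j (1 : ℂ))))
  refine ⟨∑ j, B j, ∑ j, K j, fun k i j => (h j k i).trans ?_⟩
  have hK : K j ≤ ∑ i, K i := Finset.single_le_sum (fun _ _ => zero_le) (Finset.mem_univ j)
  have hB : B j ≤ ∑ i, B i := Finset.single_le_sum (fun _ _ => zero_le) (Finset.mem_univ j)
  gcongr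

lemma A_zero_nilpotent (M : Milnor f b) : IsNilpotent (D.A 0) := by
  obtain ⟨m, hm⟩ := M.exists_pow_mem M.conv M.coeff_zero
  refine ⟨m, LinearMap.ext fun c => ?_⟩
  have key : ∀ k, (D.A 0 ^ k) c = D.Phi (f ^ k * lin b c) 0 := by
    intro k
    induction k with
    | zero => simp [(D.Phi_lin M c).1]
    | succ k ih =>
      rw [pow_succ', Module.End.mul_apply, ih, pow_succ', mul_assoc,
        D.Phi_mul M ((M.conv.pow k).mul (conv_lin M c)) 0]
      simp
  rw [key, mul_comm]
  exact D.c_eq_zero M (hm.mul_left (conv_lin M c))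

end Division

/-- Sequences of vectors. -/
abbrev Sq (m : ℕ) := ℕ → Fin m → ℂ

lemma tsum_conv (h g : ℕ → ℝ≥0∞) :
    ∑' n, ∑ k ∈ Finset.range (n + 1), h (n - k) * g k = (∑' n, h n) * ∑' n, g n := by
  have e : ∀ n, ∑ k ∈ Finset.range (n + 1), h (n - k) * g k =
      ∑ p ∈ Finset.HasAntidiagonal.antidiagonal n, g p.1 * h p.2 := fun n => by
    rw [Finset.Nat.sum_antidiagonal_eq_sum_range_succ_mk]
    exact Finset.sum_congr rfl fun k _ => mul_comm _ _
  have e2 : (∑' n, h n) * ∑' n, g n = ∑' p : ℕ × ℕ, g p.1 * h p.2 := by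
    rw [mul_comm, ENNReal.tsum_prod (f := fun a b => g a * h b), ← ENNReal.tsum_mul_right]
    simp_rw [ENNReal.tsum_mul_left]
  rw [e2, ← Finset.HasAntidiagonal.sigmaAntidiagonalEquivProd.tsum_eq, ENNReal.tsum_sigma']
  refine tsum_congr fun n => ?_
  rw [e, tsum_fintype, Finset.univ_eq_attach]
  simp only [Finset.HasAntidiagonal.sigmaAntidiagonalEquivProd_apply]
  exact (Finset.sum_attach _ (fun p : ℕ × ℕ => g p.1 * h p.2)).symm

/-- The weights of the sequence norms. -/
noncomputable def wt (r : ℝ≥0) (n : ℕ) : ℝ≥0 := r ^ n / (n + 1).factorial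

lemma wt_pos {r : ℝ≥0} (hr : 0 < r) (n : ℕ) : 0 < wt r n := by
  have := (n + 1).factorial_pos
  unfold wt; positivity

lemma wt_succ (r : ℝ≥0) (n : ℕ) : ((n + 2 : ℕ) : ℝ≥0) * wt r (n + 1) = r * wt r n := by
  unfold wt
  rw [Nat.factorial_succ (n + 1)]
  have : ((n + 1).factorial : ℝ≥0) ≠ 0 := by exact_mod_cast (n + 1).factorial_ne_zero
  have : ((n + 2 : ℕ) : ℝ≥0) ≠ 0 := by positivity
  push_cast at *
  field_simp
  ring

lemma wt_add_le (r : ℝ≥0) {m k N : ℕ} (hm : m ≠ 0) (hk : N ≤ k) :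
    m.factorial * wt r (m + k) ≤ r ^ m / (N + 1) * wt r k := by
  have hN : (N + 1) * (k + 1).factorial * m.factorial ≤ (m + k + 1).factorial := by
    obtain ⟨m, rfl⟩ := Nat.exists_eq_succ_of_ne_zero hm
    clear hm
    induction m with
    | zero =>
      rw [show (0 : ℕ).succ + k + 1 = (k + 1) + 1 by omega, Nat.factorial_succ (k + 1)]
      simp only [Nat.succ_eq_add_one, zero_add, Nat.factorial_one, mul_one]
      gcongr
      omega
    | succ m ih =>
      rw [show (m + 1).succ + k + 1 = (m.succ + k + 1) + 1 by omega,
        Nat.factorial_succ (m.succ + k + 1), Nat.factorial_succ (m + 1), mul_left_comm]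
      refine Nat.mul_le_mul (by omega) ih
  have h1 : ((m + k + 1).factorial : ℝ≥0) ≠ 0 := by exact_mod_cast (m + k + 1).factorial_ne_zero
  have h2 : ((k + 1).factorial : ℝ≥0) ≠ 0 := by exact_mod_cast (k + 1).factorial_ne_zero
  have hN' : ((N : ℝ≥0) + 1) * (k + 1).factorial * m.factorial ≤ (m + k + 1).factorial := by
    exact_mod_cast hN
  unfold wt
  rw [div_mul_div_comm, ← mul_div_assoc, div_le_div_iff₀ (by positivity) (by positivity), pow_add]
  calc (m.factorial : ℝ≥0) * (r ^ m * r ^ k) * ((N + 1) * (k + 1).factorial)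
      = r ^ m * r ^ k * ((N + 1) * (k + 1).factorial * m.factorial) := by ring
    _ ≤ _ := by gcongr

/-- A weighted `ℓ¹`-norm on sequences. -/
noncomputable def sn {m : ℕ} (p : (Fin m → ℂ) → ℝ≥0) (r : ℝ≥0) (v : Sq m) : ℝ≥0∞ :=
  ∑' n, (p (v n) : ℝ≥0∞) * (wt r n : ℝ≥0∞)

/-- Continuous seminorms. -/
structure NormLike {m : ℕ} (p : (Fin m → ℂ) → ℝ≥0) : Prop where
  add_le : ∀ x y, p (x + y) ≤ p x + p y
  smul : ∀ (c : ℂ) x, p (c • x) = ‖c‖₊ * p x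
  cont : Continuous p

lemma normLike_nnnorm (m : ℕ) : NormLike (fun x : Fin m → ℂ => ‖x‖₊) :=
  ⟨nnnorm_add_le, nnnorm_smul, continuous_nnnorm⟩

section
variable {m : ℕ} {p : (Fin m → ℂ) → ℝ≥0} {r : ℝ≥0}

lemma NormLike.zero (hp : NormLike p) : p 0 = 0 := by
  simpa using hp.smul 0 0

lemma NormLike.sum_le (hp : NormLike p) {ι : Type*} (s : Finset ι) (x : ι → Fin m → ℂ) :
    p (∑ i ∈ s, x i) ≤ ∑ i ∈ s, p (x i) :=
  Finset.le_sum_of_subadditive p hp.zero.le hp.add_le s x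

lemma coord_le_sn (p : (Fin m → ℂ) → ℝ≥0) (r : ℝ≥0) (v : Sq m) (n : ℕ) :
    (p (v n) : ℝ≥0∞) * (wt r n : ℝ≥0∞) ≤ sn p r v :=
  ENNReal.le_tsum n

lemma sn_zero (hp : NormLike p) : sn p r 0 = 0 := by
  simp [sn, hp.zero]

lemma sn_add_le (hp : NormLike p) (u v : Sq m) : sn p r (u + v) ≤ sn p r u + sn p r v := by
  unfold sn
  rw [← ENNReal.tsum_add]
  refine ENNReal.tsum_le_tsum fun n => ?_
  rw [← add_mul]
  gcongr
  exact_mod_cast hp.add_le _ _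

lemma sn_smul (hp : NormLike p) (c : ℂ) (v : Sq m) : sn p r (c • v) = ‖c‖₊ * sn p r v := by
  unfold sn
  rw [← ENNReal.tsum_mul_left]
  refine tsum_congr fun n => ?_
  rw [Pi.smul_apply, hp.smul, ENNReal.coe_mul, mul_assoc]

lemma sn_neg (hp : NormLike p) (v : Sq m) : sn p r (-v) = sn p r v := by
  simpa using sn_smul hp (-1) v

lemma sn_sub_le (hp : NormLike p) (u v : Sq m) : sn p r (u - v) ≤ sn p r u + sn p r v := by
  rw [sub_eq_add_neg, ← sn_neg hp v]; exact sn_add_le hp _ _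

lemma sn_sum_le (hp : NormLike p) {ι : Type*} (s : Finset ι) (x : ι → Sq m) :
    sn p r (∑ i ∈ s, x i) ≤ ∑ i ∈ s, sn p r (x i) :=
  Finset.le_sum_of_subadditive _ (sn_zero hp).le (sn_add_le hp) s x

lemma sn_le_of_le {q : (Fin m → ℂ) → ℝ≥0} {c : ℝ≥0} (h : ∀ x, p x ≤ c * q x) (v : Sq m) :
    sn p r v ≤ c * sn q r v := by
  unfold sn
  rw [← ENNReal.tsum_mul_left]
  refine ENNReal.tsum_le_tsum fun n => ?_
  rw [← mul_assoc, ← ENNReal.coe_mul]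
  exact mul_le_mul' (ENNReal.coe_le_coe.2 (h _)) le_rfl

lemma sn_mono {r s : ℝ≥0} (h : r ≤ s) (v : Sq m) : sn p r v ≤ sn p s v := by
  refine ENNReal.tsum_le_tsum fun n => ?_
  unfold wt
  gcongr

/-- The convolution of a sequence of endomorphisms with a sequence of vectors. -/
def cnv (A : ℕ → (Fin m → ℂ) →ₗ[ℂ] (Fin m → ℂ)) : Sq m →ₗ[ℂ] Sq m :=
  LinearMap.pi fun n => ∑ k ∈ Finset.range (n + 1), A (n - k) ∘ₗ LinearMap.proj k

lemma cnv_apply (A : ℕ → (Fin m → ℂ) →ₗ[ℂ] (Fin m → ℂ)) (v : Sq m) (n : ℕ) :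
    cnv A v n = ∑ k ∈ Finset.range (n + 1), A (n - k) (v k) := by
  simp [cnv]

lemma sn_cnv_le (hp : NormLike p) {A : ℕ → (Fin m → ℂ) →ₗ[ℂ] (Fin m → ℂ)} {ε B K : ℝ≥0}
    (hA : ∀ k x, p (A k x) ≤ B * K ^ k * k.factorial * p x) (hε : ∀ x, p (A 0 x) ≤ ε * p x)
    (hK : K * r ≤ 1 / 2) {N : ℕ} {v : Sq m} (hv : ∀ k < N, v k = 0) :
    sn p r (cnv A v) ≤ (ε + 2 * B / (N + 1) : ℝ≥0) * sn p r v := by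
  set h : ℕ → ℝ≥0 := fun k => if k = 0 then ε else B * (K * r) ^ k / (N + 1) with hh
  have key : ∀ k l, p (A k (v l)) * wt r (k + l) ≤ h k * (p (v l) * wt r l) := by
    intro k l
    rcases lt_or_ge l N with hl | hl
    · simp [hv l hl, hp.zero]
    by_cases hk : k = 0
    · subst hk
      simp only [hh, if_true, zero_add, ← mul_assoc]
      gcongr
      exact hε _
    · simp only [hh, if_neg hk]
      calc p (A k (v l)) * wt r (k + l)
          ≤ B * K ^ k * k.factorial * p (v l) * wt r (k + l) := by gcongr; exact hA _ _
        _ = B * K ^ k * p (v l) * (k.factorial * wt r (k + l)) := by ring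
        _ ≤ B * K ^ k * p (v l) * (r ^ k / (N + 1) * wt r l) := by
          exact mul_le_mul' le_rfl (wt_add_le r hk hl)
        _ = _ := by rw [mul_pow]; ring
  have hsum : ∑' k, (h k : ℝ≥0∞) ≤ (ε + 2 * B / (N + 1) : ℝ≥0) := by
    have h1 : ∀ k, h (k + 1) ≤ B / (N + 1) * (1 / 2) ^ k := by
      intro k
      simp only [hh, if_neg (Nat.succ_ne_zero k)]
      calc B * (K * r) ^ (k + 1) / (N + 1) = B / (N + 1) * (K * r) ^ (k + 1) := by ring
        _ ≤ B / (N + 1) * (1 / 2) ^ (k + 1) := by gcongr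
        _ ≤ _ := by
          gcongr 1
          exact pow_le_pow_of_le_one (zero_le) (by norm_num) (Nat.le_succ k)
    rw [tsum_eq_zero_add' ENNReal.summable]
    have h2 : ∑' k : ℕ, ((1 / 2 : ℝ≥0) : ℝ≥0∞) ^ k = 2 := by
      rw [ENNReal.tsum_geometric]
      norm_num
    calc _ ≤ (ε : ℝ≥0∞) + ∑' k : ℕ, ((B / (N + 1) : ℝ≥0) : ℝ≥0∞) * ((1 / 2 : ℝ≥0) : ℝ≥0∞) ^ k := by
          gcongr with k
          · simp [hh]
          · rw [← ENNReal.coe_pow, ← ENNReal.coe_mul]; exact_mod_cast h1 k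
      _ = _ := by
        rw [ENNReal.tsum_mul_left, h2,
          show ε + 2 * B / (N + 1) = ε + B / (N + 1) * 2 by ring, ENNReal.coe_add, ENNReal.coe_mul]
        rfl
  calc sn p r (cnv A v)
      ≤ ∑' n, ∑ k ∈ Finset.range (n + 1), (h (n - k) : ℝ≥0∞) * (p (v k) * wt r k : ℝ≥0) := by
        refine ENNReal.tsum_le_tsum fun n => ?_
        rw [cnv_apply]
        simp only [← ENNReal.coe_mul, ← ENNReal.ofNNReal_finsetSum]
        rw [ENNReal.coe_le_coe]
        calc _ ≤ (∑ k ∈ Finset.range (n + 1), p (A (n - k) (v k))) * wt r n := by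
              gcongr; exact hp.sum_le _ _
          _ ≤ _ := by
            rw [Finset.sum_mul]
            refine Finset.sum_le_sum fun k hk => ?_
            have := key (n - k) k
            rwa [Nat.sub_add_cancel (Nat.lt_succ_iff.1 (Finset.mem_range.1 hk))] at this
    _ = (∑' k, (h k : ℝ≥0∞)) * sn p r v := by
        rw [tsum_conv (fun k => (h k : ℝ≥0∞))]
        simp [sn]
    _ ≤ _ := by gcongr

lemma exists_adapted {N : (Fin m → ℂ) →ₗ[ℂ] (Fin m → ℂ)} (hN : IsNilpotent N) {ε : ℝ≥0}
    (hε : 0 < ε) : ∃ p : (Fin m → ℂ) → ℝ≥0, NormLike p ∧ (∀ x, ‖x‖₊ ≤ p x) ∧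
      (∃ c, ∀ x, p x ≤ c * ‖x‖₊) ∧ ∀ x, p (N x) ≤ ε * p x := by
  obtain ⟨M, hM⟩ := hN
  have hM1 : N ^ (M + 1) = 0 := by rw [pow_succ, hM, zero_mul]
  refine ⟨fun x => ∑ j ∈ Finset.range (M + 1), ε⁻¹ ^ j * ‖(N ^ j) x‖₊, ⟨fun x y => ?_,
    fun c x => ?_, ?_⟩, fun x => ?_, ⟨∑ j ∈ Finset.range (M + 1),
      ε⁻¹ ^ j * ‖LinearMap.toContinuousLinearMap (N ^ j)‖₊, fun x => ?_⟩, fun x => ?_⟩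
  · simp only [← Finset.sum_add_distrib, map_add, ← mul_add]
    gcongr
    exact nnnorm_add_le _ _
  · simp only [map_smul, nnnorm_smul, Finset.mul_sum]
    exact Finset.sum_congr rfl fun _ _ => by ring
  · have : ∀ j, Continuous fun x => (N ^ j) x := fun j =>
      LinearMap.continuous_of_finiteDimensional (N ^ j)
    fun_prop
  · simpa using Finset.single_le_sum (f := fun j => ε⁻¹ ^ j * ‖(N ^ j) x‖₊)
      (fun _ _ => zero_le) (Finset.mem_range.2 (Nat.succ_pos M))
  · rw [Finset.sum_mul]
    refine Finset.sum_le_sum fun j _ => ?_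
    rw [mul_assoc]
    gcongr
    exact (LinearMap.toContinuousLinearMap (N ^ j)).le_opNNNorm x
  · simp only [← Module.End.mul_apply, ← pow_succ]
    rw [Finset.sum_range_succ, hM1, Finset.sum_range_succ', mul_add, Finset.mul_sum]
    simp only [LinearMap.zero_apply, nnnorm_zero, mul_zero, add_zero]
    refine le_add_of_le_of_nonneg (Finset.sum_le_sum fun j _ => le_of_eq ?_) zero_le
    rw [pow_succ ε⁻¹]
    field_simp

lemma exists_neumann (hp : NormLike p) (hp1 : ∀ x, ‖x‖₊ ≤ p x) (hr : 0 < r) {Q : Sq m →ₗ[ℂ] Sq m}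
    (hQc : Continuous Q) {N : ℕ} (hQN : ∀ x, ∀ k < N, Q x k = 0)
    (hQ : ∀ x, (∀ k < N, x k = 0) → 2 * sn p r (Q x) ≤ sn p r x) {z : Sq m}
    (hz : sn p r z ≠ ∞) (hzN : ∀ k < N, z k = 0) :
    ∃ x, x = z + Q x ∧ (∀ k < N, x k = 0) ∧ sn p r x ≤ 2 * sn p r z := by
  have hvan : ∀ j, ∀ k < N, (Q ^ j) z k = 0 := by
    intro j
    cases j with
    | zero => simpa using hzN
    | succ j => rw [pow_succ', Module.End.mul_apply]; exact hQN _
  have hj : ∀ j, sn p r ((Q ^ j) z) ≤ (2⁻¹ : ℝ≥0∞) ^ j * sn p r z := by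
    intro j
    induction j with
    | zero => simp
    | succ j ih =>
      have := hQ _ (hvan j)
      rw [← Module.End.mul_apply, ← pow_succ'] at this
      calc _ = 2⁻¹ * (2 * sn p r ((Q ^ (j + 1)) z)) := by
            rw [← mul_assoc, ENNReal.inv_mul_cancel two_ne_zero ENNReal.ofNat_ne_top, one_mul]
        _ ≤ 2⁻¹ * ((2⁻¹ : ℝ≥0∞) ^ j * sn p r z) := mul_le_mul' le_rfl (this.trans ih)
        _ = _ := by rw [pow_succ']; ring
  have hs : ∑' j : ℕ, sn p r ((Q ^ j) z) ≤ 2 * sn p r z := by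
    refine (ENNReal.tsum_le_tsum hj).trans ?_
    rw [ENNReal.tsum_mul_right, ENNReal.tsum_geometric, ENNReal.one_sub_inv_two, inv_inv]
  have hs' : ∑' j : ℕ, sn p r ((Q ^ j) z) ≠ ∞ :=
    (hs.trans_lt (ENNReal.mul_lt_top (by simp) hz.lt_top)).ne
  have hsum : ∀ n, Summable fun j => (Q ^ j) z n := by
    intro n
    refine Summable.of_nnnorm (ENNReal.tsum_coe_ne_top_iff_summable.1 ?_)
    have h1 : ∀ j, (‖(Q ^ j) z n‖₊ : ℝ≥0∞) ≤ sn p r ((Q ^ j) z) * ((wt r n)⁻¹ : ℝ≥0) := by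
      intro j
      have hw := wt_pos hr n
      calc (‖(Q ^ j) z n‖₊ : ℝ≥0∞) ≤ p ((Q ^ j) z n) := ENNReal.coe_le_coe.2 (hp1 _)
        _ = p ((Q ^ j) z n) * wt r n * ((wt r n)⁻¹ : ℝ≥0) := by
          rw [mul_assoc, ← ENNReal.coe_mul, mul_inv_cancel₀ hw.ne']; simp
        _ ≤ _ := mul_le_mul' (coord_le_sn p r _ n) le_rfl
    refine ne_top_of_le_ne_top ?_ (ENNReal.tsum_le_tsum h1)
    rw [ENNReal.tsum_mul_right]
    exact ENNReal.mul_ne_top hs' ENNReal.coe_ne_top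
  set x : Sq m := fun n => ∑' j, (Q ^ j) z n with hx
  have hxs : HasSum (fun j => (Q ^ j) z) x := Pi.hasSum.2 fun n => (hsum n).hasSum
  refine ⟨x, ?_, fun k hk => ?_, ?_⟩
  · have h1 : HasSum (fun j => (Q ^ (j + 1)) z) (Q x) := by
      simpa [Function.comp_def, pow_succ', Module.End.mul_apply] using hxs.map Q hQc
    have h2 := hxs.unique ((hasSum_nat_add_iff (f := fun j => (Q ^ j) z) 1).1 h1)
    rw [Finset.sum_range_one, pow_zero, Module.End.one_apply] at h2
    rw [add_comm]
    exact h2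
  · simp [hx, hvan _ k hk]
  · refine le_trans ?_ hs
    unfold sn
    refine ENNReal.tsum_le_of_sum_range_le fun L => ?_
    have hlim : Tendsto (fun J => ∑ n ∈ Finset.range L,
        (p ((∑ j ∈ Finset.range J, (Q ^ j) z) n) : ℝ≥0∞) * wt r n) atTop
        (𝓝 (∑ n ∈ Finset.range L, (p (x n) : ℝ≥0∞) * wt r n)) := by
      refine tendsto_finsetSum _ fun n _ => ?_
      simp only [← ENNReal.coe_mul]
      refine ENNReal.tendsto_coe.2 (Tendsto.mul_const _ ?_)
      refine (hp.cont.tendsto _).comp ?_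
      have := (hsum n).hasSum.tendsto_sum_nat
      simpa [Finset.sum_apply] using this
    refine le_of_tendsto' hlim fun J => ?_
    calc _ ≤ sn p r (∑ j ∈ Finset.range J, (Q ^ j) z) := ENNReal.sum_le_tsum _
      _ ≤ ∑ j ∈ Finset.range J, sn p r ((Q ^ j) z) := sn_sum_le hp _ _
      _ ≤ _ := ENNReal.sum_le_tsum _

/-- The weighted shift. -/
noncomputable def wsh : Sq m →ₗ[ℂ] Sq m :=
  LinearMap.pi fun n => ((n + 1 : ℕ) : ℂ) • (if n = 0 then 0 else LinearMap.proj (n - 1))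

lemma wsh_zero (v : Sq m) : wsh v 0 = 0 := by simp [wsh]

lemma wsh_succ (v : Sq m) (n : ℕ) : wsh v (n + 1) = ((n + 2 : ℕ) : ℂ) • v n := by
  simp [wsh, add_assoc, one_add_one_eq_two]

lemma sn_wsh (hp : NormLike p) (v : Sq m) : sn p r (wsh v) = r * sn p r v := by
  unfold sn
  rw [tsum_eq_zero_add' ENNReal.summable, wsh_zero, hp.zero, ← ENNReal.tsum_mul_left]
  simp only [ENNReal.coe_zero, zero_mul, zero_add]
  refine tsum_congr fun n => ?_
  rw [wsh_succ, hp.smul]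
  simp only [← ENNReal.coe_mul]
  congr 1
  rw [mul_left_comm, ← wt_succ, Complex.nnnorm_natCast]
  ring

/-- A truncated inverse of the weighted shift. -/
noncomputable def unsh (N : ℕ) : Sq m →ₗ[ℂ] Sq m :=
  LinearMap.pi fun n => if n < N then 0 else (((n + 2 : ℕ) : ℂ)⁻¹) • LinearMap.proj (n + 1)

lemma unsh_of_lt {N n : ℕ} (v : Sq m) (h : n < N) : unsh N v n = 0 := by simp [unsh, h]

lemma unsh_of_le {N n : ℕ} (v : Sq m) (h : N ≤ n) :
    unsh N v n = (((n + 2 : ℕ) : ℂ)⁻¹) • v (n + 1) := by simp [unsh, h.not_gt]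

lemma unsh_wsh {N : ℕ} {v : Sq m} (h : ∀ k < N, v k = 0) : unsh N (wsh v) = v := by
  ext1 n
  rcases lt_or_ge n N with hn | hn
  · rw [unsh_of_lt _ hn, h n hn]
  · rw [unsh_of_le _ hn, wsh_succ, smul_smul, inv_mul_cancel₀ (Nat.cast_ne_zero.2 (n + 1).succ_ne_zero),
      one_smul]

lemma sn_unsh_le (hp : NormLike p) (N : ℕ) (v : Sq m) : r * sn p r (unsh N v) ≤ sn p r v := by
  unfold sn
  rw [tsum_eq_zero_add' (f := fun n => (p (v n) : ℝ≥0∞) * (wt r n : ℝ≥0∞)) ENNReal.summable,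
    ← ENNReal.tsum_mul_left]
  refine le_add_of_nonneg_of_le zero_le (ENNReal.tsum_le_tsum fun n => ?_)
  simp only [← ENNReal.coe_mul]
  rw [ENNReal.coe_le_coe]
  rcases lt_or_ge n N with hn | hn
  · simp [unsh_of_lt _ hn, hp.zero]
  · rw [unsh_of_le _ hn, hp.smul, mul_left_comm, ← wt_succ, nnnorm_inv, Complex.nnnorm_natCast]
    have : ((n + 2 : ℕ) : ℝ≥0) ≠ 0 := by positivity
    apply le_of_eq
    field_simp

/-- The action of multiplication by `f` on sequences. -/
noncomputable def Top (A : ℕ → (Fin m → ℂ) →ₗ[ℂ] (Fin m → ℂ)) : Sq m →ₗ[ℂ] Sq m := cnv A + wsh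

lemma continuous_unsh_cnv (A : ℕ → (Fin m → ℂ) →ₗ[ℂ] (Fin m → ℂ)) (N : ℕ) :
    Continuous (unsh N ∘ₗ cnv A : Sq m →ₗ[ℂ] Sq m) := by
  refine continuous_pi fun n => ?_
  have hA : ∀ k, Continuous (A k) := fun k => LinearMap.continuous_of_finiteDimensional _
  rcases lt_or_ge n N with hn | hn
  · simpa only [LinearMap.comp_apply, unsh_of_lt _ hn] using continuous_const
  · simp only [LinearMap.comp_apply, unsh_of_le _ hn, cnv_apply]
    fun_prop

lemma cnv_vanish (A : ℕ → (Fin m → ℂ) →ₗ[ℂ] (Fin m → ℂ)) {N : ℕ} {v : Sq m}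
    (h : ∀ k < N, v k = 0) : ∀ k < N, cnv A v k = 0 := by
  intro k hk
  rw [cnv_apply]
  refine Finset.sum_eq_zero fun j hj => ?_
  rw [h j (by have := Finset.mem_range.1 hj; omega), map_zero]

lemma Top_vanish (A : ℕ → (Fin m → ℂ) →ₗ[ℂ] (Fin m → ℂ)) {N : ℕ} {v : Sq m}
    (h : ∀ k < N, v k = 0) : ∀ k < N, Top A v k = 0 := by
  intro k hk
  rw [Top, LinearMap.add_apply, Pi.add_apply, cnv_vanish A h k hk, zero_add]
  cases k with
  | zero => exact wsh_zero v
  | succ k => rw [wsh_succ, h k (by omega), smul_zero]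

/-- The sup norm version of the sequence norm. -/
noncomputable abbrev snn (r : ℝ≥0) (v : Sq m) : ℝ≥0∞ := sn (fun x => ‖x‖₊) r v

lemma snn_Top_le {A : ℕ → (Fin m → ℂ) →ₗ[ℂ] (Fin m → ℂ)} {B K : ℝ≥0}
    (hA : ∀ k x, ‖A k x‖₊ ≤ B * K ^ k * k.factorial * ‖x‖₊) (hK : K * r ≤ 1 / 2) (v : Sq m) :
    snn r (Top A v) ≤ (3 * B + r : ℝ≥0) * snn r v := by
  refine (sn_add_le (normLike_nnnorm m) _ _).trans ?_
  rw [sn_wsh (normLike_nnnorm m), ENNReal.coe_add, add_mul]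
  gcongr
  refine (sn_cnv_le (N := 0) (ε := B) (normLike_nnnorm m) hA (fun x => ?_) hK (by simp)).trans ?_
  · simpa using hA 0 x
  · refine mul_le_mul' (ENNReal.coe_le_coe.2 (le_of_eq ?_)) le_rfl
    simp; ring

lemma solve {A : ℕ → (Fin m → ℂ) →ₗ[ℂ] (Fin m → ℂ)} {B K : ℝ≥0}
    (hA : ∀ k x, ‖A k x‖₊ ≤ B * K ^ k * k.factorial * ‖x‖₊) (h0 : IsNilpotent (A 0))
    (hr : 0 < r) (hK : K * r ≤ 1 / 2) : ∃ (N : ℕ) (c : ℝ≥0),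
      (∀ y, snn r y ≠ ∞ → (∀ k < N, y k = 0) → ∃ x d, (∀ k < N, x k = 0) ∧
        snn r x ≤ c * snn r y ∧ (‖d‖₊ : ℝ≥0∞) ≤ c * snn r y ∧ y = Top A x + Pi.single N d) ∧
      (∀ x d, snn r x ≠ ∞ → (∀ k < N, x k = 0) → Top A x + Pi.single N d = 0 → x = 0 ∧ d = 0) := by
  obtain ⟨p, hp, hp1, ⟨c, hc⟩, hpA⟩ := exists_adapted h0 (ε := r / 4) (by positivity)
  have hA' : ∀ k x, p (A k x) ≤ c * B * K ^ k * k.factorial * p x := fun k x => by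
    calc p (A k x) ≤ c * (B * K ^ k * k.factorial * ‖x‖₊) := (hc _).trans (by gcongr; exact hA k x)
      _ ≤ c * (B * K ^ k * k.factorial * p x) := by gcongr; exact hp1 x
      _ = _ := by ring
  obtain ⟨N, hN⟩ := exists_nat_ge (8 * (c * B) / r)
  have hN' : r / 4 + 2 * (c * B) / (N + 1) ≤ r / 2 := by
    have : 2 * (c * B) / (N + 1) ≤ r / 4 := by
      rw [div_le_iff₀ (by positivity)]
      rw [div_le_iff₀ hr] at hN
      calc 2 * (c * B) = 8 * (c * B) / 4 := by ring
        _ ≤ N * r / 4 := by gcongr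
        _ ≤ (N + 1) * r / 4 := by gcongr; exact le_self_add
        _ = _ := by ring
    calc _ ≤ r / 4 + r / 4 := by gcongr
      _ = _ := by ring
  set Q : Sq m →ₗ[ℂ] Sq m := -(unsh N ∘ₗ cnv A) with hQ
  have hQb : ∀ x, (∀ k < N, x k = 0) → 2 * sn p r (Q x) ≤ sn p r x := by
    intro x hx
    have h1 : r * sn p r (Q x) ≤ (r / 2 : ℝ≥0) * sn p r x := by
      rw [hQ, LinearMap.neg_apply, sn_neg hp]
      refine (sn_unsh_le hp N _).trans ((sn_cnv_le hp hA' hpA hK hx).trans ?_)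
      exact mul_le_mul' (ENNReal.coe_le_coe.2 hN') le_rfl
    have hr' : (r : ℝ≥0∞) ≠ 0 := by exact_mod_cast hr.ne'
    calc 2 * sn p r (Q x) = 2 * (r : ℝ≥0∞)⁻¹ * (r * sn p r (Q x)) := by
          rw [mul_assoc, ← mul_assoc _ (r : ℝ≥0∞), ENNReal.inv_mul_cancel hr' ENNReal.coe_ne_top,
            one_mul]
      _ ≤ 2 * (r : ℝ≥0∞)⁻¹ * ((r / 2 : ℝ≥0) * sn p r x) := by gcongr
      _ = sn p r x := by
        rw [← ENNReal.coe_inv hr.ne', ← mul_assoc, ← ENNReal.coe_ofNat, ← ENNReal.coe_mul,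
          ← ENNReal.coe_mul]
        have : 2 * r⁻¹ * (r / 2) = 1 := by field_simp
        rw [this]; simp
  have hsnp : ∀ x, sn p r x ≤ c * snn r x := sn_le_of_le hc
  have hsnn : ∀ x, snn r x ≤ sn p r x := fun x => by
    simpa using sn_le_of_le (r := r) (c := 1) (p := fun x => ‖x‖₊) (q := p) (by simpa using hp1) x
  set c1 : ℝ≥0 := 2 * r⁻¹ * c with hc1
  refine ⟨N, c1 + (wt r N)⁻¹ * (1 + (3 * B + r) * c1), fun y hy hyN => ?_, fun x d hx hxN h => ?_⟩
  · have hz : r * sn p r (unsh N y) ≤ sn p r y := sn_unsh_le hp N y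
    have hr' : (r : ℝ≥0∞) ≠ 0 := by exact_mod_cast hr.ne'
    have hz2 : sn p r (unsh N y) ≤ (r⁻¹ * c : ℝ≥0) * snn r y := by
      calc sn p r (unsh N y) = (r : ℝ≥0∞)⁻¹ * (r * sn p r (unsh N y)) := by
            rw [← mul_assoc, ENNReal.inv_mul_cancel hr' ENNReal.coe_ne_top, one_mul]
        _ ≤ (r : ℝ≥0∞)⁻¹ * (c * snn r y) := mul_le_mul' le_rfl (hz.trans (hsnp y))
        _ = _ := by rw [ENNReal.coe_mul, ENNReal.coe_inv hr.ne', mul_assoc]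
    obtain ⟨x, hx, hxN, hxs⟩ := exists_neumann hp hp1 hr (Q := Q) (N := N)
      (continuous_unsh_cnv A N).neg
      (fun x k hk => by simp [hQ, unsh_of_lt _ hk]) hQb
      (ne_top_of_le_ne_top (ENNReal.mul_ne_top ENNReal.coe_ne_top hy) hz2)
      (fun k hk => unsh_of_lt y hk)
    have hxs' : snn r x ≤ c1 * snn r y := by
      refine (hsnn x).trans (hxs.trans ?_)
      calc 2 * sn p r (unsh N y) ≤ 2 * ((r⁻¹ * c : ℝ≥0) * snn r y) := by gcongr
        _ = _ := by rw [hc1, mul_assoc 2, ENNReal.coe_mul 2, mul_assoc]; simp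
    have hJ : unsh N (y - Top A x) = 0 := by
      rw [Top, LinearMap.add_apply, map_sub, map_add, unsh_wsh hxN]
      nth_rw 2 [hx]
      simp [hQ]
    have hd : y - Top A x = Pi.single N ((y - Top A x) N) := by
      ext1 n
      rcases lt_trichotomy n N with hn | rfl | hn
      · rw [Pi.single_eq_of_ne hn.ne, Pi.sub_apply, hyN n hn, Top_vanish A hxN n hn, sub_zero]
      · rw [Pi.single_eq_same]
      · rw [Pi.single_eq_of_ne hn.ne']
        obtain ⟨n, rfl⟩ := Nat.exists_eq_succ_of_ne_zero (Nat.ne_zero_of_lt hn)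
        have := congrFun hJ n
        rw [unsh_of_le _ (Nat.lt_succ_iff.1 hn)] at this
        exact (smul_eq_zero.1 this).resolve_left 
          (inv_ne_zero (Nat.cast_ne_zero.2 (n + 1).succ_ne_zero))
    refine ⟨x, (y - Top A x) N, hxN, hxs'.trans ?_, ?_, ?_⟩
    · exact mul_le_mul' (ENNReal.coe_le_coe.2 le_self_add) le_rfl
    · have hw := wt_pos hr N
      calc (‖(y - Top A x) N‖₊ : ℝ≥0∞)
          = ((wt r N)⁻¹ : ℝ≥0) * (‖(y - Top A x) N‖₊ * wt r N) := by
            rw [mul_left_comm, ← ENNReal.coe_mul, inv_mul_cancel₀ hw.ne']; simp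
        _ ≤ ((wt r N)⁻¹ : ℝ≥0) * (snn r y + (3 * B + r : ℝ≥0) * (c1 * snn r y)) := by
            gcongr
            refine (coord_le_sn _ r (y - Top A x) N).trans
              ((sn_sub_le (normLike_nnnorm m) _ _).trans ?_)
            gcongr
            exact (snn_Top_le hA hK x).trans (by gcongr)
        _ = ((wt r N)⁻¹ * (1 + (3 * B + r) * c1) : ℝ≥0) * snn r y := by
            push_cast; ring
        _ ≤ _ := mul_le_mul' (ENNReal.coe_le_coe.2 le_add_self) le_rfl
    · rw [← hd]; abel
  · have hx0 : x = 0 := by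
      have h1 : unsh N (Top A x) = 0 := by
        rw [eq_neg_of_add_eq_zero_left h, map_neg, neg_eq_zero]
        ext1 n
        rcases lt_or_ge n N with hn | hn
        · rw [unsh_of_lt _ hn]; rfl
        · rw [unsh_of_le _ hn, Pi.single_eq_of_ne (by omega), smul_zero]; rfl
      rw [Top, LinearMap.add_apply, map_add, unsh_wsh hxN] at h1
      have h2 : Q x = x := by
        rw [hQ, LinearMap.neg_apply, LinearMap.comp_apply, eq_comm]
        exact eq_neg_of_add_eq_zero_right h1
      have h3 := hQb x hxN
      rw [h2] at h3
      have hfin : sn p r x ≠ ∞ :=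
        ne_top_of_le_ne_top (ENNReal.mul_ne_top ENNReal.coe_ne_top hx) (hsnp x)
      have h4 : sn p r x = 0 := by
        rw [two_mul] at h3
        by_contra hne
        exact absurd h3 (not_le.2 (ENNReal.lt_add_right hfin hne))
      ext1 n
      have h5 := (coord_le_sn p r x n).trans h4.le
      rw [nonpos_iff_eq_zero, mul_eq_zero, ENNReal.coe_eq_zero, ENNReal.coe_eq_zero] at h5
      have h6 := h5.resolve_right (wt_pos hr n).ne'
      exact nnnorm_eq_zero.1 (le_antisymm ((hp1 _).trans h6.le) zero_le)
    refine ⟨hx0, ?_⟩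
    rw [hx0, map_zero, zero_add, Pi.single_eq_zero_iff] at h
    exact h

end

lemma finrank_coker {X F' D : Type*} [AddCommGroup X] [Module ℂ X] [AddCommGroup F'] [Module ℂ F']
    [AddCommGroup D] [Module ℂ D] [FiniteDimensional ℂ F'] [FiniteDimensional ℂ D]
    {T : X →ₗ[ℂ] X} (hT : Function.Injective T) (p : X →ₗ[ℂ] F') (s : F' →ₗ[ℂ] X)
    (hps : ∀ a, p (s a) = a) (ι : D →ₗ[ℂ] X) (hι : ∀ d, p (ι d) = 0)
    (hTp : ∀ x, p x = 0 → p (T x) = 0)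
    (hsol : ∀ y, p y = 0 → ∃ x d, p x = 0 ∧ y = T x + ι d)
    (huniq : ∀ x d, p x = 0 → T x + ι d = 0 → d = 0) :
    FiniteDimensional ℂ (X ⧸ LinearMap.range T) ∧
      Module.finrank ℂ (X ⧸ LinearMap.range T) = Module.finrank ℂ D := by
  set g : F' × D →ₗ[ℂ] X := s.coprod ι with hg
  set Φ := (LinearMap.range T).mkQ ∘ₗ g with hΦ
  have hsurj : Function.Surjective Φ := by
    intro q
    obtain ⟨y, rfl⟩ := Submodule.mkQ_surjective _ q
    obtain ⟨x, d, -, h⟩ := hsol (y - s (p y)) (by rw [map_sub, hps, sub_self])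
    refine ⟨(p y, d), ?_⟩
    rw [hΦ, LinearMap.comp_apply, ← sub_eq_zero, ← map_sub, Submodule.mkQ_apply,
      Submodule.Quotient.mk_eq_zero]
    refine ⟨-x, ?_⟩
    rw [map_neg, hg, LinearMap.coprod_apply]
    have h' : s (p y) + ι d - y = -(y - s (p y)) + ι d := by abel
    change -T x = s (p y) + ι d - y
    rw [h', h]
    abel
  have hker : ∀ k, Φ k = 0 ↔ g k ∈ LinearMap.range T := fun k => by
    rw [hΦ, LinearMap.comp_apply, Submodule.mkQ_apply, Submodule.Quotient.mk_eq_zero]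
  have hmem : ∀ k : LinearMap.ker Φ, g k ∈ LinearMap.range T := fun k =>
    (hker k).1 (LinearMap.mem_ker.1 k.2)
  set Tinv := (LinearEquiv.ofInjective T hT).symm with hTinv
  have hTi : ∀ y, T (Tinv y) = y := fun y => by
    have := LinearEquiv.ofInjective_apply (f := T) (h := hT) (Tinv y)
    rw [← this, hTinv, LinearEquiv.apply_symm_apply]
  set Θ : LinearMap.ker Φ →ₗ[ℂ] F' := p ∘ₗ Tinv.toLinearMap ∘ₗ
    ((g ∘ₗ (LinearMap.ker Φ).subtype).codRestrict _ hmem) with hΘ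
  have hT2 : ∀ k : LinearMap.ker Φ, T (Tinv ⟨g k, hmem k⟩) = g k := fun k => hTi _
  have hbij : Function.Bijective Θ := by
    constructor
    · rw [injective_iff_map_eq_zero]
      intro k hk
      have h1 : p (Tinv ⟨g k, hmem k⟩) = 0 := hk
      have h2 := hTp _ h1
      rw [hT2, hg, LinearMap.coprod_apply, map_add, hps, hι, add_zero] at h2
      have h3 := huniq _ (-(k : F' × D).2) h1
      rw [hT2, hg, LinearMap.coprod_apply, h2] at h3
      have h4 := h3 (by simp)
      exact Subtype.ext (Prod.ext h2 (neg_eq_zero.1 h4))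
    · intro a
      obtain ⟨x, d, hx, h⟩ := hsol (T (s a) - s (p (T (s a)))) (by rw [map_sub, hps, sub_self])
      have hgk : g (p (T (s a)), d) = T (s a - x) := by
        rw [hg, LinearMap.coprod_apply, map_sub, eq_sub_iff_add_eq, add_assoc, add_comm (ι d), ← h]
        abel
      have hk : (p (T (s a)), d) ∈ LinearMap.ker Φ := by
        rw [LinearMap.mem_ker, hker, hgk]
        exact ⟨_, rfl⟩
      refine ⟨⟨_, hk⟩, ?_⟩
      have h1 : Tinv ⟨g (p (T (s a)), d), hmem ⟨_, hk⟩⟩ = s a - x := hT ((hT2 ⟨_, hk⟩).trans hgk)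
      change p (Tinv ⟨g (p (T (s a)), d), hmem ⟨_, hk⟩⟩) = a
      rw [h1, map_sub, hps, hx, sub_zero]
  have hfd : FiniteDimensional ℂ (X ⧸ LinearMap.range T) :=
    FiniteDimensional.of_surjective Φ hsurj
  refine ⟨hfd, ?_⟩
  have h1 := LinearMap.finrank_range_add_finrank_ker Φ
  rw [LinearMap.range_eq_top.2 hsurj, finrank_top, (LinearEquiv.ofBijective Θ hbij).finrank_eq,
    Module.finrank_prod] at h1
  omega

section
variable {m : ℕ} {r : ℝ≥0}

lemma snn_ne_top_of_vanish {N : ℕ} {v : Sq m} (h : ∀ n, N ≤ n → v n = 0) : snn r v ≠ ∞ := by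
  unfold snn sn
  rw [tsum_eq_sum (s := Finset.range N) (fun n hn => by simp [h n (by simpa using hn)])]
  simp only [← ENNReal.coe_mul, ← ENNReal.ofNNReal_finsetSum]
  exact ENNReal.coe_ne_top

lemma snn_single_ne_top (k : ℕ) (d : Fin m → ℂ) : snn r (Pi.single k d) ≠ ∞ :=
  snn_ne_top_of_vanish (N := k + 1) fun n hn => Pi.single_eq_of_ne (by omega) _

lemma nnnorm_le_snn (hr : 0 < r) (v : Sq m) (n : ℕ) :
    (‖v n‖₊ : ℝ≥0∞) ≤ ((wt r n)⁻¹ : ℝ≥0) * snn r v := by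
  have hw := wt_pos hr n
  calc (‖v n‖₊ : ℝ≥0∞) = ((wt r n)⁻¹ : ℝ≥0) * (‖v n‖₊ * wt r n) := by
        rw [mul_left_comm, ← ENNReal.coe_mul, inv_mul_cancel₀ hw.ne']; simp
    _ ≤ _ := by gcongr; exact coord_le_sn _ r v n

lemma gev_of_snn (hr : 0 < r) {v : Sq m} (h : snn r v ≠ ∞) : Gev v := by
  refine ⟨(snn r v).toNNReal, 2 / r, fun k i => ?_⟩
  have h1 := nnnorm_le_snn hr v k
  rw [← ENNReal.coe_toNNReal h, ← ENNReal.coe_mul, ENNReal.coe_le_coe] at h1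
  refine (nnnorm_le_pi_nnnorm (v k) i).trans (h1.trans ?_)
  rw [mul_comm]
  gcongr
  unfold wt
  have h2 : ((k + 1 : ℕ) : ℝ≥0) ≤ 2 ^ k := by exact_mod_cast k.lt_two_pow_self
  rw [inv_div, Nat.factorial_succ, div_pow, div_mul_eq_mul_div]
  push_cast at *
  gcongr

lemma Gev.exists_snn {v : Sq m} (h : Gev v) : ∃ r₀ : ℝ≥0, 0 < r₀ ∧ ∀ r ≤ r₀, snn r v ≠ ∞ := by
  obtain ⟨B, K, h⟩ := h
  refine ⟨(2 * (K + 1))⁻¹, by positivity, fun r hr => ?_⟩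
  have hKr : K * r ≤ 1 / 2 := by
    calc K * r ≤ (K + 1) * (2 * (K + 1))⁻¹ := by gcongr; exact le_self_add
      _ = 1 / 2 := by field_simp
  have h1 : ∀ k, (‖v k‖₊ : ℝ≥0∞) * wt r k ≤ B * ((1 / 2 : ℝ≥0) : ℝ≥0∞) ^ k := by
    intro k
    rw [← ENNReal.coe_mul, ← ENNReal.coe_pow, ← ENNReal.coe_mul, ENNReal.coe_le_coe]
    have h2 : ‖v k‖₊ ≤ B * (K ^ k * k.factorial) := pi_nnnorm_le_iff.2 (h k)
    have h3 : (k.factorial : ℝ≥0) / (k + 1).factorial ≤ 1 :=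
      div_le_one_of_le₀ (by exact_mod_cast Nat.factorial_le k.le_succ) zero_le
    calc ‖v k‖₊ * wt r k ≤ B * (K ^ k * k.factorial) * wt r k := by gcongr
      _ = B * (K * r) ^ k * (k.factorial / (k + 1).factorial) := by unfold wt; ring
      _ ≤ B * (1 / 2) ^ k * 1 := by gcongr
      _ = _ := mul_one _
  refine ne_top_of_le_ne_top ?_ (ENNReal.tsum_le_tsum h1)
  rw [ENNReal.tsum_mul_left, ENNReal.tsum_geometric]
  refine ENNReal.mul_ne_top ENNReal.coe_ne_top (ENNReal.inv_ne_top.2 ?_)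
  norm_num

/-- The subspace of sequences of finite norm. -/
def Xr (m : ℕ) (r : ℝ≥0) : Submodule ℂ (Sq m) where
  carrier := {v | snn r v ≠ ∞}
  zero_mem' := by
    change snn r 0 ≠ ∞
    rw [snn, sn_zero (normLike_nnnorm m)]; exact ENNReal.zero_ne_top
  add_mem' := fun {u v} hu hv => ne_top_of_le_ne_top (ENNReal.add_ne_top.2 ⟨hu, hv⟩)
    (sn_add_le (normLike_nnnorm m) u v)
  smul_mem' := fun c v hv => by
    change snn r (c • v) ≠ ∞
    rw [snn, sn_smul (normLike_nnnorm m)]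
    exact ENNReal.mul_ne_top ENNReal.coe_ne_top hv

lemma Xr_mono {r s : ℝ≥0} (h : r ≤ s) : Xr m s ≤ Xr m r :=
  fun v hv => ne_top_of_le_ne_top hv (sn_mono h v)

variable {A : ℕ → (Fin m → ℂ) →ₗ[ℂ] (Fin m → ℂ)} {B K : ℝ≥0}

lemma Top_mem (hA : ∀ k x, ‖A k x‖₊ ≤ B * K ^ k * k.factorial * ‖x‖₊) (hK : K * r ≤ 1 / 2)
    {v : Sq m} (hv : v ∈ Xr m r) : Top A v ∈ Xr m r :=
  ne_top_of_le_ne_top (ENNReal.mul_ne_top ENNReal.coe_ne_top hv) (snn_Top_le hA hK v)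

/-- The restriction of `Top A` to sequences of finite norm. -/
noncomputable def TopR (hA : ∀ k x, ‖A k x‖₊ ≤ B * K ^ k * k.factorial * ‖x‖₊)
    (hK : K * r ≤ 1 / 2) : Xr m r →ₗ[ℂ] Xr m r :=
  (Top A).restrict fun _ hv => Top_mem hA hK hv

lemma TopR_coe (hA : ∀ k x, ‖A k x‖₊ ≤ B * K ^ k * k.factorial * ‖x‖₊)
    (hK : K * r ≤ 1 / 2) (x : Xr m r) : (TopR hA hK x : Sq m) = Top A x := rfl

lemma finrank_coker_Top (hA : ∀ k x, ‖A k x‖₊ ≤ B * K ^ k * k.factorial * ‖x‖₊)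
    (h0 : IsNilpotent (A 0)) (hr : 0 < r) (hK : K * r ≤ 1 / 2)
    (hinj : ∀ v, Gev v → Top A v = 0 → v = 0) :
    FiniteDimensional ℂ (Xr m r ⧸ LinearMap.range (TopR hA hK)) ∧
      Module.finrank ℂ (Xr m r ⧸ LinearMap.range (TopR hA hK)) = m := by
  obtain ⟨N, c, hsol, huniq⟩ := solve hA h0 hr hK
  let p : Xr m r →ₗ[ℂ] (Fin N → Fin m → ℂ) :=
    (LinearMap.pi fun k : Fin N => LinearMap.proj (k : ℕ)) ∘ₗ (Xr m r).subtype
  let s : (Fin N → Fin m → ℂ) →ₗ[ℂ] Xr m r :=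
    LinearMap.codRestrict (Xr m r)
      (LinearMap.pi fun k : ℕ => if h : k < N then LinearMap.proj (⟨k, h⟩ : Fin N) else 0)
      (fun a => snn_ne_top_of_vanish (N := N) fun n hn => by
        simp only [LinearMap.pi_apply, dif_neg hn.not_gt, LinearMap.zero_apply])
  let ι : (Fin m → ℂ) →ₗ[ℂ] Xr m r :=
    LinearMap.codRestrict (Xr m r) (LinearMap.single ℂ (fun _ : ℕ => Fin m → ℂ) N)
      (fun d => snn_single_ne_top N d)
  have hp : ∀ x, p x = 0 ↔ ∀ k < N, (x : Sq m) k = 0 := fun x =>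
    ⟨fun h k hk => congrFun h ⟨k, hk⟩, fun h => funext fun k => h k k.2⟩
  have := finrank_coker (T := TopR hA hK) ?_ p s ?_ ι ?_ ?_ ?_ ?_
  · simpa using this
  · rw [injective_iff_map_eq_zero]
    intro v hv
    exact Subtype.ext (hinj v (gev_of_snn hr v.2) (congrArg Subtype.val hv))
  · intro a
    ext1 k
    change (if h : (k : ℕ) < N then LinearMap.proj (⟨k, h⟩ : Fin N) else 0 :
      (Fin N → Fin m → ℂ) →ₗ[ℂ] (Fin m → ℂ)) a = a k
    rw [dif_pos k.2]
    rfl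
  · intro d
    rw [hp]
    intro k hk
    exact Pi.single_eq_of_ne hk.ne _
  · intro x hx
    rw [hp] at hx ⊢
    exact Top_vanish A hx
  · intro y hy
    rw [hp] at hy
    obtain ⟨x, d, hx, hxs, -, h⟩ := hsol y y.2 hy
    refine ⟨⟨x, ne_top_of_le_ne_top (ENNReal.mul_ne_top ENNReal.coe_ne_top y.2) hxs⟩, d,
      (hp _).2 hx, Subtype.ext h⟩
  · intro x d hx h
    exact (huniq x d x.2 ((hp _).1 hx) (congrArg Subtype.val h)).2

lemma ker_Top_dependent (hA : ∀ k x, ‖A k x‖₊ ≤ B * K ^ k * k.factorial * ‖x‖₊)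
    (h0 : IsNilpotent (A 0)) (hr : 0 < r) (hK : K * r ≤ 1 / 2) :
    ∃ L : ℕ, ∀ v : Fin L → Sq m, (∀ i, snn r (v i) ≠ ∞) → (∀ i, Top A (v i) = 0) →
      ∃ a : Fin L → ℂ, a ≠ 0 ∧ ∑ i, a i • v i = 0 := by
  obtain ⟨N, c, -, huniq⟩ := solve hA h0 hr hK
  refine ⟨Module.finrank ℂ (Fin N → Fin m → ℂ) + 1, fun v hv hT => ?_⟩
  have hdep : ¬ LinearIndependent ℂ fun i => (fun k : Fin N => v i k) := fun h => by
    have := h.fintype_card_le_finrank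
    simp at this
  obtain ⟨a, ha, i, hi⟩ := Fintype.not_linearIndependent_iff.1 hdep
  refine ⟨a, fun h => hi (congrFun h i), ?_⟩
  refine (huniq (∑ i, a i • v i) 0 ?_ ?_ ?_).1
  · exact (Xr m r).sum_mem fun i _ => (Xr m r).smul_mem _ (hv i)
  · intro k hk
    have := congrFun ha ⟨k, hk⟩
    simpa [Finset.sum_apply] using this
  · simp [hT]

lemma decompose (hA : ∀ k x, ‖A k x‖₊ ≤ B * K ^ k * k.factorial * ‖x‖₊)
    (h0 : IsNilpotent (A 0)) (hr : 0 < r) (hK : K * r ≤ 1 / 2) :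
    ∃ (N : ℕ) (c : ℝ≥0), ∀ v, snn r v ≠ ∞ → ∃ (x : Sq m) (a : Fin N → Fin m → ℂ),
      snn r x ≤ c * snn r v ∧ (∀ k j, (‖a k j‖₊ : ℝ≥0∞) ≤ c * snn r v) ∧
      v = (∑ k, ∑ j, a k j • (Pi.single (k : ℕ) (Pi.single j (1 : ℂ)) : Sq m)) + Top A x := by
  obtain ⟨N, c, hsol, -⟩ := solve hA h0 hr hK
  refine ⟨N + 1, c + ∑ k ∈ Finset.range N, (wt r k)⁻¹, fun v hv => ?_⟩
  set y : Sq m := fun n => if n < N then 0 else v n with hy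
  have hyv : snn r y ≤ snn r v := by
    refine ENNReal.tsum_le_tsum fun n => ?_
    simp only [hy]
    split_ifs <;> simp
  obtain ⟨x, d, -, hxs, hd, h⟩ := hsol y (ne_top_of_le_ne_top hv hyv) fun k hk => by simp [hy, hk]
  have hc : (c : ℝ≥0∞) ≤ (c + ∑ k ∈ Finset.range N, (wt r k)⁻¹ : ℝ≥0) :=
    ENNReal.coe_le_coe.2 le_self_add
  refine ⟨x, fun k => if (k : ℕ) < N then v k else d, hxs.trans (mul_le_mul' hc hyv),
    fun k j => ?_, ?_⟩
  · refine le_trans (ENNReal.coe_le_coe.2 (nnnorm_le_pi_nnnorm _ j)) ?_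
    split_ifs with hk
    · refine (nnnorm_le_snn hr v k).trans (mul_le_mul' (ENNReal.coe_le_coe.2 ?_) le_rfl)
      exact le_add_of_nonneg_of_le zero_le (Finset.single_le_sum
        (f := fun k => (wt r k)⁻¹) (fun _ _ => zero_le) (Finset.mem_range.2 hk))
    · exact hd.trans (mul_le_mul' hc hyv)
  · have hs : ∀ (k : ℕ) (w : Fin m → ℂ), ∑ j, w j • (Pi.single k (Pi.single j (1 : ℂ)) : Sq m) =
        Pi.single k w := by
      intro k w
      ext n i
      rcases eq_or_ne n k with rfl | hn
      · simp [Finset.sum_apply, Pi.single_apply]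
      · simp [Finset.sum_apply, Pi.single_eq_of_ne hn]
    simp only [hs]
    rw [Fin.sum_univ_castSucc]
    simp only [Fin.val_castSucc, Fin.is_lt, if_true, Fin.val_last, lt_irrefl, if_false]
    rw [add_assoc, add_comm (Pi.single N d : Sq m) (Top A x), ← h]
    ext1 n
    rw [Pi.add_apply, Finset.sum_apply]
    simp only [hy]
    split_ifs with hn
    · rw [add_zero, Finset.sum_eq_single ⟨n, hn⟩]
      · simp
      · intro k _ hk
        exact Pi.single_eq_of_ne (fun e => hk (Fin.ext e.symm)) _
      · simp
    · rw [Finset.sum_eq_zero, zero_add]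
      intro k _
      exact Pi.single_eq_of_ne (by omega) _

lemma exists_span_basis (hA : ∀ k x, ‖A k x‖₊ ≤ B * K ^ k * k.factorial * ‖x‖₊)
    (h0 : IsNilpotent (A 0)) (hr : 0 < r) (hK : K * r ≤ 1 / 2)
    (hinj : ∀ v, Gev v → Top A v = 0 → v = 0) :
    ∃ e : Fin m → Sq m, (∀ i, e i ∈ Xr m r) ∧
      ∀ v ∈ Xr m r, ∃ (c : Fin m → ℂ), ∃ x ∈ Xr m r, v = ∑ i, c i • e i + Top A x := by
  obtain ⟨hfd, hrk⟩ := finrank_coker_Top hA h0 hr hK hinj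
  let b := Module.finBasisOfFinrankEq ℂ _ hrk
  choose e he using fun i => Submodule.mkQ_surjective (LinearMap.range (TopR hA hK)) (b i)
  refine ⟨fun i => e i, fun i => (e i).2, fun v hv => ?_⟩
  set q := (LinearMap.range (TopR hA hK)).mkQ
  have h1 : q (⟨v, hv⟩ - ∑ i, b.repr (q ⟨v, hv⟩) i • e i) = 0 := by
    simp only [map_sub, map_sum, map_smul, he, b.sum_repr, sub_self]
  rw [Submodule.mkQ_apply, Submodule.Quotient.mk_eq_zero] at h1
  obtain ⟨x, hx⟩ := h1
  refine ⟨b.repr (q ⟨v, hv⟩), x, x.2, ?_⟩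
  have := congrArg Subtype.val hx
  rw [TopR_coe, Submodule.coe_sub] at this
  rw [this]
  simp

lemma span_basis_independent (hA : ∀ k x, ‖A k x‖₊ ≤ B * K ^ k * k.factorial * ‖x‖₊)
    (h0 : IsNilpotent (A 0)) (hr : 0 < r) (hK : K * r ≤ 1 / 2)
    (hinj : ∀ v, Gev v → Top A v = 0 → v = 0) {e : Fin m → Sq m} (he : ∀ i, e i ∈ Xr m r)
    (hspan : ∀ v ∈ Xr m r, ∃ (c : Fin m → ℂ), ∃ x ∈ Xr m r, v = ∑ i, c i • e i + Top A x)
    {c : Fin m → ℂ} {x : Sq m} (hx : x ∈ Xr m r) (h : ∑ i, c i • e i = Top A x) : c = 0 := by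
  obtain ⟨hfd, hrk⟩ := finrank_coker_Top hA h0 hr hK hinj
  set q := (LinearMap.range (TopR hA hK)).mkQ with hq
  let e' : Fin m → Xr m r := fun i => ⟨e i, he i⟩
  have hli : LinearIndependent ℂ fun i => q (e' i) := by
    refine linearIndependent_of_top_le_span_of_card_eq_finrank ?_ (by rw [hrk, Fintype.card_fin])
    rintro y -
    obtain ⟨v, rfl⟩ := Submodule.mkQ_surjective _ y
    obtain ⟨c, x, hx, h⟩ := hspan v v.2
    have h1 : v = ∑ i, c i • e' i + TopR hA hK ⟨x, hx⟩ := Subtype.ext (by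
      simpa [e', TopR_coe] using h)
    have h2 : q (TopR hA hK ⟨x, hx⟩) = 0 := by
      rw [hq, Submodule.mkQ_apply, Submodule.Quotient.mk_eq_zero]
      exact ⟨_, rfl⟩
    rw [h1, ← hq, map_add, h2, add_zero, map_sum]
    refine Submodule.sum_mem _ fun i _ => ?_
    rw [map_smul]
    exact Submodule.smul_mem _ _ (Submodule.subset_span ⟨i, rfl⟩)
  rw [Fintype.linearIndependent_iff] at hli
  refine funext fun i => hli c ?_ i
  have h1 : ∑ i, c i • e' i = TopR hA hK ⟨x, hx⟩ := Subtype.ext (by simpa [e', TopR_coe] using h)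
  simp only [← map_smul, ← map_sum, h1]
  rw [hq, Submodule.mkQ_apply, Submodule.Quotient.mk_eq_zero]
  exact ⟨_, rfl⟩

lemma exists_step (hA : ∀ k x, ‖A k x‖₊ ≤ B * K ^ k * k.factorial * ‖x‖₊)
    (h0 : IsNilpotent (A 0)) (hr : 0 < r) (hK : K * r ≤ 1 / 2) {e : Fin m → Sq m}
    (hspan : ∀ (k : ℕ) (j : Fin m), ∃ (c : Fin m → ℂ), ∃ x ∈ Xr m r,
      (Pi.single k (Pi.single j (1 : ℂ)) : Sq m) = ∑ i, c i • e i + Top A x) :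
    ∃ C : ℝ≥0, ∀ v, snn r v ≠ ∞ → ∃ (c : Fin m → ℂ) (x : Sq m), snn r x ≤ C * snn r v ∧
      (∀ i, (‖c i‖₊ : ℝ≥0∞) ≤ C * snn r v) ∧ v = ∑ i, c i • e i + Top A x := by
  obtain ⟨N, c₀, hdec⟩ := decompose hA h0 hr hK
  choose g z hz hgz using hspan
  have hS : ∀ (k : Fin N) (j : Fin m), ((snn r (z k j)).toNNReal : ℝ≥0∞) = snn r (z k j) :=
    fun k j => ENNReal.coe_toNNReal (hz k j)
  refine ⟨c₀ + ∑ k : Fin N, ∑ j, c₀ * (snn r (z k j)).toNNReal +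
    ∑ i, ∑ k : Fin N, ∑ j, c₀ * ‖g k j i‖₊, fun v hv => ?_⟩
  obtain ⟨x, a, hx, ha, h⟩ := hdec v hv
  refine ⟨fun i => ∑ k, ∑ j, a k j * g k j i, x + ∑ k, ∑ j, a k j • z k j, ?_, fun i => ?_, ?_⟩
  · calc snn r (x + ∑ k, ∑ j, a k j • z k j)
        ≤ snn r x + ∑ k, ∑ j, snn r (a k j • z k j) := by
          refine (sn_add_le (normLike_nnnorm m) _ _).trans ?_
          gcongr
          refine (sn_sum_le (normLike_nnnorm m) _ _).trans (Finset.sum_le_sum fun k _ => ?_)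
          exact sn_sum_le (normLike_nnnorm m) _ _
      _ ≤ c₀ * snn r v + ∑ k : Fin N, ∑ j, (c₀ * snn r v) * (snn r (z k j)).toNNReal := by
          gcongr with k _ j _
          rw [snn, sn_smul (normLike_nnnorm m), hS]
          exact mul_le_mul' (ha k j) le_rfl
      _ = (c₀ + ∑ k : Fin N, ∑ j, c₀ * (snn r (z k j)).toNNReal : ℝ≥0) * snn r v := by
          rw [ENNReal.coe_add, add_mul, ENNReal.ofNNReal_finsetSum, Finset.sum_mul]
          congr 1
          refine Finset.sum_congr rfl fun k _ => ?_
          rw [ENNReal.ofNNReal_finsetSum, Finset.sum_mul]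
          refine Finset.sum_congr rfl fun j _ => ?_
          rw [ENNReal.coe_mul]; ring
      _ ≤ _ := mul_le_mul' (ENNReal.coe_le_coe.2 le_self_add) le_rfl
  · calc (‖∑ k, ∑ j, a k j * g k j i‖₊ : ℝ≥0∞)
        ≤ ∑ k, ∑ j, (‖a k j‖₊ : ℝ≥0∞) * ‖g k j i‖₊ := by
          simp only [← ENNReal.coe_mul, ← ENNReal.ofNNReal_finsetSum, ← nnnorm_mul]
          rw [ENNReal.coe_le_coe]
          exact (nnnorm_sum_le _ _).trans (Finset.sum_le_sum fun k _ => nnnorm_sum_le _ _)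
      _ ≤ ∑ k : Fin N, ∑ j, (c₀ * snn r v) * ‖g k j i‖₊ := by
          gcongr with k _ j _
          exact ha k j
      _ = (∑ k : Fin N, ∑ j, c₀ * ‖g k j i‖₊ : ℝ≥0) * snn r v := by
          rw [ENNReal.ofNNReal_finsetSum, Finset.sum_mul]
          refine Finset.sum_congr rfl fun k _ => ?_
          rw [ENNReal.ofNNReal_finsetSum, Finset.sum_mul]
          refine Finset.sum_congr rfl fun j _ => ?_
          rw [ENNReal.coe_mul]; ring
      _ ≤ _ := by
          refine mul_le_mul' (ENNReal.coe_le_coe.2 ?_) le_rfl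
          exact le_add_of_nonneg_of_le zero_le (Finset.single_le_sum
            (f := fun i => ∑ k : Fin N, ∑ j, c₀ * ‖g k j i‖₊) (fun _ _ => zero_le)
            (Finset.mem_univ i))
  · have h1 : ∑ i, (∑ k, ∑ j, a k j * g k j i) • e i =
        ∑ k : Fin N, ∑ j, a k j • ∑ i, g k j i • e i := by
      simp only [Finset.sum_smul, Finset.smul_sum, mul_smul]
      rw [Finset.sum_comm]
      refine Finset.sum_congr rfl fun k _ => Finset.sum_comm
    nth_rw 1 [h]
    simp only [hgz]
    simp only [h1, map_add, map_sum, map_smul, smul_add, Finset.sum_add_distrib]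
    abel

/-- A basis of the cokernel of multiplication by `f`, with convergent expansions. -/
theorem exists_lattice_basis (hA : ∀ k x, ‖A k x‖₊ ≤ B * K ^ k * k.factorial * ‖x‖₊)
    (h0 : IsNilpotent (A 0)) (hinj : ∀ v, Gev v → Top A v = 0 → v = 0) :
    ∃ e : Fin m → Sq m, (∀ i, Gev (e i)) ∧
      (∀ (c : Fin m → ℂ) x, Gev x → ∑ i, c i • e i = Top A x → c = 0) ∧
      ∀ v, Gev v → ∃ (c : ℕ → Fin m → ℂ) (w : ℕ → Sq m) (C : ℝ≥0),
        (∀ n i, ‖c n i‖₊ ≤ C * C ^ n) ∧ w 0 = v ∧ (∀ n, Gev (w n)) ∧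
        ∀ n, w n = ∑ i, c n i • e i + Top A (w (n + 1)) := by
  set r₀ : ℝ≥0 := (2 * (K + 1))⁻¹ with hr₀
  have hr₀pos : 0 < r₀ := by positivity
  have hK : ∀ r ≤ r₀, K * r ≤ 1 / 2 := fun r hr => by
    calc K * r ≤ (K + 1) * (2 * (K + 1))⁻¹ := by gcongr; exact le_self_add
      _ = 1 / 2 := by field_simp
  obtain ⟨e, he, hspan⟩ := exists_span_basis hA h0 hr₀pos (hK r₀ le_rfl) hinj
  have hs1 : ∀ r ≤ r₀, ∀ (k : ℕ) (j : Fin m), ∃ (c : Fin m → ℂ), ∃ x ∈ Xr m r,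
      (Pi.single k (Pi.single j (1 : ℂ)) : Sq m) = ∑ i, c i • e i + Top A x := by
    intro r hr k j
    obtain ⟨c, x, hx, h⟩ := hspan _ (snn_single_ne_top k (Pi.single j (1 : ℂ)))
    exact ⟨c, x, Xr_mono hr hx, h⟩
  refine ⟨e, fun i => gev_of_snn hr₀pos (he i), fun c x hx h => ?_, fun v hv => ?_⟩
  · obtain ⟨r₁, hr₁, hx⟩ := hx.exists_snn
    have hr : 0 < min r₀ r₁ := lt_min hr₀pos hr₁
    have hK' := hK _ (min_le_left r₀ r₁)
    obtain ⟨C, hC⟩ := exists_step hA h0 hr hK' (hs1 _ (min_le_left _ _))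
    refine span_basis_independent hA h0 hr hK' hinj
      (fun i => Xr_mono (min_le_left _ _) (he i)) (fun v hv => ?_) (hx _ (min_le_right _ _)) h
    obtain ⟨c, x, hx, -, h⟩ := hC v hv
    exact ⟨c, x, ne_top_of_le_ne_top (ENNReal.mul_ne_top ENNReal.coe_ne_top hv) hx, h⟩
  · obtain ⟨r₁, hr₁, hv⟩ := hv.exists_snn
    have hr : 0 < min r₀ r₁ := lt_min hr₀pos hr₁
    have hK' := hK _ (min_le_left r₀ r₁)
    set r := min r₀ r₁
    obtain ⟨C, hC⟩ := exists_step hA h0 hr hK' (hs1 _ (min_le_left _ _))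
    choose! c x hx hc h using hC
    set w : ℕ → Sq m := fun n => x^[n] v with hw
    have hw1 : ∀ n, w (n + 1) = x (w n) := fun n => Function.iterate_succ_apply' x n v
    have hfin : ∀ n, snn r (w n) ≠ ∞ := by
      intro n
      induction n with
      | zero => exact hv _ (min_le_right _ _)
      | succ n ih =>
        rw [hw1]
        exact ne_top_of_le_ne_top (ENNReal.mul_ne_top ENNReal.coe_ne_top ih) (hx _ ih)
    have hbd : ∀ n, snn r (w n) ≤ (C ^ n * (snn r v).toNNReal : ℝ≥0) := by
      intro n
      induction n with
      | zero => simp [hw, ENNReal.coe_toNNReal (hv r (min_le_right _ _))]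
      | succ n ih =>
        rw [hw1]
        refine (hx _ (hfin n)).trans ((mul_le_mul' le_rfl ih).trans (le_of_eq ?_))
        rw [← ENNReal.coe_mul, pow_succ', mul_assoc]
    refine ⟨fun n => c (w n), w, C + C * (snn r v).toNNReal, fun n i => ?_, rfl,
      fun n => gev_of_snn hr (hfin n), fun n => ?_⟩
    · have h1 := (hc _ (hfin n) i).trans (mul_le_mul' le_rfl (hbd n))
      rw [← ENNReal.coe_mul, ENNReal.coe_le_coe] at h1
      refine h1.trans ?_
      calc C * (C ^ n * (snn r v).toNNReal) = C * (snn r v).toNNReal * C ^ n := by ring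
        _ ≤ _ := mul_le_mul' le_add_self (pow_le_pow_left₀ zero_le le_self_add n)
    · rw [hw1]; exact h _ (hfin n)

/-- Sequences infinitely divisible by `f` vanish. -/
lemma eq_zero_of_iterate_Top (h0 : IsNilpotent (A 0)) {v : Sq m}
    (h : ∀ n, ∃ w, v = (Top A ^ n) w) : v = 0 := by
  obtain ⟨M, hM⟩ := h0
  have h1 : ∀ (k : ℕ) (w : Sq m), (∀ j < k, w j = 0) → Top A w k = A 0 (w k) := by
    intro k w hw
    rw [Top, LinearMap.add_apply, Pi.add_apply, cnv_apply, Finset.sum_range_succ,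
      Finset.sum_eq_zero, zero_add, Nat.sub_self]
    · cases k with
      | zero => rw [wsh_zero, add_zero]
      | succ k => rw [wsh_succ, hw k k.lt_succ_self, smul_zero, add_zero]
    · intro j hj
      rw [hw j (Finset.mem_range.1 hj), map_zero]
  have h2 : ∀ (k i : ℕ) (w : Sq m), (∀ j < k, w j = 0) →
      (∀ j < k, (Top A ^ i) w j = 0) ∧ (Top A ^ i) w k = (A 0 ^ i) (w k) := by
    intro k i w hw
    induction i with
    | zero => exact ⟨hw, rfl⟩
    | succ i ih =>
      rw [pow_succ', Module.End.mul_apply]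
      refine ⟨Top_vanish A ih.1, ?_⟩
      rw [h1 k _ ih.1, ih.2, pow_succ', Module.End.mul_apply]
  have h3 : ∀ (k : ℕ) (w : Sq m), ∀ j < k, (Top A ^ (M * k)) w j = 0 := by
    intro k w
    induction k with
    | zero => simp
    | succ k ih =>
      intro j hj
      rw [Nat.mul_succ, add_comm, pow_add, Module.End.mul_apply]
      obtain ⟨a, b⟩ := h2 k M _ ih
      rcases Nat.lt_succ_iff_lt_or_eq.1 hj with hj | rfl
      · exact a j hj
      · rw [b, hM]; rfl
  ext1 n
  obtain ⟨w, rfl⟩ := h (M * (n + 1))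
  exact h3 (n + 1) w n n.lt_succ_self

end

/-! ### Division by a convergent power series -/

lemma exists_fixed_point {ρ σ : ℝ≥0} (hρ : 0 < ρ) (hσ : 0 < σ) (T : PS →ₗ[ℂ] PS)
    (hT : ∀ a, nrm ρ σ (T a) ≤ ((1 / 2 : ℝ≥0) : ℝ≥0∞) * nrm ρ σ a) {g : PS}
    (hg : nrm ρ σ g ≠ ∞) : ∃ u, nrm ρ σ u < ∞ ∧ u = g + T u := by
  have hlt : ((1 / 2 : ℝ≥0) : ℝ≥0∞) < 1 := by
    rw [← ENNReal.coe_one, ENNReal.coe_lt_coe]; exact NNReal.half_lt_self one_ne_zero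
  have hpow : ∀ k : ℕ, nrm ρ σ ((T ^ k) g) ≤ ((1 / 2 : ℝ≥0) : ℝ≥0∞) ^ k * nrm ρ σ g := by
    intro k
    induction k with
    | zero => simp
    | succ k ih =>
      rw [pow_succ', Module.End.mul_apply, pow_succ', mul_assoc]
      exact (hT _).trans (by gcongr)
  have hsum : ∑' k, nrm ρ σ ((T ^ k) g) ≠ ∞ := by
    refine ne_top_of_le_ne_top ?_ (ENNReal.tsum_le_tsum hpow)
    rw [ENNReal.tsum_mul_right, ENNReal.tsum_geometric]
    exact ENNReal.mul_ne_top (ENNReal.inv_ne_top.2 (tsub_pos_of_lt hlt).ne') hg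
  obtain ⟨u, hu, ht⟩ := exists_sum_of_nrm hρ hσ hsum
  refine ⟨u, hu.trans_lt hsum.lt_top, ?_⟩
  refine eq_of_tendsto_nrm hρ hσ (a := fun m => ∑ k ∈ Finset.range (m + 1), (T ^ k) g)
    ((tendsto_add_atTop_iff_nat 1).2 ht) ?_
  refine tendsto_nrm_of_le (t := ((1 / 2 : ℝ≥0) : ℝ≥0∞)) ENNReal.coe_ne_top (fun m => ?_) ht
  have : g + T u - ∑ k ∈ Finset.range (m + 1), (T ^ k) g
      = T (u - ∑ k ∈ Finset.range m, (T ^ k) g) := by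
    rw [Finset.sum_range_succ', map_sub, map_sum]
    simp only [pow_succ', Module.End.mul_apply, pow_zero, Module.End.one_apply]
    ring
  rw [this]
  exact hT _

/-- The weight of an exponent in which `x` has weight `q + 1` and `y` has weight `1`. -/
def wl (q : ℕ) (n : Ex) : ℕ := (q + 1) * n 0 + n 1

lemma wl_add (q : ℕ) (m n : Ex) : wl q (m + n) = wl q m + wl q n := by
  simp only [wl, Finsupp.add_apply]; ring

lemma deg_le_wl (q : ℕ) (n : Ex) : deg n ≤ wl q n := by
  simp only [wl, deg]; nlinarith [Nat.zero_le (q * n 0)]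

lemma mon_pow_eq (q : ℕ) (s : ℝ≥0) (n : Ex) : mon (s ^ (q + 1)) s n = s ^ wl q n := by
  rw [mon, wl, ← pow_mul, pow_add _ ((q + 1) * n 0)]

lemma nrm_scale_wl_le {q k : ℕ} {s r : ℝ≥0} (hs : s ≤ 1) {a : PS}
    (ha : ∀ n, coeff n a ≠ 0 → k ≤ wl q n) :
    nrm ((s * r) ^ (q + 1)) (s * r) a ≤ ((s ^ k : ℝ≥0) : ℝ≥0∞) * nrm (r ^ (q + 1)) r a := by
  refine nrm_le_of_coeff _ fun n => ?_
  rw [← ENNReal.coe_mul, ENNReal.coe_le_coe, mon_pow_eq, mon_pow_eq, mul_pow]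
  by_cases h : coeff n a = 0
  · simp [h]
  · have h2 : s ^ wl q n ≤ s ^ k := pow_le_pow_of_le_one zero_le hs (ha n h)
    calc _ = s ^ wl q n * (‖coeff n a‖₊ * r ^ wl q n) := by ring
      _ ≤ _ := by gcongr

/-- The exponent `n₀` strictly minimizes the weight among the exponents of `f`. -/
structure Lead (f : PS) (q : ℕ) (n₀ : Ex) : Prop where
  ne : coeff n₀ f ≠ 0
  lt : ∀ n, n ≠ n₀ → coeff n f ≠ 0 → wl q n₀ < wl q n

lemma exists_lead {f : PS} (hf : f ≠ 0) : ∃ (n₀ : Ex) (q : ℕ), lexOrder f = toLex n₀ ∧ Lead f q n₀ := by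
  obtain ⟨n₀, h⟩ := exists_finsupp_eq_lexOrder_of_ne_zero hf
  refine ⟨n₀, n₀ 1, h, coeff_ne_zero_of_lexOrder h.symm, fun n hn hc => ?_⟩
  have h1 := lexOrder_le_of_coeff_ne_zero hc
  rw [h, WithTop.coe_le_coe] at h1
  have h2 : toLex n₀ < toLex n := lt_of_le_of_ne h1 fun h => hn (toLex.injective h).symm
  obtain ⟨i, hi, hlt⟩ := Finsupp.Lex.lt_iff.1 h2
  simp only [ofLex_toLex] at hi hlt
  simp only [wl]
  fin_cases i
  · simp only [Fin.zero_eta] at hlt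
    have : (n₀ 1 + 1) * (n₀ 0 + 1) ≤ (n₀ 1 + 1) * n 0 := Nat.mul_le_mul_left _ hlt
    nlinarith
  · have := hi 0 (by simp)
    simp only [Fin.mk_one] at hlt
    rw [this]; omega

lemma Lead.exists_quot {f : PS} {q : ℕ} {n₀ : Ex} (h : Lead f q n₀) (hf : Conv f) {G : PS}
    (hG : Conv G) : ∃ Q, Conv Q ∧ ∀ n, coeff (n + n₀) (G - f * Q) = 0 := by
  set c := coeff n₀ f with hc
  have hc0 : c ≠ 0 := h.ne
  set e : PS := f - monomial n₀ c with he
  have hew : ∀ n, coeff n e ≠ 0 → wl q n₀ + 1 ≤ wl q n := by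
    intro n hn
    rw [he, map_sub, coeff_monomial] at hn
    split_ifs at hn with h1
    · rw [h1, ← hc, sub_self] at hn; exact absurd rfl hn
    · rw [sub_zero] at hn; exact h.lt n h1 hn
  have hec : Conv e := hf.sub (conv_monomial _ _)
  obtain ⟨r₁, hr₁, hr₁1, hr₁e⟩ := hec.exists_le one_pos
  obtain ⟨r, hr, hrr, hrG⟩ := hG.exists_le hr₁
  have hr1 : r ≤ 1 := hrr.trans hr₁1
  have hre : nrm (r ^ (q + 1)) r e < ∞ :=
    (nrm_mono ((pow_le_of_le_one zero_le hr1 (by omega)).trans hrr) hrr e).trans_lt hr₁e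
  lift nrm (r ^ (q + 1)) r e to ℝ≥0 using hre.ne with M hM
  set t : ℝ≥0 := 1 / 2 * ‖c‖₊ * r ^ wl q n₀ with ht
  have hcn : 0 < ‖c‖₊ := nnnorm_pos.2 hc0
  have ht0 : 0 < t := by positivity
  set s : ℝ≥0 := min 1 (t / (M + 1)) with hs
  have hs0 : 0 < s := lt_min one_pos (by positivity)
  have hs1 : s ≤ 1 := min_le_left _ _
  set σ := s * r with hσ
  have hσ0 : 0 < σ := by positivity
  have hρ0 : 0 < σ ^ (q + 1) := by positivity
  have hσr : σ ≤ r := mul_le_of_le_one_left zero_le hs1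
  have hen : nrm (σ ^ (q + 1)) σ e ≤
      ((1 / 2 * ‖c‖₊ * mon (σ ^ (q + 1)) σ n₀ : ℝ≥0) : ℝ≥0∞) := by
    refine (nrm_scale_wl_le hs1 hew).trans ?_
    rw [← hM, ← ENNReal.coe_mul, ENNReal.coe_le_coe, mon_pow_eq]
    have h1 : s * M ≤ t := calc
      s * M ≤ t / (M + 1) * (M + 1) := by
        gcongr
        · exact min_le_right _ _
        · exact le_self_add
      _ = t := div_mul_cancel₀ _ (by positivity)
    calc s ^ (wl q n₀ + 1) * M = s ^ wl q n₀ * (s * M) := by ring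
      _ ≤ s ^ wl q n₀ * t := by gcongr
      _ = _ := by rw [ht, hσ, mul_pow]; ring
  set T : PS →ₗ[ℂ] PS := (-c⁻¹) • (shiftDown n₀ ∘ₗ LinearMap.mulLeft ℂ e) with hT
  have hTa : ∀ a, T a = (-c⁻¹) • shiftDown n₀ (e * a) := fun a => rfl
  have hmp : 0 < mon (σ ^ (q + 1)) σ n₀ := mon_pos hρ0 hσ0 _
  have hTn : ∀ a, nrm (σ ^ (q + 1)) σ (T a) ≤
      ((1 / 2 : ℝ≥0) : ℝ≥0∞) * nrm (σ ^ (q + 1)) σ a := by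
    intro a
    rw [hTa]
    refine (nrm_smul_le _ _ _ _).trans ?_
    have h1 := nrm_shiftDown_le (σ ^ (q + 1)) σ n₀ (e * a)
    have h2 := h1.trans ((nrm_mul_le _ _ _ _).trans (mul_le_mul' hen le_rfl))
    rw [← ENNReal.mul_le_mul_iff_left (c := ((mon (σ ^ (q + 1)) σ n₀ : ℝ≥0) : ℝ≥0∞))
      (by exact_mod_cast hmp.ne') ENNReal.coe_ne_top, mul_assoc]
    refine (mul_le_mul' le_rfl h2).trans (le_of_eq ?_)
    rw [nnnorm_neg, nnnorm_inv, ← mul_assoc, ← ENNReal.coe_mul, mul_right_comm _ _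
      ((mon (σ ^ (q + 1)) σ n₀ : ℝ≥0) : ℝ≥0∞), ← ENNReal.coe_mul]
    congr 2
    field_simp
  have hg : nrm (σ ^ (q + 1)) σ (c⁻¹ • shiftDown n₀ G) ≠ ∞ := by
    refine ((nrm_smul_le _ _ _ _).trans_lt (ENNReal.mul_lt_top ENNReal.coe_lt_top ?_)).ne
    have h1 := (nrm_shiftDown_le (σ ^ (q + 1)) σ n₀ G).trans_lt ((nrm_mono
      ((pow_le_of_le_one zero_le (hσr.trans hr1) (by omega)).trans hσr) hσr G).trans_lt hrG)
    by_contra h2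
    rw [not_lt, top_le_iff] at h2
    rw [h2, ENNReal.top_mul (by exact_mod_cast hmp.ne')] at h1
    exact lt_irrefl _ h1
  obtain ⟨Q, hQ, hQe⟩ := exists_fixed_point hρ0 hσ0 T hTn hg
  refine ⟨Q, conv_of_nrm hρ0 hσ0 hQ, fun n => ?_⟩
  have h1 := congrArg (coeff n) hQe
  rw [hTa, map_add, coeff_smul, coeff_smul, coeff_shiftDown, coeff_shiftDown] at h1
  have h2 : f = e + monomial n₀ c := by rw [he]; ring
  rw [h2, add_mul, map_sub, map_add, add_comm n n₀, coeff_add_monomial_mul, add_comm n₀ n, h1]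
  field_simp
  ring

/-- The ideal generated by `f` is closed in the adic topology. -/
lemma cdvd_of_forall_ord {f : PS} (hf : Conv f) (hf0 : f ≠ 0) {G : PS} (hG : Conv G)
    (h : ∀ n, ∃ a, Ord n (G - f * a)) : CDvd f G := by
  obtain ⟨n₀, q, -, hl⟩ := exists_lead hf0
  obtain ⟨Q, hQ, hr⟩ := hl.exists_quot hf hG
  refine ⟨Q, hQ, sub_eq_zero.1 ?_⟩
  ext n
  rw [coeff_zero]
  obtain ⟨a, ha⟩ := h (wl q n + 1)
  have hord : ∀ k, wl q k ≤ wl q n → coeff k (G - f * Q) = coeff k (f * (a - Q)) := by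
    intro k hk
    have := ha k (by have := deg_le_wl q k; omega)
    rw [show G - f * Q = (G - f * a) + f * (a - Q) by ring, map_add, this, zero_add]
  have hvan : ∀ w k, wl q k = w → w + wl q n₀ ≤ wl q n → coeff k (a - Q) = 0 := by
    intro w
    induction w using Nat.strong_induction_on with
    | _ w ih =>
      intro k hk hw
      have h1 := hr k
      rw [hord _ (by rw [wl_add]; omega), coeff_mul,
        Finset.sum_eq_single (n₀, k)] at h1
      · exact (mul_eq_zero.1 h1).resolve_left hl.ne
      · intro p hp hpn
        have hp' := Finset.HasAntidiagonal.mem_antidiagonal.1 hp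
        by_cases hc : coeff p.1 f = 0
        · rw [hc, zero_mul]
        · have hne : p.1 ≠ n₀ := by
            intro hpe
            apply hpn
            rw [hpe, add_comm k] at hp'
            exact Prod.ext hpe (add_left_cancel hp')
          have h2 := hl.lt _ hne hc
          have h3 := congrArg (wl q) hp'
          rw [wl_add, wl_add] at h3
          rw [ih (wl q p.2) (by omega) p.2 rfl (by omega), mul_zero]
      · intro hp
        exact absurd (Finset.HasAntidiagonal.mem_antidiagonal.2 (add_comm _ _)) hp
  rw [hord n le_rfl, coeff_mul]
  refine Finset.sum_eq_zero fun p hp => ?_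
  have hp' := Finset.HasAntidiagonal.mem_antidiagonal.1 hp
  by_cases hc : coeff p.1 f = 0
  · rw [hc, zero_mul]
  · have h2 : wl q n₀ ≤ wl q p.1 := by
      by_cases hne : p.1 = n₀
      · rw [hne]
      · exact (hl.lt _ hne hc).le
    have h3 := congrArg (wl q) hp'
    rw [wl_add] at h3
    rw [hvan _ p.2 rfl (by omega), mul_zero]

lemma lexOrder_pow {f : PS} {n : Ex} (h : lexOrder f = toLex n) (k : ℕ) :
    lexOrder (f ^ k) = toLex (k • n) := by
  induction k with
  | zero =>
    rw [pow_zero, zero_smul]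
    refine le_antisymm (lexOrder_le_of_coeff_ne_zero (by simp)) ?_
    rw [le_lexOrder_iff]
    intro d hd
    rw [WithTop.coe_lt_coe] at hd
    exact absurd hd (not_lt.2 (bot_le (a := toLex d)))
  | succ k ih =>
    rw [pow_succ, lexOrder_mul, ih, h, succ_nsmul, toLex_add, WithTop.coe_add]

/-- Principal ideals of convergent power series are integrally closed. -/
lemma cdvd_of_forall_pow {f : PS} (hf : Conv f) (hf0 : f ≠ 0) {G : PS} (hG : Conv G)
    (h : ∀ k, ∃ w, G ^ (k + 1) = f ^ k * w) : CDvd f G := by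
  obtain ⟨n₀, q, hn₀, hl⟩ := exists_lead hf0
  obtain ⟨Q, hQ, hr⟩ := hl.exists_quot hf hG
  refine ⟨Q, hQ, sub_eq_zero.1 ?_⟩
  set R := G - f * Q with hR
  by_contra hR0
  obtain ⟨m, hm⟩ := exists_finsupp_eq_lexOrder_of_ne_zero hR0
  have key : ∀ k, k • n₀ ≤ (k + 1) • m := by
    intro k
    have h1 : f ^ k ∣ R ^ (k + 1) := by
      rw [hR, sub_eq_add_neg, add_pow]
      refine Finset.dvd_sum fun j hj => ?_
      refine Dvd.dvd.mul_right ?_ _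
      have hjk : j ≤ k + 1 := by simpa [Nat.lt_succ_iff] using hj
      rcases j with _ | j
      · rw [pow_zero, one_mul, Nat.sub_zero, neg_pow, mul_pow, pow_succ f k]
        exact ⟨(-1) ^ (k + 1) * (f * Q ^ (k + 1)), by ring⟩
      · obtain ⟨w, hw⟩ := h j
        obtain ⟨i, rfl⟩ : ∃ i, k = j + i := ⟨k - j, by omega⟩
        rw [hw, show j + i + 1 - (j + 1) = i by omega, neg_pow, mul_pow, pow_add]
        exact ⟨w * ((-1) ^ i * Q ^ i), by ring⟩
    obtain ⟨w, hw⟩ := h1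
    have hw0 : w ≠ 0 := by
      rintro rfl
      rw [mul_zero] at hw
      exact hR0 (pow_eq_zero_iff (by omega) |>.1 hw)
    obtain ⟨l, hl'⟩ := exists_finsupp_eq_lexOrder_of_ne_zero hw0
    have h2 := congrArg lexOrder hw
    rw [lexOrder_mul, lexOrder_pow hm, lexOrder_pow hn₀, hl', ← WithTop.coe_add,
      WithTop.coe_inj, ← toLex_add] at h2
    rw [toLex.injective h2]
    exact le_self_add
  have hle : n₀ ≤ m := by
    intro i
    by_contra! hlt
    have := key (n₀ i + 1) i
    simp only [Finsupp.smul_apply, smul_eq_mul] at this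
    nlinarith
  have h1 := coeff_ne_zero_of_lexOrder hm.symm
  apply h1
  have := hr (m - n₀)
  rwa [tsub_add_cancel_of_le hle] at this

section

/-! ### Absence of torsion -/

variable {μ : ℕ} {f : PS} {b : Fin μ → PS}

lemma Dx_pow (g : PS) (k : ℕ) : Dx (g ^ (k + 1)) = C (k + 1 : ℂ) * (g ^ k * Dx g) := by
  rw [Derivation.leibniz_pow]
  simp [smul_eq_mul]

lemma Dy_pow (g : PS) (k : ℕ) : Dy (g ^ (k + 1)) = C (k + 1 : ℂ) * (g ^ k * Dy g) := by
  rw [Derivation.leibniz_pow]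
  simp [smul_eq_mul]

lemma C_mul_C_inv {c : ℂ} (hc : c ≠ 0) : (C c : PS) * C c⁻¹ = 1 := by
  rw [← map_mul, mul_inv_cancel₀ hc, map_one]

lemma Milnor.ne_zero (M : Milnor f b) : f ≠ 0 := by
  rintro rfl
  rcases M.partials_ne_zero with h | h <;> simp at h

namespace Milnor

lemma br_of_eq {G k : PS} (hx : Dx G = k * Dx f) (hy : Dy G = k * Dy f) : br f k = 0 := by
  have h := Dx_Dy_comm G
  rw [hx, hy, Dx_mul, Dy_mul, Dx_Dy_comm f] at h
  rw [br]
  linear_combination -h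

lemma exists_ord_sub_sum (M : Milnor f b) (n : ℕ) : ∀ {G : PS}, Conv G → br f G = 0 →
    ∃ c : ℕ → ℂ, Ord n (G - ∑ i ∈ Finset.range n, C (c i) * f ^ i) := by
  induction n with
  | zero => exact fun _ _ => ⟨0, ord_zero_left _⟩
  | succ n ih =>
    intro G hG hbr
    obtain ⟨k, hk, hx, hy⟩ := M.koszul (hG.pderiv 0) (hG.pderiv 1) hbr
    change Dx G = _ at hx
    change Dy G = _ at hy
    obtain ⟨c, hc⟩ := ih hk (br_of_eq hx hy)
    set c' : ℕ → ℂ := fun i => Nat.casesOn i (coeff 0 G) fun i => (i + 1 : ℂ)⁻¹ * c i with hc'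
    refine ⟨c', ?_⟩
    set r := k - ∑ i ∈ Finset.range n, C (c i) * f ^ i with hr
    set P := ∑ i ∈ Finset.range n, C ((i + 1 : ℂ)⁻¹ * c i) * f ^ (i + 1) with hP
    have hs : ∑ i ∈ Finset.range (n + 1), C (c' i) * f ^ i = P + C (coeff 0 G) := by
      rw [Finset.sum_range_succ', pow_zero, mul_one]; rfl
    have hcc : ∀ i : ℕ, (C (c i) : PS) = C ((i + 1 : ℂ)⁻¹ * c i) * C (i + 1 : ℂ) := fun i => by
      rw [← map_mul]; congr 1
      have : (i + 1 : ℂ) ≠ 0 := by exact_mod_cast i.succ_ne_zero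
      field_simp
    have hPx : Dx P = (∑ i ∈ Finset.range n, C (c i) * f ^ i) * Dx f := by
      rw [hP, map_sum, Finset.sum_mul]
      refine Finset.sum_congr rfl fun i _ => ?_
      rw [Dx_mul, Dx_C, Dx_pow, hcc]; ring
    have hPy : Dy P = (∑ i ∈ Finset.range n, C (c i) * f ^ i) * Dy f := by
      rw [hP, map_sum, Finset.sum_mul]
      refine Finset.sum_congr rfl fun i _ => ?_
      rw [Dy_mul, Dy_C, Dy_pow, hcc]; ring
    have he : eul (G - (P + C (coeff 0 G))) = r * eul f := by
      rw [eul, eul, map_sub, map_sub, map_add, map_add, Dx_C, Dy_C, hPx, hPy, hx, hy, hr]; ring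
    have ho : Ord (n + 1) (r * eul f) := hc.mul (ord_eul f)
    rw [hs]
    intro d hd
    rcases Nat.eq_zero_or_pos (deg d) with h0 | h0
    · have : d = 0 := by
        ext i; fin_cases i <;> simp [deg] at h0 ⊢ <;> omega
      rw [this, map_sub, map_add, hP, map_sum]
      rw [Finset.sum_eq_zero fun i _ => ?_]
      · simp
      · rw [coeff_zero_eq_constantCoeff_apply, map_mul, map_pow,
          ← coeff_zero_eq_constantCoeff_apply f, M.coeff_zero]
        simp
    · have h1 := ho d hd
      rw [← he, coeff_eul] at h1
      exact (mul_eq_zero.1 h1).resolve_left (by exact_mod_cast h0.ne')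

/-- A convergent series vanishing at the origin and constant along the fibres of `f` is divisible
by `f`. -/
lemma cdvd_of_br_eq_zero (M : Milnor f b) {G : PS} (hG : Conv G) (h : br f G = 0)
    (h0 : coeff 0 G = 0) : CDvd f G := by
  refine cdvd_of_forall_ord M.conv M.ne_zero hG fun n => ?_
  obtain ⟨c, hc⟩ := M.exists_ord_sub_sum (n + 1) hG h
  have h1 := hc 0 (by simp [deg])
  rw [Finset.sum_range_succ', pow_zero, mul_one] at hc h1
  have h2 : ∑ i ∈ Finset.range n, C (c (i + 1)) * f ^ (i + 1)
      = f * ∑ i ∈ Finset.range n, C (c (i + 1)) * f ^ i := by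
    rw [Finset.mul_sum]
    exact Finset.sum_congr rfl fun i _ => by ring
  have h3 : c 0 = 0 := by
    rw [map_sub, h0, map_add, h2, coeff_zero_eq_constantCoeff_apply (φ := f * _), map_mul,
      ← coeff_zero_eq_constantCoeff_apply f, M.coeff_zero] at h1
    simpa using h1
  refine ⟨∑ i ∈ Finset.range n, C (c (i + 1)) * f ^ i, ?_⟩
  rw [h3, map_zero, add_zero, h2] at hc
  exact hc.mono n.le_succ

lemma cdvd_of_sq (M : Milnor f b) {G : PS} (hG : Conv G) (h : CDvd f (G ^ 2)) : CDvd f G := by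
  have hf0 := M.ne_zero
  have key : ∀ k : ℕ, ∃ w, Conv w ∧ G ^ (k + 2) = f ^ (k + 1) * w := by
    intro k
    induction k with
    | zero =>
      obtain ⟨w, hw, e⟩ := h
      exact ⟨w, hw, by rw [e]; ring⟩
    | succ k ih =>
      obtain ⟨w, hw, e⟩ := ih
      have hk : (k + 1 : ℂ) ≠ 0 := by exact_mod_cast k.succ_ne_zero
      have hdvd : CDvd f (w * G) := by
        refine M.cdvd_of_mul_partials hf0
          ⟨C (k + 1 : ℂ)⁻¹ * (C (k + 2 : ℂ) * (w * Dx G) - Dx w * G),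
            (conv_C _).mul (((conv_C _).mul (hw.mul (hG.pderiv 0))).sub
              ((hw.pderiv 0).mul hG)), ?_⟩
          ⟨C (k + 1 : ℂ)⁻¹ * (C (k + 2 : ℂ) * (w * Dy G) - Dy w * G),
            (conv_C _).mul (((conv_C _).mul (hw.mul (hG.pderiv 1))).sub
              ((hw.pderiv 1).mul hG)), ?_⟩
        · have h1 := congrArg Dx e
          rw [Dx_pow, Dx_mul, Dx_pow] at h1
          push_cast at h1
          rw [show (k + 1 + 1 : ℂ) = k + 2 by ring] at h1
          apply mul_left_cancel₀ (pow_ne_zero k hf0)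
          have h2 := C_mul_C_inv hk
          linear_combination (-C (k + 1 : ℂ)⁻¹ * G) * h1 + C (k + 1 : ℂ)⁻¹ * C (k + 2 : ℂ) * Dx G * e
            - f ^ k * Dx f * (w * G) * h2
        · have h1 := congrArg Dy e
          rw [Dy_pow, Dy_mul, Dy_pow] at h1
          push_cast at h1
          rw [show (k + 1 + 1 : ℂ) = k + 2 by ring] at h1
          apply mul_left_cancel₀ (pow_ne_zero k hf0)
          have h2 := C_mul_C_inv hk
          linear_combination (-C (k + 1 : ℂ)⁻¹ * G) * h1 + C (k + 1 : ℂ)⁻¹ * C (k + 2 : ℂ) * Dy G * e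
            - f ^ k * Dy f * (w * G) * h2
      obtain ⟨w', hw', e'⟩ := hdvd
      refine ⟨w', hw', ?_⟩
      rw [pow_succ, e, mul_assoc, e']; ring
  refine cdvd_of_forall_pow M.conv hf0 hG fun k => ?_
  rcases k with _ | k
  · exact ⟨G, by ring⟩
  · obtain ⟨w, -, e⟩ := key k
    exact ⟨w, e⟩

lemma cdvd_of_pow (M : Milnor f b) {g : PS} (hg : Conv g) {j : ℕ} (h : CDvd f (g ^ (j + 1))) :
    CDvd f g := by
  induction j using Nat.strong_induction_on with
  | _ j ih =>
    rcases j with _ | j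
    · simpa using h
    · refine ih ((j + 1) / 2) (by omega) (M.cdvd_of_sq (hg.pow _) ?_)
      obtain ⟨i, hi⟩ : ∃ i, ((j + 1) / 2 + 1) * 2 = i + (j + 1 + 1) :=
        ⟨((j + 1) / 2 + 1) * 2 - (j + 1 + 1), by omega⟩
      rw [← pow_mul, hi, pow_add]
      exact h.mul_left (hg.pow _)

end Milnor

namespace Division

variable (D : Division f b)

lemma exists_A_bound (M : Milnor f b) : ∃ B K : ℝ≥0, ∀ k x,
    ‖D.A k x‖₊ ≤ B * K ^ k * k.factorial * ‖x‖₊ := by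
  obtain ⟨B, K, h⟩ := D.gev_A M
  refine ⟨μ * B, K, fun k x => pi_nnnorm_le_iff.2 fun i => ?_⟩
  have hx : D.A k x = ∑ j, x j • D.A k (Pi.single j 1) := by
    conv_lhs => rw [pi_eq_sum_univ' x, map_sum]
    simp
  rw [hx, Finset.sum_apply]
  refine (nnnorm_sum_le _ _).trans ?_
  calc _ ≤ ∑ j : Fin μ, ‖x‖₊ * (B * (K ^ k * k.factorial)) := by
        refine Finset.sum_le_sum fun j _ => ?_
        rw [Pi.smul_apply, nnnorm_smul]
        gcongr
        · exact nnnorm_le_pi_nnnorm x j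
        · exact h k i j
    _ = _ := by simp; ring

lemma Psi_f_mul (M : Milnor f b) {α : PS × PS} (h : Coc f α) :
    D.Psi (f * α.1, f * α.2) = Top D.A (D.Psi α) := by
  ext1 n
  rw [D.Psi_mul M h, Top, LinearMap.add_apply, Pi.add_apply, cnv_apply]
  congr 1
  rcases n with _ | n
  · simp [wsh_zero]
  · rw [wsh_succ, if_neg n.succ_ne_zero, Nat.add_sub_cancel]

lemma snn_Psi_ne_top {K B R : ℝ≥0} (h : ∀ (u : PS) (k : ℕ) (i : Fin μ),
    (‖D.Phi u k i‖₊ : ℝ≥0∞) ≤ ((B * (K ^ k * k.factorial) : ℝ≥0) : ℝ≥0∞) * nrm R R u)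
    {r : ℝ≥0} (hr : K * r ≤ 1 / 2) {α : PS × PS} (hα : nrm R R (dform α) < ∞) :
    snn r (D.Psi α) ≠ ∞ := by
  lift nrm R R (dform α) to ℝ≥0 using hα.ne with T hT
  have h1 : ∀ k, (‖D.Psi α k‖₊ : ℝ≥0∞) * wt r k ≤
      (B * K * T : ℝ≥0) * ((1 / 2 : ℝ≥0) : ℝ≥0∞) ^ k := by
    intro k
    rw [← ENNReal.coe_mul, ← ENNReal.coe_pow, ← ENNReal.coe_mul, ENNReal.coe_le_coe]
    have h2 : ‖D.Psi α k‖₊ ≤ B * (K ^ (k + 1) * (k + 1).factorial) * T := by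
      refine pi_nnnorm_le_iff.2 fun i => ?_
      have := h (dform α) (k + 1) i
      rwa [← hT, ← ENNReal.coe_mul, ENNReal.coe_le_coe] at this
    have h3 : ((k + 1).factorial : ℝ≥0) ≠ 0 := by exact_mod_cast (k + 1).factorial_ne_zero
    calc ‖D.Psi α k‖₊ * wt r k ≤ B * (K ^ (k + 1) * (k + 1).factorial) * T * wt r k := by gcongr
      _ = B * K * T * (K * r) ^ k := by unfold wt; field_simp; ring
      _ ≤ B * K * T * (1 / 2) ^ k := by gcongr
  refine ne_top_of_le_ne_top ?_ (ENNReal.tsum_le_tsum h1)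
  rw [ENNReal.tsum_mul_left, ENNReal.tsum_geometric]
  refine ENNReal.mul_ne_top ENNReal.coe_ne_top (ENNReal.inv_ne_top.2 ?_)
  norm_num

lemma Coc.sum {ι : Type*} {s : Finset ι} {α : ι → PS × PS} (a : ι → ℂ) (h : ∀ i ∈ s, Coc f (α i)) :
    Coc f (∑ i ∈ s, a i • α i) := by
  refine ⟨?_, ?_, ?_⟩
  · rw [Prod.fst_sum]
    exact Conv.sum fun i hi => (h i hi).1.smul _
  · rw [Prod.snd_sum]
    exact Conv.sum fun i hi => (h i hi).2.1.smul _
  · rw [map_sum]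
    refine InJ.sum fun i hi => ?_
    rw [map_smul, smul_eq_C_mul]
    exact (h i hi).2.2.mul_left (conv_C _)

lemma Cob.wedge {α : PS × PS} {φ h : PS} (h1 : α.1 = Dx φ + h * Dx f)
    (h2 : α.2 = Dy φ + h * Dy f) : Dx f * α.2 - Dy f * α.1 = br f φ := by
  rw [h1, h2, br]; ring

/-- Multiplication by `f` is injective on the cohomology of the relative de Rham complex. -/
lemma cob_of_cob_mul (M : Milnor f b) {α : PS × PS} (hα : Coc f α)
    (hc : Cob f (f * α.1, f * α.2)) : Cob f α := by
  obtain ⟨D⟩ := M.exists_division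
  obtain ⟨g₁, h, hg₁, hh, e1, e2⟩ := hc
  have hf0 := M.ne_zero
  obtain ⟨g, hg, hg0, e1, e2⟩ : ∃ g, Conv g ∧ coeff 0 g = 0 ∧
      f * α.1 = Dx g + h * Dx f ∧ f * α.2 = Dy g + h * Dy f :=
    ⟨g₁ - C (coeff 0 g₁), hg₁.sub (conv_C _), by simp,
      by rw [map_sub, Dx_C, sub_zero]; exact e1, by rw [map_sub, Dy_C, sub_zero]; exact e2⟩
  suffices hdvd : CDvd f g by
    obtain ⟨φ, hφ, rfl⟩ := hdvd
    rw [Dx_mul] at e1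
    rw [Dy_mul] at e2
    obtain ⟨k, hk, e⟩ : CDvd f (φ + h) := M.cdvd_of_mul_partials hf0
      ⟨α.1 - Dx φ, hα.1.sub (hφ.pderiv 0), by linear_combination -e1⟩
      ⟨α.2 - Dy φ, hα.2.1.sub (hφ.pderiv 1), by linear_combination -e2⟩
    refine ⟨φ, k, hφ, hk, ?_, ?_⟩ <;> apply mul_left_cancel₀ hf0
    · linear_combination e1 + Dx f * e
    · linear_combination e2 + Dy f * e
  set u := Dx f * α.2 - Dy f * α.1 with hu
  have huc : Conv u := ((M.conv.pderiv 0).mul hα.2.1).sub ((M.conv.pderiv 1).mul hα.1)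
  have hfu : f * u = br f g := by
    rw [hu, br]; linear_combination Dx f * e2 - Dy f * e1
  obtain ⟨N, p, q, hp, hq, hN⟩ := M.exists_pow_mem hg hg0
  set β : PS × PS := (-(u * q), u * p) with hβ
  have hβ1 : Conv β.1 := (huc.mul hq).neg
  have hβ2 : Conv β.2 := huc.mul hp
  have hβw : Dx f * β.2 - Dy f * β.1 = u * g ^ N := by rw [hN, hβ]; ring
  set W := Dx g * β.2 - Dy g * β.1 with hW
  have hWc : Conv W := ((hg.pderiv 0).mul hβ2).sub ((hg.pderiv 1).mul hβ1)
  have hdc : Conv (dform β) := conv_dform hβ1 hβ2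
  set γ : ℕ → PS × PS := fun i =>
    (C (2 * N + i + 2 : ℂ) * (g ^ (N + i + 1) * β.1), C (2 * N + i + 2 : ℂ) * (g ^ (N + i + 1) * β.2))
    with hγ
  have hγd : ∀ i, dform (γ i) = C (2 * N + i + 2 : ℂ) *
      (g ^ (N + i) * (C (N + i + 1 : ℂ) * W + g * dform β)) := by
    intro i
    simp only [hγ, dform_apply, Dx_mul, Dy_mul, Dx_C, Dy_C, Dx_pow, Dy_pow, hW]
    push_cast
    ring
  have hγc : ∀ i, Coc f (γ i) := by
    intro i
    refine ⟨(conv_C _).mul ((hg.pow _).mul hβ1), (conv_C _).mul ((hg.pow _).mul hβ2), ?_⟩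
    rw [hγd]
    refine InJ.mul_left ?_ (conv_C _)
    rw [mul_comm, pow_add, mul_comm (g ^ N), ← mul_assoc]
    exact InJ.mul_left ⟨p, q, hp, hq, hN⟩
      ((((conv_C _).mul hWc).add (hg.mul hdc)).mul (hg.pow _))
  have hγw : ∀ i, f * (Dx f * (γ i).2 - Dy f * (γ i).1) = br f (g ^ (2 * N + i + 2)) := by
    intro i
    have h1 : Dx f * (γ i).2 - Dy f * (γ i).1
        = C (2 * N + i + 2 : ℂ) * (g ^ (N + i + 1) * (u * g ^ N)) := by
      rw [← hβw, hγ]; ring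
    rw [h1, br, show 2 * N + i + 2 = (2 * N + i + 1) + 1 by ring, Dx_pow, Dy_pow]
    have h2 : ((2 * N + i + 1 : ℕ) + 1 : ℂ) = 2 * N + i + 2 := by push_cast; ring
    rw [h2]
    rw [br] at hfu
    linear_combination C (2 * N + i + 2 : ℂ) * g ^ (2 * N + i + 1) * hfu
  have hγT : ∀ i, Top D.A (D.Psi (γ i)) = 0 := by
    intro i
    rw [← D.Psi_f_mul M (hγc i)]
    have hgp := hg.pow (2 * N + i + 2)
    obtain ⟨k, hk, h1, h2⟩ := M.koszul
      (p := f * (γ i).1 - Dx (g ^ (2 * N + i + 2))) (q := f * (γ i).2 - Dy (g ^ (2 * N + i + 2)))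
      ((M.conv.mul (hγc i).1).sub (hgp.pderiv 0)) ((M.conv.mul (hγc i).2.1).sub (hgp.pderiv 1)) (by
        have := hγw i
        rw [br] at this
        linear_combination this)
    exact D.Psi_of_cob M ⟨_, k, hgp, hk, by linear_combination h1, by linear_combination h2⟩
  obtain ⟨B, K, hA⟩ := D.exists_A_bound M
  obtain ⟨R, -, -, ⟨K', B', hPhi⟩, hRg, hRW, hRd⟩ := exists_radius
    (D.eventually_Phi_bound.and (hg.eventually.and (hWc.eventually.and hdc.eventually))) one_pos
  set r : ℝ≥0 := (2 * (K + K' + 1))⁻¹ with hr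
  have hr0 : 0 < r := by positivity
  have hKr : K * r ≤ 1 / 2 := by
    calc K * r ≤ (K + K' + 1) * (2 * (K + K' + 1))⁻¹ := by
          gcongr; rw [add_assoc]; exact le_self_add
      _ = 1 / 2 := by field_simp
  have hKr' : K' * r ≤ 1 / 2 := by
    calc K' * r ≤ (K + K' + 1) * (2 * (K + K' + 1))⁻¹ := by
          gcongr; rw [add_right_comm]; exact le_add_self
      _ = 1 / 2 := by field_simp
  obtain ⟨L, hL⟩ := ker_Top_dependent hA (D.A_zero_nilpotent M) hr0 hKr
  obtain ⟨a, ha, hsum⟩ := hL (fun i => D.Psi (γ i)) (fun i => by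
    refine D.snn_Psi_ne_top hPhi hKr' ?_
    rw [hγd]
    refine (nrm_C_mul_le _ _ _ _).trans_lt (ENNReal.mul_lt_top ENNReal.coe_lt_top ?_)
    refine (nrm_mul_le _ _ _ _).trans_lt (ENNReal.mul_lt_top
      ((nrm_pow_le _ _ _ _).trans_lt (ENNReal.pow_lt_top hRg)) ?_)
    refine (nrm_add_le _ _ _ _).trans_lt (ENNReal.add_lt_top.2 ⟨?_, ?_⟩)
    · exact (nrm_C_mul_le _ _ _ _).trans_lt (ENNReal.mul_lt_top ENNReal.coe_lt_top hRW)
    · exact (nrm_mul_le _ _ _ _).trans_lt (ENNReal.mul_lt_top hRg hRd)) (fun i => hγT i)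
  have hcob : Cob f (∑ i, a i • γ i) := D.cob_of_Psi_eq_zero M (Coc.sum a fun i _ => hγc i) (by
    rw [map_sum]; simpa only [map_smul] using hsum)
  obtain ⟨φ, k, hφ, hk, h1, h2⟩ := hcob
  have hw := Cob.wedge h1 h2
  set P : PS := ∑ i, C (a i) * g ^ (2 * N + i + 2) with hP
  have hPc : Conv P := Conv.sum fun i _ => (conv_C _).mul (hg.pow _)
  have hbr : br f (P - f * φ) = 0 := by
    rw [br_sub, br_mul, br_self, zero_mul, add_zero, ← hw, hP, br_sum, Prod.fst_sum, Prod.snd_sum,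
      Finset.mul_sum, Finset.mul_sum, ← Finset.sum_sub_distrib, Finset.mul_sum,
      ← Finset.sum_sub_distrib]
    refine Finset.sum_eq_zero fun i _ => ?_
    have hbC : br f (C (a i)) = 0 := by rw [br, Dx_C, Dy_C]; ring
    rw [br_mul, hbC, ← hγw, Prod.smul_fst, Prod.smul_snd, smul_eq_C_mul, smul_eq_C_mul]
    ring
  have hcoeff : ∀ x : PS, ∀ j, coeff 0 (x * g ^ (j + 1)) = 0 := fun x j => by
    rw [coeff_zero_eq_constantCoeff_apply, map_mul, map_pow,
      ← coeff_zero_eq_constantCoeff_apply g, hg0]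
    simp
  have hP0 : coeff 0 (P - f * φ) = 0 := by
    rw [map_sub, hP, map_sum, Finset.sum_eq_zero fun i _ => hcoeff _ _,
      coeff_zero_eq_constantCoeff_apply, map_mul, ← coeff_zero_eq_constantCoeff_apply f,
      M.coeff_zero]
    simp
  have hfP : CDvd f P := by
    have := (M.cdvd_of_br_eq_zero (hPc.sub (M.conv.mul hφ)) hbr hP0).add ⟨φ, hφ, rfl⟩
    rwa [sub_add_cancel] at this
  obtain ⟨i₀, hi₀, hmin⟩ := WellFounded.has_min (wellFounded_lt (α := Fin L)) {i | a i ≠ 0}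
    (Function.ne_iff.1 ha)
  set U : PS := ∑ i, C (a i) * g ^ ((i : ℕ) - i₀) with hU
  have hUc : Conv U := Conv.sum fun i _ => (conv_C _).mul (hg.pow _)
  have hlt : ∀ i, i < i₀ → a i = 0 := fun i hi => by
    by_contra h
    exact hmin i h hi
  have hPU : P = g ^ (2 * N + i₀ + 1 + 1) * U := by
    rw [hP, hU, Finset.mul_sum]
    refine Finset.sum_congr rfl fun i _ => ?_
    rcases lt_or_ge i i₀ with h | h
    · rw [hlt i h]; simp
    · have h' : (i₀ : ℕ) ≤ i := h
      obtain ⟨j, hj⟩ := Nat.exists_eq_add_of_le h'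
      rw [hj, Nat.add_sub_cancel_left]; ring
  have hU0 : coeff 0 U ≠ 0 := by
    rw [hU, map_sum, Finset.sum_eq_single i₀]
    · simpa using hi₀
    · intro i _ hne
      rcases lt_or_gt_of_ne hne with h | h
      · rw [hlt i h]; simp
      · have h' : (i₀ : ℕ) < i := h
        rw [show (i : ℕ) - i₀ = (i - i₀ - 1) + 1 by omega]
        exact hcoeff _ _
    · simp
  obtain ⟨V, hV, hUV⟩ := hUc.exists_inv hU0
  refine M.cdvd_of_pow hg (j := 2 * N + i₀ + 1) ?_
  have := hfP.mul_left hV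
  rwa [hPU, mul_left_comm, mul_comm V, hUV, mul_one] at this

lemma Top_injective (M : Milnor f b) {v : Sq μ} (hv : Gev v) (h : Top D.A v = 0) : v = 0 := by
  obtain ⟨α, hα, rfl⟩ := D.exists_Psi_eq M hv
  rw [← D.Psi_f_mul M hα] at h
  exact D.Psi_of_cob M (cob_of_cob_mul M hα (D.cob_of_Psi_eq_zero M (Coc.mul M hα) h))

end Division

end

section Germs

lemma germ_ext {u v : Og E} (h : Og.rep u =ᶠ[𝓝 0] Og.rep v) : u = v :=
  Subtype.ext (by rw [(Og.rep_spec u).2, (Og.rep_spec v).2]; exact Germ.coe_eq.2 h)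

lemma rep_of_eq {u : Og E} {g : E → ℂ} (h : u.1 = ↑g) : Og.rep u =ᶠ[𝓝 0] g :=
  Germ.coe_eq.1 ((Og.rep_spec u).2.symm.trans h)

lemma rep_mk {g : E → ℂ} (h : AnalyticAt ℂ g 0) : Og.rep (Og.mk g) =ᶠ[𝓝 0] g :=
  rep_of_eq (by rw [Og.mk, dif_pos h])

lemma rep_const (c : ℂ) : Og.rep (Og.const c : Og E) =ᶠ[𝓝 0] fun _ => c :=
  rep_mk analyticAt_const

lemma rep_add (u v : Og E) : Og.rep (u + v) =ᶠ[𝓝 0] fun z => Og.rep u z + Og.rep v z :=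
  rep_of_eq (by
    change u.1 + v.1 = _
    rw [(Og.rep_spec u).2, (Og.rep_spec v).2]; rfl)

lemma rep_mul (u v : Og E) : Og.rep (u * v) =ᶠ[𝓝 0] fun z => Og.rep u z * Og.rep v z :=
  rep_of_eq (by
    change u.1 * v.1 = _
    rw [(Og.rep_spec u).2, (Og.rep_spec v).2]; rfl)

lemma rep_sub (u v : Og E) : Og.rep (u - v) =ᶠ[𝓝 0] fun z => Og.rep u z - Og.rep v z :=
  rep_of_eq (by
    change u.1 - v.1 = _
    rw [(Og.rep_spec u).2, (Og.rep_spec v).2]; rfl)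

lemma rep_zero : Og.rep (0 : Og E) =ᶠ[𝓝 0] fun _ => 0 :=
  rep_of_eq rfl

lemma rep_pd (v : E) (u : Og E) : Og.rep (Og.pd v u) =ᶠ[𝓝 0] fun z => fderiv ℂ (Og.rep u) z v :=
  rep_of_eq rfl

lemma eventually_differentiableAt (u : Og E) : ∀ᶠ z in 𝓝 (0 : E), DifferentiableAt ℂ (Og.rep u) z :=
  (Og.rep_spec u).1.eventually_analyticAt.mono fun _ h => h.differentiableAt

lemma rep_pd_of_eq (v : E) {u : Og E} {g : E → ℂ} (h : Og.rep u =ᶠ[𝓝 0] g) :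
    Og.rep (Og.pd v u) =ᶠ[𝓝 0] fun z => fderiv ℂ g z v := by
  filter_upwards [rep_pd v u, h.fderiv (𝕜 := ℂ)] with z h1 h2
  rw [h1, h2]

lemma ev0_of_eq {u : Og E} {g : E → ℂ} (h : Og.rep u =ᶠ[𝓝 0] g) : Og.ev0 u = g 0 :=
  h.self_of_nhds

lemma ev0_add (u v : Og E) : Og.ev0 (u + v) = Og.ev0 u + Og.ev0 v := ev0_of_eq (rep_add u v)

lemma ev0_mul (u v : Og E) : Og.ev0 (u * v) = Og.ev0 u * Og.ev0 v := ev0_of_eq (rep_mul u v)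

lemma ev0_const (c : ℂ) : Og.ev0 (Og.const c : Og E) = c := ev0_of_eq (rep_const c)

lemma const_zero : (Og.const 0 : Og E) = 0 := Subtype.ext (by
  rw [Og.const, Og.mk, dif_pos analyticAt_const]; rfl)

lemma pd_add (v : E) (u w : Og E) : Og.pd v (u + w) = Og.pd v u + Og.pd v w := by
  refine germ_ext ?_
  filter_upwards [rep_pd_of_eq v (rep_add u w), rep_pd v u, rep_pd v w,
    rep_add (Og.pd v u) (Og.pd v w), eventually_differentiableAt u,
    eventually_differentiableAt w] with z h1 h2 h3 h4 h5 h6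
  rw [h1, h4, h2, h3, fderiv_fun_add h5 h6]; rfl

lemma pd_mul (v : E) (u w : Og E) : Og.pd v (u * w) = Og.pd v u * w + u * Og.pd v w := by
  refine germ_ext ?_
  filter_upwards [rep_pd_of_eq v (rep_mul u w), rep_pd v u, rep_pd v w,
    rep_add (Og.pd v u * w) (u * Og.pd v w), rep_mul (Og.pd v u) w, rep_mul u (Og.pd v w),
    eventually_differentiableAt u, eventually_differentiableAt w] with z h1 h2 h3 h4 h5 h6 h7 h8
  rw [h1, h4, h5, h6, h2, h3, fderiv_fun_mul h7 h8]
  simp only [add_apply, smul_apply, smul_eq_mul]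
  ring

lemma pd_const (v : E) (c : ℂ) : Og.pd v (Og.const c : Og E) = 0 := by
  refine germ_ext ?_
  filter_upwards [rep_pd_of_eq v (rep_const (E := E) c), rep_zero (E := E)] with z h1 h2
  rw [h1, h2]; simp

lemma pd_vadd (v w : E) (u : Og E) : Og.pd (v + w) u = Og.pd v u + Og.pd w u := by
  refine germ_ext ?_
  filter_upwards [rep_pd (v + w) u, rep_pd v u, rep_pd w u,
    rep_add (Og.pd v u) (Og.pd w u)] with z h1 h2 h3 h4
  rw [h1, h4, h2, h3, map_add]

lemma pd_vsmul (c : ℂ) (v : E) (u : Og E) : Og.pd (c • v) u = Og.const c * Og.pd v u := by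
  refine germ_ext ?_
  filter_upwards [rep_pd (c • v) u, rep_pd v u, rep_const (E := E) c,
    rep_mul (Og.const c) (Og.pd v u)] with z h1 h2 h3 h4
  rw [h1, h4, h2, h3, map_smul, smul_eq_mul]

/-- Iterated directional derivatives of a germ. -/
noncomputable def ipd (u : Og E) : (n : ℕ) → (Fin n → E) → Og E
  | 0, _ => u
  | n + 1, m => Og.pd (m 0) (ipd u n (Fin.tail m))

lemma rep_ipd (u : Og E) : ∀ (n : ℕ) (m : Fin n → E),
    Og.rep (ipd u n m) =ᶠ[𝓝 0] fun z => iteratedFDeriv ℂ n (Og.rep u) z m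
  | 0, m => by simp [ipd]
  | n + 1, m => by
    filter_upwards [rep_pd_of_eq (m 0) (rep_ipd u n (Fin.tail m)),
      (Og.rep_spec u).1.eventually_analyticAt] with z h1 h2
    rw [ipd, h1, iteratedFDeriv_succ_apply_left]
    have h3 : DifferentiableAt ℂ (iteratedFDeriv ℂ n (Og.rep u)) z :=
      (h2.contDiffAt (n := ⊤)).differentiableAt_iteratedFDeriv (WithTop.coe_lt_top _)
    have h4 := ((ContinuousMultilinearMap.apply ℂ (fun _ : Fin n => E) ℂ
      (Fin.tail m)).hasFDerivAt (x := iteratedFDeriv ℂ n (Og.rep u) z)).comp z h3.hasFDerivAt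
    exact congrArg (fun l => l (m 0)) h4.fderiv

lemma pd_comm (v w : E) (u : Og E) : Og.pd v (Og.pd w u) = Og.pd w (Og.pd v u) := by
  refine germ_ext ?_
  filter_upwards [rep_ipd u 2 ![v, w], rep_ipd u 2 ![w, v],
    (Og.rep_spec u).1.eventually_analyticAt] with z h1 h2 h3
  have h4 := (h3.contDiffAt (n := ⊤)).isSymmSndFDerivAt (by simp)
  have h5 := h4.eq v w
  simp only [ipd, Fin.tail, Matrix.cons_val_zero, Matrix.cons_val_succ] at h1 h2
  rw [h1, h2, iteratedFDeriv_two_apply, iteratedFDeriv_two_apply]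
  simpa using h5

end Germs

/-- The standard basis of `ℂ × ℂ`. -/
def bvec : Fin 2 → ℂ × ℂ := ![(1, 0), (0, 1)]

lemma norm_bvec (i : Fin 2) : ‖bvec i‖ = 1 := by
  fin_cases i <;> simp [bvec, Prod.norm_def]

/-- Iterated partial derivatives of a germ in two variables. -/
noncomputable def mpd (i j : ℕ) (u : Og (ℂ × ℂ)) : Og (ℂ × ℂ) :=
  (Og.pd (bvec 0))^[i] ((Og.pd (bvec 1))^[j] u)

/-- The Taylor series at the origin of a germ in two variables. -/
noncomputable def tay (u : Og (ℂ × ℂ)) : PS :=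
  ofCoeff fun n => Og.ev0 (mpd (n 0) (n 1) u) / ((n 0).factorial * (n 1).factorial)

lemma coeff_tay (u : Og (ℂ × ℂ)) (n : Ex) :
    coeff n (tay u) = Og.ev0 (mpd (n 0) (n 1) u) / ((n 0).factorial * (n 1).factorial) := rfl

lemma iterate_pd_add (v : ℂ × ℂ) (u w : Og (ℂ × ℂ)) :
    ∀ k, (Og.pd v)^[k] (u + w) = (Og.pd v)^[k] u + (Og.pd v)^[k] w
  | 0 => rfl
  | k + 1 => by simp only [Function.iterate_succ_apply', iterate_pd_add v u w k, pd_add]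

lemma tay_add (u w : Og (ℂ × ℂ)) : tay (u + w) = tay u + tay w := by
  ext n
  rw [map_add, coeff_tay, coeff_tay, coeff_tay, mpd, iterate_pd_add, iterate_pd_add, ev0_add,
    add_div, mpd, mpd]

lemma tay_pd (i : Fin 2) (u : Og (ℂ × ℂ)) : tay (Og.pd (bvec i) u) = pderiv ℂ i (tay u) := by
  ext n
  have hc : Function.Commute (Og.pd (bvec 0)) (Og.pd (bvec 1)) := fun u => pd_comm _ _ u
  rw [coeff_pderiv, coeff_tay, coeff_tay]
  have h0 := Nat.cast_add_one_ne_zero (R := ℂ) (n i)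
  have h1 : ((n 0).factorial : ℂ) ≠ 0 := Nat.cast_ne_zero.2 (Nat.factorial_ne_zero _)
  have h2 : ((n 1).factorial : ℂ) ≠ 0 := Nat.cast_ne_zero.2 (Nat.factorial_ne_zero _)
  fin_cases i
  · have : mpd (n 0) (n 1) (Og.pd (bvec 0) u) = mpd (n 0 + 1) (n 1) u := by
      rw [mpd, mpd, Function.iterate_succ_apply, (hc.iterate_right (n 1)).eq]
    simp only [Fin.zero_eta, Finsupp.add_apply, Finsupp.single_eq_same, this]
    simp only [Fin.zero_eta] at h0
    simp [Nat.factorial_succ]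
    field_simp
  · have : mpd (n 0) (n 1) (Og.pd (bvec 1) u) = mpd (n 0) (n 1 + 1) u := by
      rw [mpd, mpd, Function.iterate_succ_apply]
    simp only [Fin.mk_one, Finsupp.add_apply, Finsupp.single_eq_same, this]
    simp only [Fin.mk_one] at h0
    simp [Nat.factorial_succ]
    field_simp

lemma coeff_zero_tay (u : Og (ℂ × ℂ)) : coeff 0 (tay u) = Og.ev0 u := by
  rw [coeff_tay]; simp [mpd]

lemma exists_eq_add_single {n : Ex} {d : ℕ} (h : deg n = d + 1) :
    ∃ m i, n = m + Finsupp.single i 1 ∧ deg m = d := by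
  have : ∃ i, 1 ≤ n i := by
    by_contra hn
    push Not at hn
    have h0 := hn 0
    have h1 := hn 1
    rw [deg] at h; omega
  obtain ⟨i, hi⟩ := this
  have hle : Finsupp.single i 1 ≤ n := by simpa using hi
  refine ⟨n - Finsupp.single i 1, i, (tsub_add_cancel_of_le hle).symm, ?_⟩
  have h2 := deg_add (n - Finsupp.single i 1) (Finsupp.single i 1)
  rw [tsub_add_cancel_of_le hle, h] at h2
  have h3 : deg (Finsupp.single i 1) = 1 := by fin_cases i <;> simp [deg]
  omega

lemma tay_zero : tay 0 = 0 := by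
  have := tay_add 0 0
  rwa [add_zero, left_eq_add] at this

lemma tay_sub (u w : Og (ℂ × ℂ)) : tay (u - w) = tay u - tay w :=
  eq_sub_of_add_eq (by rw [← tay_add, sub_add_cancel])

lemma tay_sum {ι : Type*} (s : Finset ι) (u : ι → Og (ℂ × ℂ)) :
    tay (∑ i ∈ s, u i) = ∑ i ∈ s, tay (u i) := by
  induction s using Finset.induction_on with
  | empty => simp [tay_zero]
  | insert i s h ih => rw [Finset.sum_insert h, Finset.sum_insert h, tay_add, ih]

lemma tay_const (c : ℂ) : tay (Og.const c) = C c := by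
  refine pderiv.ext (fun i => ?_) ?_
  · rw [← tay_pd, pd_const, tay_zero, pderiv_C]
  · rw [← coeff_zero_eq_constantCoeff_apply, coeff_zero_tay, ev0_const, constantCoeff_C]

lemma tay_mul (u w : Og (ℂ × ℂ)) : tay (u * w) = tay u * tay w := by
  suffices H : ∀ d, ∀ u w : Og (ℂ × ℂ), ∀ n, deg n = d →
      coeff n (tay (u * w)) = coeff n (tay u * tay w) from ext fun n => H _ u w n rfl
  intro d
  induction d with
  | zero =>
    intro u w n hn
    obtain rfl : n = 0 := by ext i; fin_cases i <;> simp [deg] at hn ⊢ <;> omega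
    rw [coeff_zero_tay, ev0_mul, coeff_zero_eq_constantCoeff_apply, map_mul,
      ← coeff_zero_eq_constantCoeff_apply, ← coeff_zero_eq_constantCoeff_apply, coeff_zero_tay,
      coeff_zero_tay]
  | succ d ih =>
    intro u w n hn
    obtain ⟨m, i, rfl, hm⟩ := exists_eq_add_single hn
    have h0 := Nat.cast_add_one_ne_zero (R := ℂ) (m i)
    apply mul_right_cancel₀ h0
    rw [← coeff_pderiv, ← coeff_pderiv, ← tay_pd, pd_mul, tay_add, map_add, ih _ _ _ hm,
      ih _ _ _ hm, Derivation.leibniz, tay_pd, tay_pd, map_add, smul_eq_mul, smul_eq_mul]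
    ring_nf

lemma symm_finTwoArrow_eq_ex (p : ℕ × ℕ) : (finTwoArrowEquiv' ℕ).symm p = ex p := by
  ext i; fin_cases i <;> simp

lemma nrm_eq_tsum (ρ σ : ℝ≥0) (a : PS) :
    nrm ρ σ a = ∑' p : ℕ × ℕ, ((‖coeff (ex p) a‖₊ * (ρ ^ p.1 * σ ^ p.2) : ℝ≥0) : ℝ≥0∞) := by
  rw [nrm, ← (finTwoArrowEquiv' ℕ).symm.tsum_eq]
  refine tsum_congr fun p => ?_
  rw [symm_finTwoArrow_eq_ex, mon, ex_zero, ex_one]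

lemma coeff_iterate_pderiv (i : Fin 2) (a : PS) : ∀ (k : ℕ) (n : Ex),
    coeff n ((pderiv ℂ i)^[k] a) * (n i).factorial
      = (n i + k).factorial * coeff (n + Finsupp.single i k) a
  | 0, n => by simp [mul_comm]
  | k + 1, n => by
    have h := coeff_iterate_pderiv i a k (n + Finsupp.single i 1)
    rw [Finsupp.add_apply, Finsupp.single_eq_same, add_assoc n, ← Finsupp.single_add,
      Nat.factorial_succ, add_right_comm, add_comm 1 k] at h
    rw [Function.iterate_succ_apply', coeff_pderiv, ← add_assoc (n i) k 1, ← h]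
    push_cast; ring

lemma coeff_zero_iterate_pderiv (a : PS) (p : ℕ × ℕ) :
    coeff 0 ((pderiv ℂ 0)^[p.1] ((pderiv ℂ 1)^[p.2] a))
      = p.1.factorial * p.2.factorial * coeff (ex p) a := by
  have h1 := coeff_iterate_pderiv 0 ((pderiv ℂ 1)^[p.2] a) p.1 0
  have h2 := coeff_iterate_pderiv 1 a p.2 (Finsupp.single 0 p.1)
  rw [← ex] at h2
  simp only [zero_add, Finsupp.coe_zero, Pi.zero_apply, Nat.factorial_zero, Nat.cast_one,
    mul_one] at h1
  have h3 : (Finsupp.single 0 p.1 : Ex) 1 = 0 := by simp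
  rw [h3] at h2
  simp only [zero_add, Nat.factorial_zero, Nat.cast_one, mul_one] at h2
  rw [h1, h2]; ring

/-- The homogeneous part of degree `k` of a power series, as a function. -/
noncomputable def hpart (a : PS) (k : ℕ) (z : ℂ × ℂ) : ℂ :=
  ∑ p ∈ Finset.HasAntidiagonal.antidiagonal k, coeff (ex p) a * (z.1 ^ p.1 * z.2 ^ p.2)

/-- The directional derivative of a power series along a vector. -/
noncomputable def dirD (z : ℂ × ℂ) : Module.End ℂ PS :=
  z.1 • (pderiv ℂ 0).toLinearMap + z.2 • (pderiv ℂ 1).toLinearMap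

lemma tay_pd_dir (z : ℂ × ℂ) (u : Og (ℂ × ℂ)) : tay (Og.pd z u) = dirD z (tay u) := by
  have : z = z.1 • bvec 0 + z.2 • bvec 1 := by ext <;> simp [bvec]
  conv_lhs => rw [this]
  rw [pd_vadd, pd_vsmul, pd_vsmul, tay_add, tay_mul, tay_mul, tay_const, tay_const, tay_pd, tay_pd,
    ← smul_eq_C_mul, ← smul_eq_C_mul]
  rfl

lemma tay_ipd_const (z : ℂ × ℂ) (u : Og (ℂ × ℂ)) :
    ∀ k, tay (ipd u k fun _ => z) = (dirD z ^ k) (tay u)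
  | 0 => rfl
  | k + 1 => by
    rw [ipd, tay_pd_dir, pow_succ', Module.End.mul_apply, ← tay_ipd_const z u k]
    rfl

lemma coeff_zero_dirD_pow (z : ℂ × ℂ) (a : PS) (k : ℕ) :
    coeff 0 ((dirD z ^ k) a) = k.factorial * hpart a k z := by
  have hc : Commute (z.1 • (pderiv ℂ (0 : Fin 2)).toLinearMap : Module.End ℂ PS)
      (z.2 • (pderiv ℂ 1).toLinearMap) := by
    refine Commute.smul_left (Commute.smul_right ?_ _) _
    exact LinearMap.ext fun a => Dx_Dy_comm a
  rw [dirD, hc.add_pow', LinearMap.sum_apply, map_sum, hpart, Finset.mul_sum]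
  refine Finset.sum_congr rfl fun p hp => ?_
  have hk := Finset.HasAntidiagonal.mem_antidiagonal.1 hp
  rw [smul_pow, smul_pow, smul_mul_smul_comm, LinearMap.smul_apply, LinearMap.smul_apply,
    map_nsmul, coeff_smul, Module.End.mul_apply, Module.End.pow_apply, Module.End.pow_apply]
  have h1 := coeff_zero_iterate_pderiv a p
  have h2 : (k.choose p.1 * p.1.factorial * p.2.factorial : ℂ) = k.factorial := by
    rw [← hk, Nat.choose_symm_add]; exact_mod_cast Nat.add_choose_mul_factorial_mul_factorial p.1 p.2
  erw [h1]
  rw [← h2, nsmul_eq_mul]; ring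

/-- The homogeneous parts of the power series of a germ are given by its Taylor coefficients. -/
lemma series_apply_eq_hpart {u : Og (ℂ × ℂ)} {p : FormalMultilinearSeries ℂ (ℂ × ℂ) ℂ} {r : ℝ≥0∞}
    (h : HasFPowerSeriesOnBall (Og.rep u) p 0 r) (k : ℕ) (z : ℂ × ℂ) :
    p k (fun _ => z) = hpart (tay u) k z := by
  have h1 := h.factorial_smul z k
  have h2 : Og.ev0 (ipd u k fun _ => z) = iteratedFDeriv ℂ k (Og.rep u) 0 fun _ => z :=
    (rep_ipd u k fun _ => z).self_of_nhds
  rw [← h2, ← coeff_zero_tay, tay_ipd_const, coeff_zero_dirD_pow, nsmul_eq_mul] at h1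
  exact mul_left_cancel₀ (Nat.cast_ne_zero.2 k.factorial_ne_zero) h1

lemma tay_eq_zero {u : Og (ℂ × ℂ)} (h : tay u = 0) : u = 0 := by
  obtain ⟨p, r, hp⟩ := (Og.rep_spec u).1
  refine germ_ext ?_
  filter_upwards [hp.eventually_hasSum, rep_zero (E := ℂ × ℂ)] with z hz h0
  rw [h0]
  have h1 : ∀ k, p k (fun _ => z) = 0 := fun k => by
    rw [series_apply_eq_hpart hp, h, hpart]; simp
  simp only [h1, zero_add] at hz
  exact hz.unique hasSum_zero

lemma tay_injective : Function.Injective tay := fun u w h =>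
  sub_eq_zero.1 (tay_eq_zero (by rw [tay_sub, h, sub_self]))

lemma exists_ipd_eq_mpd (u : Og (ℂ × ℂ)) (i j : ℕ) :
    ∃ m : Fin (i + j) → ℂ × ℂ, (∀ l, ‖m l‖ = 1) ∧ mpd i j u = ipd u (i + j) m := by
  have key : ∀ (s : Fin 2) (w : Og (ℂ × ℂ)) (k : ℕ),
      (∃ m : Fin k → ℂ × ℂ, (∀ l, ‖m l‖ = 1) ∧ w = ipd u k m) →
      ∃ m : Fin (k + 1) → ℂ × ℂ, (∀ l, ‖m l‖ = 1) ∧ Og.pd (bvec s) w = ipd u (k + 1) m := by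
    rintro s w k ⟨m, hm, rfl⟩
    refine ⟨Fin.cons (bvec s) m, fun l => ?_, by rw [ipd, Fin.cons_zero, Fin.tail_cons]⟩
    refine Fin.cases ?_ (fun l => ?_) l
    · rw [Fin.cons_zero, norm_bvec]
    · rw [Fin.cons_succ, hm]
  induction i with
  | zero =>
    rw [zero_add]
    induction j with
    | zero => exact ⟨Fin.elim0, fun l => l.elim0, rfl⟩
    | succ j ih =>
      have := key 1 _ _ ih
      rwa [mpd, Function.iterate_zero, id, ← Function.iterate_succ_apply' (Og.pd (bvec 1))] at this
  | succ i ih =>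
    rw [Nat.add_right_comm]
    have := key 0 _ _ ih
    rwa [mpd, ← Function.iterate_succ_apply' (Og.pd (bvec 0))] at this

lemma conv_tay (u : Og (ℂ × ℂ)) : Conv (tay u) := by
  obtain ⟨p, r, hp⟩ := (Og.rep_spec u).1
  obtain ⟨s, hs0, hs⟩ := ENNReal.lt_iff_exists_nnreal_btwn.1 (hp.r_pos.trans_le hp.r_le)
  rw [ENNReal.coe_pos] at hs0
  obtain ⟨B, hB0, hB⟩ := p.nnnorm_mul_pow_le_of_lt_radius hs
  have hco : ∀ q : ℕ × ℕ, ‖coeff (ex q) (tay u)‖₊ * ((s / 4) ^ q.1 * (s / 4) ^ q.2)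
      ≤ B * ((1 / 2) ^ q.1 * (1 / 2) ^ q.2) := by
    intro q
    set k := q.1 + q.2 with hk
    obtain ⟨m, hm, he⟩ := exists_ipd_eq_mpd u q.1 q.2
    have h1 : ‖Og.ev0 (mpd q.1 q.2 u)‖₊ ≤ k.factorial * ‖p k‖₊ := by
      have h0 : Og.ev0 (ipd u k m) = iteratedFDeriv ℂ k (Og.rep u) 0 m :=
        (rep_ipd u k m).self_of_nhds
      rw [he, h0, hp.iteratedFDeriv_eq_sum_of_completeSpace]
      refine (nnnorm_sum_le _ _).trans ?_
      refine (Finset.sum_le_card_nsmul _ _ ‖p k‖₊ fun σ _ => ?_).trans ?_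
      · refine ((p k).le_opNNNorm _).trans ?_
        have : ∀ l, ‖m l‖₊ = 1 := fun l => by ext; exact hm l
        simp [this]
      · simp [Fintype.card_perm]
    have h2 : (k.factorial : ℝ≥0) ≤ 2 ^ k * (q.1.factorial * q.2.factorial) := by
      have h3 := Nat.add_choose_mul_factorial_mul_factorial q.1 q.2
      have h4 : (q.1 + q.2).choose q.2 ≤ 2 ^ (q.1 + q.2) := Nat.choose_le_two_pow _ _
      rw [hk, ← h3]
      rw [mul_assoc]
      push_cast
      gcongr
      exact_mod_cast h4
    have h5 : ‖coeff (ex q) (tay u)‖₊ ≤ 2 ^ k * ‖p k‖₊ := by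
      rw [coeff_tay, ex_zero, ex_one, nnnorm_div]
      refine div_le_of_le_mul₀ (by positivity) (by positivity) (h1.trans ?_)
      rw [nnnorm_mul, Complex.nnnorm_natCast, Complex.nnnorm_natCast]
      calc (k.factorial : ℝ≥0) * ‖p k‖₊
          ≤ 2 ^ k * (q.1.factorial * q.2.factorial) * ‖p k‖₊ := by gcongr
        _ = _ := by ring
    calc ‖coeff (ex q) (tay u)‖₊ * ((s / 4) ^ q.1 * (s / 4) ^ q.2)
        ≤ 2 ^ k * ‖p k‖₊ * (s / 4) ^ k := by rw [hk, pow_add (s / 4)]; gcongr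
      _ = ‖p k‖₊ * s ^ k * (1 / 2) ^ k := by
          rw [show s / 4 = s * (1 / 2) * (1 / 2) by ring_nf, mul_pow, mul_pow]
          have : (2 : ℝ≥0) ^ k * (1 / 2) ^ k = 1 := by rw [← mul_pow]; simp
          linear_combination ‖p k‖₊ * s ^ k * (1 / 2) ^ k * this
      _ ≤ B * (1 / 2) ^ k := by gcongr; exact hB k
      _ = _ := by rw [hk, pow_add]
  refine ⟨s / 4, by positivity, ?_⟩
  rw [nrm_eq_tsum]
  refine (ENNReal.tsum_le_tsum fun q => ENNReal.coe_le_coe.2 (hco q)).trans_lt ?_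
  have hg : ∑' i : ℕ, (((1 / 2) ^ i : ℝ≥0) : ℝ≥0∞) < ∞ :=
    (ENNReal.tsum_coe_ne_top_iff_summable.2 (NNReal.summable_geometric (by norm_num))).lt_top
  simp only [ENNReal.coe_mul, ENNReal.tsum_mul_left, ENNReal.tsum_prod', ENNReal.tsum_mul_right]
  exact ENNReal.mul_lt_top ENNReal.coe_lt_top (ENNReal.mul_lt_top hg hg)

/-- The formal multilinear series attached to a power series. -/
noncomputable def mseries (a : PS) : FormalMultilinearSeries ℂ (ℂ × ℂ) ℂ := fun k =>
  ∑ p ∈ Finset.HasAntidiagonal.antidiagonal k, coeff (ex p) a •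
    (ContinuousMultilinearMap.mkPiAlgebra ℂ (Fin k) ℂ).compContinuousLinearMap fun l =>
      if (l : ℕ) < p.1 then ContinuousLinearMap.fst ℂ ℂ ℂ else ContinuousLinearMap.snd ℂ ℂ ℂ

lemma mseries_apply (a : PS) (k : ℕ) (z : ℂ × ℂ) :
    mseries a k (fun _ => z) = hpart a k z := by
  rw [mseries, hpart, sum_apply]
  refine Finset.sum_congr rfl fun p hp => ?_
  obtain ⟨i, j⟩ := p
  obtain rfl := Finset.HasAntidiagonal.mem_antidiagonal.1 hp
  simp only [smul_apply, smul_eq_mul,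
    ContinuousMultilinearMap.compContinuousLinearMap_apply,
    ContinuousMultilinearMap.mkPiAlgebra_apply]
  rw [Fin.prod_univ_add]
  simp

lemma nnnorm_mseries_le (a : PS) (k : ℕ) :
    ‖mseries a k‖₊ ≤ ∑ p ∈ Finset.HasAntidiagonal.antidiagonal k, ‖coeff (ex p) a‖₊ := by
  refine nnnorm_sum_le_of_le _ fun p _ => ?_
  rw [nnnorm_smul]
  refine mul_le_of_le_one_right zero_le ?_
  have h := ContinuousMultilinearMap.norm_compContinuousLinearMap_le
    (ContinuousMultilinearMap.mkPiAlgebra ℂ (Fin k) ℂ) (fun l : Fin k =>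
      if (l : ℕ) < p.1 then ContinuousLinearMap.fst ℂ ℂ ℂ else ContinuousLinearMap.snd ℂ ℂ ℂ)
  refine h.trans ?_
  rw [ContinuousMultilinearMap.norm_mkPiAlgebra, one_mul]
  refine Finset.prod_le_one (fun _ _ => norm_nonneg _) fun l _ => ?_
  split_ifs
  · exact ContinuousLinearMap.norm_fst_le ..
  · exact ContinuousLinearMap.norm_snd_le ..

lemma radius_mseries_pos {a : PS} (ha : Conv a) : 0 < (mseries a).radius := by
  obtain ⟨r, hr, h⟩ := ha
  refine (ENNReal.coe_pos.2 hr).trans_le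
    ((mseries a).le_radius_of_bound_nnreal (nrm r r a).toNNReal fun k => ?_)
  rw [← ENNReal.coe_le_coe, ENNReal.coe_toNNReal h.ne, nrm_eq_tsum]
  refine le_trans ?_ (ENNReal.sum_le_tsum (Finset.HasAntidiagonal.antidiagonal k))
  rw [← ENNReal.ofNNReal_finsetSum, ENNReal.coe_le_coe]
  refine (mul_le_mul_left (nnnorm_mseries_le a k) _).trans ?_
  rw [Finset.sum_mul]
  refine Finset.sum_le_sum fun p hp => ?_
  rw [← pow_add, Finset.HasAntidiagonal.mem_antidiagonal.1 hp]

lemma eq_of_hpart_eq {a b : PS} (h : ∀ k z, hpart a k z = hpart b k z) : a = b := by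
  ext n
  obtain ⟨q, rfl⟩ := (finTwoArrowEquiv' ℕ).symm.surjective n
  set k := q.1 + q.2 with hk
  let P : PS → Polynomial ℂ := fun a => ∑ i ∈ Finset.range (k + 1),
    Polynomial.monomial i (coeff (ex (i, k - i)) a)
  have hP : ∀ a x, (P a).eval x = hpart a k (x, 1) := fun a x => by
    simp only [P, hpart, Polynomial.eval_finsetSum, Polynomial.eval_monomial]
    rw [Finset.Nat.sum_antidiagonal_eq_sum_range_succ
      fun i j => coeff (ex (i, j)) a * (x ^ i * 1 ^ j)]
    simp
  have h1 : P a = P b := Polynomial.funext fun x => by rw [hP, hP, h]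
  have h2 : ∀ a, (P a).coeff q.1 = coeff (ex q) a := fun a => by
    simp only [P, Polynomial.finsetSum_coeff, Polynomial.coeff_monomial]
    rw [Finset.sum_ite_eq' , if_pos (Finset.mem_range.2 (by omega)), hk, Nat.add_sub_cancel_left]
  rw [symm_finTwoArrow_eq_ex, ← h2, ← h2, h1]

lemma exists_tay_eq {a : PS} (ha : Conv a) : ∃ u, tay u = a := by
  have h := (mseries a).hasFPowerSeriesOnBall (radius_mseries_pos ha)
  have hu := rep_mk h.analyticAt
  obtain ⟨r, h'⟩ := h.hasFPowerSeriesAt.congr hu.symm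
  exact ⟨_, eq_of_hpart_eq fun k z => by rw [← series_apply_eq_hpart h', mseries_apply]⟩

section Composition

/-- The coordinate germ on `ℂ`. -/
noncomputable def tvar : Og ℂ := Og.mk id

lemma rep_tvar : Og.rep tvar =ᶠ[𝓝 0] id := rep_mk analyticAt_id

lemma tendsto_rep {f : Og E} (hf : Og.ev0 f = 0) : Tendsto (Og.rep f) (𝓝 0) (𝓝 0) := by
  have h := (Og.rep_spec f).1.continuousAt.tendsto
  rwa [show Og.rep f 0 = 0 from hf] at h

lemma rep_comp {f : Og E} (hf : Og.ev0 f = 0) (c : Og ℂ) :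
    Og.rep (Og.comp c f) =ᶠ[𝓝 0] fun z => Og.rep c (Og.rep f z) :=
  rep_of_eq (by rw [Og.comp, dif_pos hf])

lemma comp_sub {f : Og E} (hf : Og.ev0 f = 0) (c d : Og ℂ) :
    Og.comp (c - d) f = Og.comp c f - Og.comp d f := by
  refine germ_ext ?_
  filter_upwards [rep_comp hf (c - d), rep_comp hf c, rep_comp hf d,
    rep_sub (Og.comp c f) (Og.comp d f),
    (tendsto_rep hf).eventually (rep_sub c d)] with z h1 h2 h3 h4 h5
  rw [h1, h4, h2, h3, h5]

lemma comp_const_add_tvar_mul {f : Og E} (hf : Og.ev0 f = 0) (a : ℂ) (d : Og ℂ) :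
    Og.comp (Og.const a + tvar * d) f = Og.const a + f * Og.comp d f := by
  refine germ_ext ?_
  filter_upwards [rep_comp hf (Og.const a + tvar * d), rep_comp hf d,
    rep_add (Og.const a) (f * Og.comp d f), rep_mul f (Og.comp d f), rep_const (E := E) a,
    (tendsto_rep hf).eventually (rep_add (Og.const a) (tvar * d)),
    (tendsto_rep hf).eventually (rep_mul tvar d),
    (tendsto_rep hf).eventually (rep_const (E := ℂ) a),
    (tendsto_rep hf).eventually rep_tvar] with z h1 h2 h3 h4 h5 h6 h7 h8 h9
  rw [h1, h3, h4, h2, h5, h6, h7, h8, h9, id]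

lemma pd_comp {f : Og E} (hf : Og.ev0 f = 0) (c : Og ℂ) (v : E) :
    Og.pd v (Og.comp c f) = Og.comp (Og.pd 1 c) f * Og.pd v f := by
  refine germ_ext ?_
  filter_upwards [rep_pd_of_eq v (rep_comp hf c), rep_comp hf (Og.pd 1 c), rep_pd v f,
    rep_mul (Og.comp (Og.pd 1 c) f) (Og.pd v f), (tendsto_rep hf).eventually (rep_pd 1 c),
    (tendsto_rep hf).eventually (eventually_differentiableAt c),
    eventually_differentiableAt f] with z h1 h2 h3 h4 h5 h6 h7
  have h8 := (h6.hasFDerivAt.comp z h7.hasFDerivAt).fderiv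
  rw [h1, h4, h2, h3, h5]
  change fderiv ℂ (Og.rep c ∘ Og.rep f) z v = _
  rw [h8, ContinuousLinearMap.comp_apply]
  conv_lhs => rw [← mul_one (fderiv ℂ (Og.rep f) z v), ← smul_eq_mul, map_smul]
  rw [smul_eq_mul, mul_comm]

lemma exists_eq_const_add (c : Og ℂ) : ∃ d, c = Og.const (Og.ev0 c) + tvar * d := by
  obtain ⟨p, hp⟩ := (Og.rep_spec c).1
  have h := hp.has_fpower_series_dslope_fslope.analyticAt
  refine ⟨Og.mk (dslope (Og.rep c) 0), germ_ext ?_⟩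
  filter_upwards [rep_add (Og.const (Og.ev0 c)) (tvar * Og.mk (dslope (Og.rep c) 0)),
    rep_mul tvar (Og.mk (dslope (Og.rep c) 0)), rep_const (E := ℂ) (Og.ev0 c), rep_tvar,
    rep_mk h] with z h1 h2 h3 h4 h5
  rw [h1, h2, h3, h4, h5]
  have := sub_smul_dslope (Og.rep c) 0 z
  rw [sub_zero, smul_eq_mul] at this
  rw [id, this, Og.ev0]; ring

lemma eq_zero_of_tvar_pow_dvd {c : Og ℂ} (h : ∀ n, ∃ d, c = tvar ^ n * d) : c = 0 := by
  have hp : ∀ (n : ℕ) (d : Og ℂ), Og.rep (tvar ^ n * d) =ᶠ[𝓝 0] fun z => z ^ n * Og.rep d z := by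
    intro n
    induction n with
    | zero => intro d; simp
    | succ n ih =>
      intro d
      rw [pow_succ, mul_assoc]
      filter_upwards [ih (tvar * d), rep_mul tvar d, rep_tvar] with z h1 h2 h3
      rw [h1, h2, h3, id]; ring
  have hc := (Og.rep_spec c).1
  have : analyticOrderAt (Og.rep c) 0 = ⊤ := by
    refine ENat.eq_top_iff_forall_ge.2 fun n => ?_
    obtain ⟨d, rfl⟩ := h n
    refine (natCast_le_analyticOrderAt hc).2 ⟨Og.rep d, (Og.rep_spec d).1, ?_⟩
    filter_upwards [hp n d] with z hz
    rw [hz, sub_zero, smul_eq_mul]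
  refine germ_ext ?_
  filter_upwards [analyticOrderAt_eq_top.1 this, rep_zero (E := ℂ)] with z h1 h2
  rw [h1, h2]

lemma exists_germ_of_geometric {c : ℕ → ℂ} {K : ℝ≥0} (h : ∀ n, ‖c n‖₊ ≤ K * K ^ n) :
    ∃ ψ : ℕ → Og ℂ, ∀ n, ψ n = Og.const (c n) + tvar * ψ (n + 1) := by
  set p : ℕ → FormalMultilinearSeries ℂ ℂ ℂ := fun n =>
    FormalMultilinearSeries.ofScalars ℂ fun k => c (n + k) with hp
  have hrad : ∀ n, 0 < (p n).radius := fun n => by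
    have hK : (0 : ℝ≥0) < (K + 1)⁻¹ := by positivity
    refine (ENNReal.coe_pos.2 hK).trans_le
      ((p n).le_radius_of_bound_nnreal (K * K ^ n) fun k => ?_)
    have h1 : ‖p n k‖₊ = ‖c (n + k)‖₊ := by
      ext; simp [hp]
    rw [h1]
    calc ‖c (n + k)‖₊ * (K + 1)⁻¹ ^ k ≤ K * K ^ (n + k) * (K + 1)⁻¹ ^ k := by gcongr; exact h _
      _ = K * K ^ n * (K * (K + 1)⁻¹) ^ k := by rw [mul_pow, pow_add]; ring
      _ ≤ K * K ^ n * 1 := by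
        gcongr
        refine pow_le_one₀ (by positivity) ?_
        rw [← div_eq_mul_inv]
        exact div_le_one_of_le₀ (by simp) (by positivity)
      _ = _ := mul_one _
  have hs : ∀ n, HasFPowerSeriesOnBall (p n).sum (p n) 0 (p n).radius := fun n =>
    (p n).hasFPowerSeriesOnBall (hrad n)
  refine ⟨fun n => Og.mk (p n).sum, fun n => germ_ext ?_⟩
  filter_upwards [rep_mk (hs n).analyticAt, rep_mk (hs (n + 1)).analyticAt,
    rep_add (Og.const (c n)) (tvar * Og.mk (p (n + 1)).sum), rep_const (E := ℂ) (c n),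
    rep_mul tvar (Og.mk (p (n + 1)).sum), rep_tvar, (hs n).eventually_hasSum,
    (hs (n + 1)).eventually_hasSum] with z h1 h2 h3 h4 h5 h6 h7 h8
  rw [h1, h3, h4, h5, h6, h2, id]
  have h9 : ∀ n k, p n k (fun _ => z) = c (n + k) * z ^ k := fun n k => by
    simp [hp, mul_comm]
  simp only [h9, zero_add] at h7 h8
  refine h7.unique ?_
  rw [← hasSum_nat_add_iff' 1]
  simp only [Finset.range_one, Finset.sum_singleton, add_zero, pow_zero, mul_one, add_sub_cancel_left]
  convert! h8.mul_left z using 2 with k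
  rw [add_assoc n 1 k, add_comm 1 k, pow_succ]; ring

end Composition

section Transfer
open Division

variable {μ : ℕ} {f : Og (ℂ × ℂ)}

lemma tay_dx (u : Og (ℂ × ℂ)) : tay (Og.dx u) = Dx (tay u) := tay_pd 0 u

lemma tay_dy (u : Og (ℂ × ℂ)) : tay (Og.dy u) = Dy (tay u) := tay_pd 1 u

lemma mem_jacobianSet_iff {x : Og (ℂ × ℂ)} : x ∈ jacobianSet f ↔ InJ (tay f) (tay x) := by
  constructor
  · rintro ⟨g, h, rfl⟩
    exact ⟨tay g, tay h, conv_tay g, conv_tay h, by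
      rw [tay_add, tay_mul, tay_mul, tay_dx, tay_dy]⟩
  · rintro ⟨g, h, hg, hh, hx⟩
    obtain ⟨g, rfl⟩ := exists_tay_eq hg
    obtain ⟨h, rfl⟩ := exists_tay_eq hh
    exact ⟨g, h, tay_injective (by rw [hx, tay_add, tay_mul, tay_mul, tay_dx, tay_dy])⟩

/-- The Taylor series of a pair of germs. -/
noncomputable def tayPair (u : Og (ℂ × ℂ) × Og (ℂ × ℂ)) : PS × PS := (tay u.1, tay u.2)

lemma exists_tayPair_eq {α : PS × PS} (h : Coc (tay f) α) : ∃ u, tayPair u = α := by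
  obtain ⟨a, ha⟩ := exists_tay_eq h.1
  obtain ⟨b, hb⟩ := exists_tay_eq h.2.1
  exact ⟨(a, b), Prod.ext ha hb⟩

lemma mem_deRhamCocycles_iff {u : Og (ℂ × ℂ) × Og (ℂ × ℂ)} :
    u ∈ deRhamCocycles f ↔ Coc (tay f) (tayPair u) := by
  rw [deRhamCocycles, Set.mem_ofPred_eq, mem_jacobianSet_iff, tay_sub, tay_dx, tay_dy]
  exact ⟨fun h => ⟨conv_tay _, conv_tay _, h⟩, fun h => h.2.2⟩

lemma mem_deRhamCoboundaries_iff {u : Og (ℂ × ℂ) × Og (ℂ × ℂ)} :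
    u ∈ deRhamCoboundaries f ↔ Cob (tay f) (tayPair u) := by
  constructor
  · rintro ⟨g, h, h1, h2⟩
    refine ⟨tay g, tay h, conv_tay g, conv_tay h, ?_, ?_⟩
    · rw [tayPair, h1, tay_add, tay_mul, tay_dx, tay_dx]
    · rw [tayPair, h2, tay_add, tay_mul, tay_dy, tay_dy]
  · rintro ⟨g, h, hg, hh, h1, h2⟩
    obtain ⟨g, rfl⟩ := exists_tay_eq hg
    obtain ⟨h, rfl⟩ := exists_tay_eq hh
    refine ⟨g, h, tay_injective (h1.trans ?_), tay_injective (h2.trans ?_)⟩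
    · rw [tay_add, tay_mul, tay_dx, tay_dx]
    · rw [tay_add, tay_mul, tay_dy, tay_dy]

lemma exists_milnor (hf : Og.ev0 f = 0) (hμ : HasMilnorNumber f μ) :
    ∃ b : Fin μ → PS, Milnor (tay f) b := by
  obtain ⟨b, hb⟩ := hμ
  refine ⟨fun i => tay (b i), conv_tay f, by rw [coeff_zero_tay, hf], fun i => conv_tay _, ?_⟩
  intro u hu
  obtain ⟨u, rfl⟩ := exists_tay_eq hu
  have h : ∀ c : Fin μ → ℂ, InJ (tay f) (tay u - ∑ i, C (c i) * tay (b i)) ↔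
      u - ∑ i, Og.const (c i) * b i ∈ jacobianSet f := fun c => by
    rw [mem_jacobianSet_iff, tay_sub, tay_sum]
    simp only [tay_mul, tay_const]
  simpa only [h] using hb u

/-- The combination `∑ i, c i (f) • α i` of one-forms with coefficients in one-variable germs. -/
noncomputable def comb (f : Og (ℂ × ℂ)) (α : Fin μ → PS × PS) (c : Fin μ → Og ℂ) : PS × PS :=
  ∑ i, (tay (Og.comp (c i) f) * (α i).1, tay (Og.comp (c i) f) * (α i).2)

lemma comb_sub (hf : Og.ev0 f = 0) (α : Fin μ → PS × PS) (c d : Fin μ → Og ℂ) :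
    comb f α (c - d) = comb f α c - comb f α d := by
  rw [comb, comb, comb, ← Finset.sum_sub_distrib]
  refine Finset.sum_congr rfl fun i _ => ?_
  rw [Pi.sub_apply, comp_sub hf, tay_sub, sub_mul, sub_mul]; rfl

lemma comb_const_add_tvar_mul (hf : Og.ev0 f = 0) (α : Fin μ → PS × PS) {c d : Fin μ → Og ℂ}
    {a : Fin μ → ℂ} (h : ∀ i, c i = Og.const (a i) + tvar * d i) :
    comb f α c = ∑ i, a i • α i + (tay f * (comb f α d).1, tay f * (comb f α d).2) := by
  have h1 : (tay f * (comb f α d).1, tay f * (comb f α d).2) =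
      ∑ i, (tay f * (tay (Og.comp (d i) f) * (α i).1),
        tay f * (tay (Og.comp (d i) f) * (α i).2)) := by
    rw [comb, Prod.fst_sum, Prod.snd_sum, Finset.mul_sum, Finset.mul_sum]
    ext : 1
    · rw [Prod.fst_sum]
    · rw [Prod.snd_sum]
  rw [h1, comb, ← Finset.sum_add_distrib]
  refine Finset.sum_congr rfl fun i _ => ?_
  rw [h i, comp_const_add_tvar_mul hf, tay_add, tay_mul, tay_const]
  ext1
  · change _ = a i • (α i).1 + _
    rw [smul_eq_C_mul]; ring
  · change _ = a i • (α i).2 + _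
    rw [smul_eq_C_mul]; ring

lemma Division.Coc.comp_mul (hf : Og.ev0 f = 0) {α : PS × PS} (h : Coc (tay f) α) (c : Og ℂ) :
    Coc (tay f) (tay (Og.comp c f) * α.1, tay (Og.comp c f) * α.2) := by
  refine ⟨(conv_tay _).mul h.1, (conv_tay _).mul h.2.1, ?_⟩
  have hx : Dx (tay (Og.comp c f)) = tay (Og.comp (Og.pd 1 c) f) * Dx (tay f) := by
    rw [← tay_dx, Og.dx, pd_comp hf, tay_mul, tay_dx]
  have hy : Dy (tay (Og.comp c f)) = tay (Og.comp (Og.pd 1 c) f) * Dy (tay f) := by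
    rw [← tay_dy, Og.dy, pd_comp hf, tay_mul, tay_dy]
  have h1 : dform (tay (Og.comp c f) * α.1, tay (Og.comp c f) * α.2) =
      tay (Og.comp c f) * dform α + (tay (Og.comp (Og.pd 1 c) f) * α.2 * Dx (tay f)
        + (-(tay (Og.comp (Og.pd 1 c) f) * α.1)) * Dy (tay f)) := by
    rw [dform_apply, dform_apply, Dx_mul, Dy_mul, hx, hy]; ring
  rw [h1]
  exact (h.2.2.mul_left (conv_tay _)).add
    ⟨_, _, (conv_tay _).mul h.2.1, ((conv_tay _).mul h.1).neg, rfl⟩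

lemma coc_comb (hf : Og.ev0 f = 0) {α : Fin μ → PS × PS} (h : ∀ i, Coc (tay f) (α i))
    (c : Fin μ → Og ℂ) : Coc (tay f) (comb f α c) := by
  have := Coc.sum (s := Finset.univ) (fun _ : Fin μ => (1 : ℂ))
    fun i _ => (h i).comp_mul hf (c i)
  simpa only [one_smul, comb] using this

lemma tayPair_sub_sum (u : Og (ℂ × ℂ) × Og (ℂ × ℂ)) (e : Fin μ → Og (ℂ × ℂ) × Og (ℂ × ℂ))
    (c : Fin μ → Og ℂ) :
    tayPair (u - ∑ i, (Og.comp (c i) f * (e i).1, Og.comp (c i) f * (e i).2)) =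
      tayPair u - comb f (fun i => tayPair (e i)) c := by
  ext1
  · rw [tayPair, Prod.fst_sub, Prod.fst_sub, Prod.fst_sum, comb, Prod.fst_sum, tay_sub, tay_sum]
    simp only [tay_mul]; rfl
  · rw [tayPair, Prod.snd_sub, Prod.snd_sub, Prod.snd_sum, comb, Prod.snd_sum, tay_sub, tay_sum]
    simp only [tay_mul]; rfl

variable {b : Fin μ → PS} (D : Division (tay f) b)

lemma Psi_comb (M : Milnor (tay f) b) (hf : Og.ev0 f = 0) {α : Fin μ → PS × PS}
    (hα : ∀ i, Coc (tay f) (α i)) {c d : Fin μ → Og ℂ} {a : Fin μ → ℂ}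
    (h : ∀ i, c i = Og.const (a i) + tvar * d i) :
    D.Psi (comb f α c) = ∑ i, a i • D.Psi (α i) + Top D.A (D.Psi (comb f α d)) := by
  rw [comb_const_add_tvar_mul hf α h, map_add, map_sum, D.Psi_f_mul M (coc_comb hf hα d)]
  simp only [map_smul]

lemma Division.Coc.sub {F : PS} {α β : PS × PS} (hα : Coc F α) (hβ : Coc F β) : Coc F (α - β) :=
  ⟨hα.1.sub hβ.1, hα.2.1.sub hβ.2.1, by rw [map_sub]; exact hα.2.2.sub hβ.2.2⟩

lemma exists_Psi_comb_eq (M : Milnor (tay f) b) (hf : Og.ev0 f = 0) {α : Fin μ → PS × PS}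
    (hα : ∀ i, Coc (tay f) (α i)) {c : ℕ → Fin μ → ℂ} {w : ℕ → Sq μ} {K : ℝ≥0}
    (hc : ∀ n i, ‖c n i‖₊ ≤ K * K ^ n)
    (hw : ∀ n, w n = ∑ i, c n i • D.Psi (α i) + Top D.A (w (n + 1))) :
    ∃ d : Fin μ → Og ℂ, D.Psi (comb f α d) = w 0 := by
  choose ψ hψ using fun i => exists_germ_of_geometric fun n => hc n i
  set z : ℕ → Sq μ := fun n => w n - D.Psi (comb f α fun i => ψ i n) with hz
  have hstep : ∀ n, z n = Top D.A (z (n + 1)) := fun n => by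
    simp only [hz]
    rw [hw n, Psi_comb D M hf hα fun i => hψ i n, map_sub]; abel
  have hpow : ∀ n, z 0 = (Top D.A ^ n) (z n) := fun n => by
    induction n with
    | zero => rfl
    | succ n ih => rw [ih, hstep n, pow_succ, Module.End.mul_apply]
  have h0 : z 0 = 0 := eq_zero_of_iterate_Top (D.A_zero_nilpotent M) fun n => ⟨_, hpow n⟩
  exact ⟨fun i => ψ i 0, (sub_eq_zero.1 h0).symm⟩

lemma eq_zero_of_Psi_comb (M : Milnor (tay f) b) (hf : Og.ev0 f = 0) {α : Fin μ → PS × PS}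
    (hα : ∀ i, Coc (tay f) (α i))
    (hind : ∀ (c : Fin μ → ℂ) (x : Sq μ), Gev x →
      ∑ i, c i • D.Psi (α i) = Top D.A x → c = 0)
    {d : Fin μ → Og ℂ} (hd : D.Psi (comb f α d) = 0) : d = 0 := by
  have hstep : ∀ d : Fin μ → Og ℂ, D.Psi (comb f α d) = 0 →
      ∃ d' : Fin μ → Og ℂ, (∀ i, d i = tvar * d' i) ∧ D.Psi (comb f α d') = 0 := by
    intro d hd
    choose d' hd' using fun i => exists_eq_const_add (d i)
    rw [Psi_comb D M hf hα hd'] at hd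
    have ha := hind (-fun i => Og.ev0 (d i)) _ (D.gev_Psi (coc_comb hf hα d')) (by
      simp only [Pi.neg_apply, neg_smul, Finset.sum_neg_distrib]
      exact neg_eq_of_add_eq_zero_right hd)
    rw [neg_eq_zero] at ha
    have ha' : ∀ i, Og.ev0 (d i) = 0 := fun i => congrFun ha i
    refine ⟨d', fun i => ?_, D.Top_injective M (D.gev_Psi (coc_comb hf hα d')) ?_⟩
    · conv_lhs => rw [hd' i, ha', const_zero, zero_add]
    · simpa only [ha', zero_smul, Finset.sum_const_zero, zero_add] using hd
  have hpow : ∀ n, ∃ d' : Fin μ → Og ℂ, (∀ i, d i = tvar ^ n * d' i) ∧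
      D.Psi (comb f α d') = 0 := by
    intro n
    induction n with
    | zero => exact ⟨d, fun i => by rw [pow_zero, one_mul], hd⟩
    | succ n ih =>
      obtain ⟨d', h1, h2⟩ := ih
      obtain ⟨d'', h3, h4⟩ := hstep d' h2
      exact ⟨d'', fun i => by rw [h1, h3, pow_succ, mul_assoc], h4⟩
  funext i
  exact eq_zero_of_tvar_pow_dvd fun n => (hpow n).imp' (fun d' => d' i) fun d' h => h.1 i

end Transfer

end BrieskornLattice

open BrieskornLattice

/-- **The Brieskorn–Deligne theorem.**  For a holomorphic function germ
`f : (ℂ²,0) → (ℂ,0)` with an isolated critical point of Milnor number `μ`, the first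
cohomology `H_f` of the relative de Rham complex — cocycles modulo coboundaries — is a
free module of rank `μ` over `ℂ{t} = 𝒪₁`, where `t` acts as multiplication by `f`
(so `ψ ∈ 𝒪₁` acts as multiplication by `ψ ∘ f`): there exist `μ` cocycles whose classes
form a basis. -/
theorem brieskorn_deligne
    (f : Og (ℂ × ℂ)) (hf0 : Og.ev0 f = 0) (μ : ℕ) (hμ : HasMilnorNumber f μ) :
    ∃ e : Fin μ → Og (ℂ × ℂ) × Og (ℂ × ℂ),
      (∀ i, e i ∈ deRhamCocycles f) ∧
      ∀ u ∈ deRhamCocycles f, ∃! c : Fin μ → Og ℂ,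
        u - (∑ i, (Og.comp (c i) f * (e i).1, Og.comp (c i) f * (e i).2)) ∈
          deRhamCoboundaries f := by
  obtain ⟨b, M⟩ := exists_milnor hf0 hμ
  obtain ⟨D⟩ := M.exists_division
  obtain ⟨B, K, hA⟩ := D.exists_A_bound M
  obtain ⟨v, hv, hind, hex⟩ := exists_lattice_basis hA (D.A_zero_nilpotent M)
    fun v hv h => D.Top_injective M hv h
  choose α hα hαv using fun i => D.exists_Psi_eq M (hv i)
  simp only [← hαv] at hind hex
  choose e he using fun i => exists_tayPair_eq (hα i)
  refine ⟨e, fun i => mem_deRhamCocycles_iff.2 (by rw [he]; exact hα i), fun u hu => ?_⟩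
  rw [mem_deRhamCocycles_iff] at hu
  have key : ∀ c : Fin μ → Og ℂ,
      u - (∑ i, (Og.comp (c i) f * (e i).1, Og.comp (c i) f * (e i).2)) ∈ deRhamCoboundaries f ↔
        D.Psi (comb f α c) = D.Psi (tayPair u) := fun c => by
    rw [mem_deRhamCoboundaries_iff, tayPair_sub_sum, funext he]
    rw [eq_comm, ← sub_eq_zero, ← map_sub]
    exact ⟨D.Psi_of_cob M, D.cob_of_Psi_eq_zero M (hu.sub (coc_comb hf0 hα c))⟩
  simp only [key]
  obtain ⟨a, w, L, ha, hw0, -, hw⟩ := hex _ (D.gev_Psi hu)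
  obtain ⟨c, hc⟩ := exists_Psi_comb_eq D M hf0 hα ha hw
  refine ⟨c, hc.trans hw0, fun c' hc' => sub_eq_zero.1 ?_⟩
  refine eq_zero_of_Psi_comb D M hf0 hα hind ?_
  rw [comb_sub hf0, map_sub, hc', hc, hw0, sub_self]
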